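/- arXiv:1612.03408 — 4 statements merged into one kernel-verified Lean document; each statement's English description precedes it below -/
import Mathlib

section
/- Let A and B be commutative rings with unity, f : A → B a ring homomorphism, and J an ideal of B. Assume that A is Cohen-Macaulay in the sense of ideals and that kgr_A(𝔞, J) ≥ height 𝔞 for every ideal 𝔞 of A. Then kgr_{A⋈^f J}(𝔞^e, A⋈^f J) = kgr_A(𝔞, A) ≤ kgr_A(𝔞, J) for every ideal 𝔞 of A. -/
/-- The Koszul cochain differential of the complex `Hom(K_•(x), M)`, described explicitly:
the degree-`i` term is the module of `M`-valued functions on the `i`-element subsets of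
`Fin n`, and the differential is the usual alternating-sum formula. -/
noncomputable def koszulMap (A : Type*) [CommRing A] (M : Type*) [AddCommGroup M]
    [Module A M] {n : ℕ} (x : Fin n → A) (i : ℕ) :
    ({s : Finset (Fin n) // s.card = i} → M) →ₗ[A]
      ({s : Finset (Fin n) // s.card = i + 1} → M) where
  toFun g t := ∑ j ∈ t.1.attach,
    (((-1 : A) ^ ((t.1.filter (fun k => k < j.1)).card)) * x j.1) •
      g ⟨t.1.erase j.1, by
        rw [Finset.card_erase_of_mem j.2, t.2]; omega⟩

  map_add' g h := funext fun t => by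
    simp [smul_add, Finset.sum_add_distrib]
  map_smul' a g := funext fun t => by
    simp only [Pi.smul_apply, RingHom.id_apply, Finset.smul_sum]
    exact Finset.sum_congr rfl fun j _ => by
      rw [smul_smul, smul_smul, mul_comm]

/-- Nonvanishing of the `i`-th cohomology `H^i(Hom(K_•(x), M))` of the Koszul
cochain complex. -/
def koszulCohomologyNeZero (A : Type*) [CommRing A] (M : Type*) [AddCommGroup M]
    [Module A M] {n : ℕ} (x : Fin n → A) : ℕ → Prop
  | 0 => LinearMap.ker (koszulMap A M x 0) ≠ ⊥
  | (i + 1) => ¬ (LinearMap.ker (koszulMap A M x (i + 1)) ≤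
      LinearMap.range (koszulMap A M x i))

/-- The Koszul grade of a finite sequence `x` on `M`:
`inf { i : H^i(Hom(K_•(x), M)) ≠ 0 }` (an element of `ℕ∞`, equal to `⊤` if all
cohomology vanishes). -/
noncomputable def kgrSeq (A : Type*) [CommRing A] (M : Type*) [AddCommGroup M]
    [Module A M] {n : ℕ} (x : Fin n → A) : ℕ∞ :=
  sInf {i : ℕ∞ | ∃ k : ℕ, i = k ∧ koszulCohomologyNeZero A M x k}

/-- The Koszul grade `kgr_A(𝔞, M)` of an arbitrary ideal `𝔞` on `M`: the supremum of the
Koszul grades of finite sequences contained in `𝔞` (equivalently, of the finitely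
generated subideals of `𝔞`). -/
noncomputable def kgr (A : Type*) [CommRing A] (𝔞 : Ideal A) (M : Type*)
    [AddCommGroup M] [Module A M] : ℕ∞ :=
  ⨆ (n : ℕ) (x : Fin n → A) (_ : ∀ j, x j ∈ 𝔞), kgrSeq A M x

/-- The height of an ideal: the infimum of the heights of the primes containing it. -/
noncomputable def idealHeight (A : Type*) [CommRing A] (𝔞 : Ideal A) : ℕ∞ :=
  ⨅ (p : PrimeSpectrum A) (_ : 𝔞 ≤ p.asIdeal), Order.height p

/-- A commutative ring `R` is Cohen-Macaulay in the sense of a class `𝒜` of ideals if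
`height 𝔞 = kgr_R(𝔞, R)` for every `𝔞 ∈ 𝒜`. -/
def IsCMSense (R : Type*) [CommRing R] (𝒜 : Set (Ideal R)) : Prop :=
  ∀ 𝔞 ∈ 𝒜, idealHeight R 𝔞 = kgr R 𝔞 R

/-- Cohen-Macaulay in the sense of ideals. -/
def IsCMIdeals (R : Type*) [CommRing R] : Prop :=
  ∀ 𝔞 : Ideal R, idealHeight R 𝔞 = kgr R 𝔞 R

/-- Cohen-Macaulay in the sense of maximal ideals. -/
def IsCMMaximal (R : Type*) [CommRing R] : Prop :=
  ∀ 𝔪 : Ideal R, 𝔪.IsMaximal → idealHeight R 𝔪 = kgr R 𝔪 R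

/-- The amalgamation `A ⋈^f J = {(a, f a + j) : a ∈ A, j ∈ J}` of `A` with `B` along the
ideal `J` of `B` with respect to `f : A →+* B`, as a subring of `A × B`. -/
def amalgamation {A B : Type*} [CommRing A] [CommRing B] (f : A →+* B) (J : Ideal B) :
    Subring (A × B) where
  carrier := {p | p.2 - f p.1 ∈ J}
  zero_mem' := by simp
  one_mem' := by simp
  add_mem' := fun {p q} hp hq => by
    have := J.add_mem hp hq
    simpa [add_sub_add_comm] using this
  neg_mem' := fun {p} hp => by
    show (-p).2 - f ((-p).1) ∈ J
    have key : (-p).2 - f ((-p).1) = -(p.2 - f p.1) := by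
      simp only [Prod.fst_neg, Prod.snd_neg, map_neg]; ring
    rw [key]
    exact J.neg_mem hp
  mul_mem' := fun {p q} hp hq => by
    show (p * q).2 - f ((p * q).1) ∈ J
    have key : (p * q).2 - f ((p * q).1)
        = p.2 * (q.2 - f q.1) + (p.2 - f p.1) * f q.1 := by
      simp only [Prod.fst_mul, Prod.snd_mul, map_mul]; ring
    rw [key]
    exact J.add_mem (J.mul_mem_left _ hq) (J.mul_mem_right _ hp)

/-- The natural embedding `ι_A : A → A ⋈^f J`, `a ↦ (a, f a)`. -/
def amalgIota {A B : Type*} [CommRing A] [CommRing B] (f : A →+* B) (J : Ideal B) :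
    A →+* amalgamation f J where
  toFun a := ⟨(a, f a), show (a, f a).2 - f (a, f a).1 ∈ J by simp⟩
  map_one' := Subtype.ext (by simp)
  map_mul' a b := Subtype.ext (by simp)
  map_zero' := Subtype.ext (by simp)
  map_add' a b := Subtype.ext (by simp)

/-- The extension `𝔞^e = 𝔞(A ⋈^f J)` of an ideal `𝔞` of `A` along `ι_A`. -/
noncomputable def idealExt {A B : Type*} [CommRing A] [CommRing B] (f : A →+* B)
    (J : Ideal B) (𝔞 : Ideal A) : Ideal ↥(amalgamation f J) :=
  Ideal.map (amalgIota f J) 𝔞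

/-- `kgr_A(𝔞, J)` where the ideal `J` of `B` is viewed as an `A`-module via `f`. -/
noncomputable def kgrIdeal {A B : Type*} [CommRing A] [CommRing B] (f : A →+* B)
    (J : Ideal B) (𝔞 : Ideal A) : ℕ∞ :=
  letI : Module A J := Module.compHom J f
  kgr A 𝔞 J

/-- The ideal `𝔭'^f = 𝔭 ⋈^f J = {(p, f p + j) : p ∈ 𝔭, j ∈ J}` of `A ⋈^f J`. -/
def primeAmalg {A B : Type*} [CommRing A] [CommRing B] (f : A →+* B) (J : Ideal B)
    (𝔭 : Ideal A) : Ideal ↥(amalgamation f J) where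
  carrier := {z | (z : A × B).1 ∈ 𝔭}
  zero_mem' := by simp
  add_mem' := fun {a b} ha hb => 𝔭.add_mem ha hb
  smul_mem' := fun c {z} hz => 𝔭.mul_mem_left (c : A × B).1 hz

/-- The ideal `𝔮̄^f = {(a, f a + j) : a ∈ A, j ∈ J, f a + j ∈ 𝔮}` of `A ⋈^f J`. -/
def qbarAmalg {A B : Type*} [CommRing A] [CommRing B] (f : A →+* B) (J : Ideal B)
    (𝔮 : Ideal B) : Ideal ↥(amalgamation f J) where
  carrier := {z | (z : A × B).2 ∈ 𝔮}
  zero_mem' := by simp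
  add_mem' := fun {a b} ha hb => 𝔮.add_mem ha hb
  smul_mem' := fun c {z} hz => 𝔮.mul_mem_left (c : A × B).2 hz

/-- A ring homomorphism `f : A →+* B` satisfies the going-down property. -/
def RingHom.GoesDown {A B : Type*} [CommRing A] [CommRing B] (f : A →+* B) : Prop :=
  ∀ (𝔭' 𝔭 : Ideal A), 𝔭'.IsPrime → 𝔭.IsPrime → 𝔭' ≤ 𝔭 →
    ∀ 𝔮 : Ideal B, 𝔮.IsPrime → 𝔮.comap f = 𝔭 →
      ∃ 𝔮' : Ideal B, 𝔮'.IsPrime ∧ 𝔮' ≤ 𝔮 ∧ 𝔮'.comap f = 𝔭'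

namespace Koszul

universe u v

/-- A module with an endomorphism and a family of submodules, of which complexes of modules
are the main example: `d` is the differential and `deg i` the module of elements of
degree `i`. -/
structure GradedDiff (A : Type u) [CommRing A] where
  /-- The underlying module. -/
  carrier : Type v
  [addCommGroup : AddCommGroup carrier]
  [module : Module A carrier]
  /-- The differential. -/
  d : carrier →ₗ[A] carrier
  /-- The elements of degree `i`. -/
  deg : ℤ → Submodule A carrier

attribute [instance] GradedDiff.addCommGroup GradedDiff.module

namespace GradedDiff

variable {A : Type u} [CommRing A]

/-- Exactness in degree `i`. -/
def ExactAt (C : GradedDiff.{u, v} A) (i : ℤ) : Prop :=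
  ∀ g ∈ C.deg i, C.d g = 0 → ∃ h ∈ C.deg (i - 1), C.d h = g

/-- Exactness in all degrees smaller than `k`. -/
def ExactBelow (C : GradedDiff.{u, v} A) (k : ℤ) : Prop :=
  ∀ i < k, C.ExactAt i

/-- The shifted mapping cone of multiplication by `a`. -/
abbrev cone (a : A) (C : GradedDiff.{u, v} A) : GradedDiff.{u, v} A where
  carrier := C.carrier × C.carrier
  d := (C.d ∘ₗ LinearMap.fst A _ _).prod
    (a • LinearMap.fst A _ _ - C.d ∘ₗ LinearMap.snd A _ _)
  deg i := (C.deg i).prod (C.deg (i - 1))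

theorem cone_d (a : A) (C : GradedDiff.{u, v} A) (g₀ g₁ : C.carrier) :
    (cone a C).d (g₀, g₁) = (C.d g₀, a • g₀ - C.d g₁) := rfl

theorem mem_cone_deg (a : A) (C : GradedDiff.{u, v} A) (i : ℤ) (g₀ g₁ : C.carrier) :
    ((g₀, g₁) : C.carrier × C.carrier) ∈ (cone a C).deg i ↔
      g₀ ∈ C.deg i ∧ g₁ ∈ C.deg (i - 1) := Iff.rfl

/-- Multiplication by `a` is null-homotopic. -/
def IsNull (C : GradedDiff.{u, v} A) (a : A) : Prop :=
  ∃ σ : C.carrier →ₗ[A] C.carrier,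
    (∀ i, ∀ g ∈ C.deg i, σ g ∈ C.deg (i - 1)) ∧ ∀ g, C.d (σ g) + σ (C.d g) = a • g

/-- The ideal of the elements acting null-homotopically. -/
def nullIdeal (C : GradedDiff.{u, v} A) : Ideal A where
  carrier := {a | C.IsNull a}
  zero_mem' := ⟨0, by simp, by simp⟩
  add_mem' := by
    rintro a b ⟨σ, hσ, h⟩ ⟨τ, hτ, h'⟩
    refine ⟨σ + τ, fun i g hg => add_mem (hσ i g hg) (hτ i g hg), fun g => ?_⟩
    rw [add_smul, ← h, ← h']
    simp only [LinearMap.add_apply, map_add]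
    abel
  smul_mem' := by
    rintro c a ⟨σ, hσ, h⟩
    refine ⟨c • σ, fun i g hg => Submodule.smul_mem _ c (hσ i g hg), fun g => ?_⟩
    rw [smul_eq_mul, mul_smul, ← h]
    simp

theorem self_mem_nullIdeal_cone (a : A) (C : GradedDiff.{u, v} A) :
    a ∈ (cone a C).nullIdeal := by
  refine ⟨(LinearMap.snd A C.carrier C.carrier).prod 0, ?_, ?_⟩
  · rintro i ⟨g₀, g₁⟩ hg
    exact ⟨hg.2, zero_mem _⟩
  · rintro ⟨g₀, g₁⟩
    change (C.d g₁ + (a • g₀ - C.d g₁), a • g₁ - C.d 0 + 0) = (a • g₀, a • g₁)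
    simp

theorem nullIdeal_le_nullIdeal_cone (a : A) (C : GradedDiff.{u, v} A) :
    C.nullIdeal ≤ (cone a C).nullIdeal := by
  rintro b ⟨σ, hσ, h⟩
  refine ⟨σ.prodMap (-σ), ?_, ?_⟩
  · rintro i ⟨g₀, g₁⟩ hg
    exact ⟨hσ _ _ hg.1, neg_mem (hσ _ _ hg.2)⟩
  · rintro ⟨g₀, g₁⟩
    change (C.d (σ g₀), a • σ g₀ - C.d (-σ g₁)) +
      (σ (C.d g₀), -σ (a • g₀ - C.d g₁)) = (b • g₀, b • g₁)
    rw [← h, ← h]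
    refine Prod.ext rfl ?_
    simp only [map_neg, map_sub, map_smul, Prod.mk_add_mk]
    abel

theorem ExactBelow.cone {C : GradedDiff.{u, v} A} {k : ℤ} (hC : C.ExactBelow k) (a : A) :
    (cone a C).ExactBelow k := by
  rintro i hi ⟨g₀, g₁⟩ hg hd
  rw [mem_cone_deg] at hg
  rw [cone_d] at hd
  obtain ⟨h₀, hh₀, rfl⟩ := hC i hi g₀ hg.1 (congrArg Prod.fst hd)
  have hd₁ : a • C.d h₀ - C.d g₁ = 0 := congrArg Prod.snd hd
  obtain ⟨h₁, hh₁, e⟩ := hC (i - 1) (by omega) (a • h₀ - g₁)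
    (sub_mem (Submodule.smul_mem _ _ hh₀) hg.2) (by simpa using hd₁)
  refine ⟨(h₀, h₁), ⟨hh₀, hh₁⟩, ?_⟩
  rw [cone_d, e, sub_sub_cancel]

theorem ExactBelow.of_cone {C : GradedDiff.{u, v} A} {k : ℤ} {a : A}
    (hC : (GradedDiff.cone a C).ExactBelow k) (ha : a ∈ C.nullIdeal) : C.ExactBelow k := by
  intro i hi g hg hd
  obtain ⟨σ, hσ, h⟩ := ha
  have hσd : a • g - C.d (σ g) = 0 := by
    rw [← h, hd]
    simp
  obtain ⟨⟨h₀, h₁⟩, hh, e⟩ := hC i hi (g, σ g) ⟨hg, hσ i g hg⟩ (by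
    rw [cone_d, hd, hσd]
    rfl)
  exact ⟨h₀, hh.1, congrArg Prod.fst e⟩

/-- Isomorphism of graded modules with differential. -/
def Isomorphic (C C' : GradedDiff.{u, v} A) : Prop :=
  ∃ e : C.carrier ≃ₗ[A] C'.carrier,
    (∀ g, e (C.d g) = C'.d (e g)) ∧ ∀ i g, e g ∈ C'.deg i ↔ g ∈ C.deg i

theorem Isomorphic.refl (C : GradedDiff.{u, v} A) : Isomorphic C C :=
  ⟨LinearEquiv.refl A _, fun _ => rfl, fun _ _ => Iff.rfl⟩

theorem Isomorphic.symm {C C' : GradedDiff.{u, v} A} (h : Isomorphic C C') :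
    Isomorphic C' C := by
  obtain ⟨e, hd, hdeg⟩ := h
  refine ⟨e.symm, fun g => ?_, fun i g => ?_⟩
  · rw [LinearEquiv.symm_apply_eq, hd, e.apply_symm_apply]
  · rw [← hdeg, e.apply_symm_apply]

theorem Isomorphic.trans {C C' C'' : GradedDiff.{u, v} A} (h : Isomorphic C C')
    (h' : Isomorphic C' C'') : Isomorphic C C'' := by
  obtain ⟨e, hd, hdeg⟩ := h
  obtain ⟨e', hd', hdeg'⟩ := h'
  exact ⟨e.trans e', fun g => by simp [hd, hd'], fun i g => by simp [hdeg, hdeg']⟩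

theorem Isomorphic.cone {C C' : GradedDiff.{u, v} A} (h : Isomorphic C C') (a : A) :
    Isomorphic (cone a C) (cone a C') := by
  obtain ⟨e, hd, hdeg⟩ := h
  refine ⟨e.prodCongr e, ?_, ?_⟩
  · rintro ⟨g₀, g₁⟩
    change (e (C.d g₀), e (a • g₀ - C.d g₁)) = (C'.d (e g₀), a • e g₀ - C'.d (e g₁))
    simp [hd]
  · rintro i ⟨g₀, g₁⟩
    exact and_congr (hdeg _ _) (hdeg _ _)

theorem Isomorphic.exactBelow {C C' : GradedDiff.{u, v} A} (h : Isomorphic C C') {k : ℤ}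
    (hC : C.ExactBelow k) : C'.ExactBelow k := by
  obtain ⟨e, hd, hdeg⟩ := h.symm
  intro i hi g hg hg0
  obtain ⟨y, hy, hy'⟩ := hC i hi (e g) ((hdeg i g).2 hg) (by rw [← hd, hg0, map_zero])
  refine ⟨e.symm y, ?_, ?_⟩
  · rw [← hdeg, e.apply_symm_apply]
    exact hy
  · apply e.injective
    rw [hd, e.apply_symm_apply, hy']

/-- Swapping the two middle components of the double cone, with a sign on the last one. -/
theorem cone_cone_isomorphic (a b : A) (C : GradedDiff.{u, v} A) :
    Isomorphic (cone a (cone b C)) (cone b (cone a C)) := by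
  let e : ((C.carrier × C.carrier) × C.carrier × C.carrier) ≃ₗ[A]
      ((C.carrier × C.carrier) × C.carrier × C.carrier) :=
    { toFun := fun g => ((g.1.1, g.2.1), (g.1.2, -g.2.2))
      invFun := fun g => ((g.1.1, g.2.1), (g.1.2, -g.2.2))
      map_add' := fun g h => by simp [add_comm]
      map_smul' := fun c g => by simp
      left_inv := fun g => by simp
      right_inv := fun g => by simp }
  refine ⟨e, ?_, ?_⟩
  · rintro ⟨⟨g₀₀, g₀₁⟩, g₁₀, g₁₁⟩
    change ((C.d g₀₀, a • g₀₀ - C.d g₁₀),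
        (b • g₀₀ - C.d g₀₁, -(a • g₀₁ - (b • g₁₀ - C.d g₁₁)))) =
      ((C.d g₀₀, a • g₀₀ - C.d g₁₀),
        (b • g₀₀ - C.d g₀₁, b • g₁₀ - (a • g₀₁ - C.d (-g₁₁))))
    refine Prod.ext rfl (Prod.ext rfl ?_)
    simp only [map_neg]
    abel
  · rintro i ⟨⟨g₀₀, g₀₁⟩, g₁₀, g₁₁⟩
    change ((g₀₀ ∈ C.deg i ∧ g₁₀ ∈ C.deg (i - 1)) ∧
        g₀₁ ∈ C.deg (i - 1) ∧ -g₁₁ ∈ C.deg (i - 1 - 1)) ↔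
      ((g₀₀ ∈ C.deg i ∧ g₀₁ ∈ C.deg (i - 1)) ∧
        g₁₀ ∈ C.deg (i - 1) ∧ g₁₁ ∈ C.deg (i - 1 - 1))
    rw [neg_mem_iff]
    exact and_and_and_comm

/-- The iterated cone along a list of scalars. -/
def iterCone (C : GradedDiff.{u, v} A) (l : List A) : GradedDiff.{u, v} A :=
  l.foldr cone C

theorem iterCone_isomorphic_of_perm (C : GradedDiff.{u, v} A) {l l' : List A}
    (h : l.Perm l') : Isomorphic (C.iterCone l) (C.iterCone l') := by
  induction h with
  | nil => exact .refl _
  | cons a _ ih => exact ih.cone a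
  | swap a b l => exact cone_cone_isomorphic b a _
  | trans _ _ ih ih' => exact ih.trans ih'

theorem ExactBelow.iterCone {C : GradedDiff.{u, v} A} {k : ℤ} (hC : C.ExactBelow k)
    (l : List A) : (C.iterCone l).ExactBelow k := by
  induction l with
  | nil => exact hC
  | cons a l ih => exact ih.cone a

theorem nullIdeal_le_nullIdeal_iterCone (C : GradedDiff.{u, v} A) (l : List A) :
    C.nullIdeal ≤ (C.iterCone l).nullIdeal := by
  induction l with
  | nil => exact le_rfl
  | cons a l ih => exact ih.trans (nullIdeal_le_nullIdeal_cone a _)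

theorem mem_nullIdeal_iterCone (C : GradedDiff.{u, v} A) {l : List A} {a : A} (ha : a ∈ l) :
    a ∈ (C.iterCone l).nullIdeal := by
  induction l with
  | nil => simp at ha
  | cons b l ih =>
    rcases List.mem_cons.1 ha with rfl | h
    · exact self_mem_nullIdeal_cone _ _
    · exact nullIdeal_le_nullIdeal_cone _ _ (ih h)

theorem ExactBelow.of_iterCone {C : GradedDiff.{u, v} A} {k : ℤ} {l : List A}
    (hC : (C.iterCone l).ExactBelow k) (hl : ∀ a ∈ l, a ∈ C.nullIdeal) :
    C.ExactBelow k := by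
  induction l with
  | nil => exact hC
  | cons a l ih =>
    exact ih (hC.of_cone (nullIdeal_le_nullIdeal_iterCone C l (hl a (by simp))))
      fun b hb => hl b (List.mem_cons_of_mem a hb)

theorem ExactBelow.iterCone_of_subset_span {C : GradedDiff.{u, v} A} {k : ℤ} {l l' : List A}
    (hC : (C.iterCone l').ExactBelow k) (h : ∀ a ∈ l', a ∈ Ideal.span {b | b ∈ l}) :
    (C.iterCone l).ExactBelow k := by
  have h₁ : (C.iterCone (l' ++ l)).ExactBelow k := by
    refine (iterCone_isomorphic_of_perm C List.perm_append_comm).exactBelow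
      (C := C.iterCone (l ++ l')) ?_
    simpa only [GradedDiff.iterCone, List.foldr_append] using hC.iterCone l
  have h₂ : ((C.iterCone l).iterCone l').ExactBelow k := by
    simpa only [GradedDiff.iterCone, List.foldr_append] using h₁
  exact h₂.of_iterCone fun a ha =>
    Ideal.span_le.2 (fun b hb => mem_nullIdeal_iterCone C hb) (h a ha)

end GradedDiff

section Cochains

variable {A : Type u} [CommRing A] {M : Type v} [AddCommGroup M] [Module A M]

/-- The Koszul differential on functions defined on all finite subsets of `Fin n`. -/
def diff (M : Type v) [AddCommGroup M] [Module A M] {n : ℕ} (x : Fin n → A) :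
    (Finset (Fin n) → M) →ₗ[A] (Finset (Fin n) → M) where
  toFun g t := ∑ j ∈ t, ((-1 : A) ^ ((t.filter (fun k => k < j)).card) * x j) • g (t.erase j)
  map_add' g h := funext fun t => by
    simp [smul_add, Finset.sum_add_distrib]
  map_smul' a g := funext fun t => by
    simp only [Pi.smul_apply, RingHom.id_apply, Finset.smul_sum]
    exact Finset.sum_congr rfl fun j _ => smul_comm _ _ _

theorem diff_apply {n : ℕ} (x : Fin n → A) (g : Finset (Fin n) → M) (t : Finset (Fin n)) :
    diff M x g t =
      ∑ j ∈ t, ((-1 : A) ^ ((t.filter (fun k => k < j)).card) * x j) • g (t.erase j) := rfl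

/-- The total Koszul complex of a finite sequence with values in a module. -/
abbrev cochains (M : Type v) [AddCommGroup M] [Module A M] {n : ℕ} (x : Fin n → A) :
    GradedDiff.{u, v} A where
  carrier := Finset (Fin n) → M
  d := diff M x
  deg i :=
    { carrier := {g | ∀ s : Finset (Fin n), (s.card : ℤ) ≠ i → g s = 0}
      zero_mem' := fun _ _ => rfl
      add_mem' := fun {g h} hg hh s hs => by simp [hg s hs, hh s hs]
      smul_mem' := fun a g hg s hs => by simp [hg s hs] }

theorem mem_cochains_deg {n : ℕ} (x : Fin n → A) (i : ℤ) (g : Finset (Fin n) → M) :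
    g ∈ (cochains M x).deg i ↔ ∀ s : Finset (Fin n), (s.card : ℤ) ≠ i → g s = 0 := Iff.rfl

/-- The subset of `Fin n` obtained from a subset of `Fin (n + 1)` by deleting `0` and
shifting. -/
def unshift {n : ℕ} (t : Finset (Fin (n + 1))) : Finset (Fin n) :=
  Finset.univ.filter fun j => j.succ ∈ t

theorem unshift_map {n : ℕ} (s : Finset (Fin n)) : unshift (s.map (Fin.succEmb n)) = s := by
  ext j
  simp [unshift]

theorem unshift_insert {n : ℕ} (s : Finset (Fin n)) :
    unshift (insert 0 (s.map (Fin.succEmb n))) = s := by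
  ext j
  simp [unshift]

theorem map_unshift {n : ℕ} {t : Finset (Fin (n + 1))} (ht : 0 ∉ t) :
    (unshift t).map (Fin.succEmb n) = t := by
  ext j
  refine Fin.cases ?_ (fun j => ?_) j
  · simp [ht]
  · simp [unshift]

theorem insert_map_unshift {n : ℕ} {t : Finset (Fin (n + 1))} (ht : 0 ∈ t) :
    insert 0 ((unshift t).map (Fin.succEmb n)) = t := by
  ext j
  refine Fin.cases ?_ (fun j => ?_) j
  · simp [ht]
  · simp [unshift]

theorem zero_notMem_map_succ {n : ℕ} (s : Finset (Fin n)) :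
    (0 : Fin (n + 1)) ∉ s.map (Fin.succEmb n) := by
  simp

/-- Splitting a cochain according to whether the subset contains `0`. -/
def splitEquiv (A : Type u) [CommRing A] (M : Type v) [AddCommGroup M] [Module A M] (n : ℕ) :
    (Finset (Fin (n + 1)) → M) ≃ₗ[A] (Finset (Fin n) → M) × (Finset (Fin n) → M) where
  toFun g := (fun s => g (s.map (Fin.succEmb n)),
    fun s => g (insert 0 (s.map (Fin.succEmb n))))
  invFun g t := if 0 ∈ t then g.2 (unshift t) else g.1 (unshift t)
  map_add' _ _ := rfl
  map_smul' _ _ := rfl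
  left_inv g := by
    funext t
    by_cases ht : 0 ∈ t
    · simp only [ht, if_true, insert_map_unshift ht]
    · simp only [ht, if_false, map_unshift ht]
  right_inv g := by
    refine Prod.ext (funext fun s => ?_) (funext fun s => ?_)
    · simp only [zero_notMem_map_succ, if_false, unshift_map]
    · simp only [Finset.mem_insert_self, if_true, unshift_insert]

theorem erase_map_succ {n : ℕ} (s : Finset (Fin n)) (j : Fin n) :
    (s.map (Fin.succEmb n)).erase j.succ = (s.erase j).map (Fin.succEmb n) := by
  rw [Finset.map_erase]
  rfl

theorem filter_lt_map_succ {n : ℕ} (s : Finset (Fin n)) (j : Fin n) :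
    (s.map (Fin.succEmb n)).filter (fun k => k < j.succ) =
      (s.filter fun k => k < j).map (Fin.succEmb n) := by
  ext k
  refine Fin.cases ?_ (fun k => ?_) k <;> simp

theorem diff_map_succ {n : ℕ} (x : Fin (n + 1) → A) (g : Finset (Fin (n + 1)) → M)
    (s : Finset (Fin n)) :
    diff M x g (s.map (Fin.succEmb n)) =
      diff M (Fin.tail x) (fun s => g (s.map (Fin.succEmb n))) s := by
  rw [diff_apply, diff_apply, Finset.sum_map]
  refine Finset.sum_congr rfl fun j _ => ?_
  rw [Fin.coe_succEmb, erase_map_succ, filter_lt_map_succ, Finset.card_map]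
  rfl

theorem diff_insert_zero {n : ℕ} (x : Fin (n + 1) → A) (g : Finset (Fin (n + 1)) → M)
    (s : Finset (Fin n)) :
    diff M x g (insert 0 (s.map (Fin.succEmb n))) =
      x 0 • g (s.map (Fin.succEmb n)) -
        diff M (Fin.tail x) (fun s => g (insert 0 (s.map (Fin.succEmb n)))) s := by
  rw [diff_apply, diff_apply, Finset.sum_insert (zero_notMem_map_succ s), Finset.sum_map,
    sub_eq_add_neg, ← Finset.sum_neg_distrib]
  congr 1
  · rw [Finset.erase_insert (zero_notMem_map_succ s)]
    simp
  · refine Finset.sum_congr rfl fun j _ => ?_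
    rw [Fin.coe_succEmb, Finset.erase_insert_of_ne (Fin.succ_ne_zero j).symm, erase_map_succ,
      Finset.filter_insert, if_pos (Fin.succ_pos j), filter_lt_map_succ,
      Finset.card_insert_of_notMem (zero_notMem_map_succ _), Finset.card_map, ← neg_smul]
    congr 1
    rw [pow_succ, Fin.tail]
    ring

theorem cochains_succ_isomorphic {n : ℕ} (x : Fin (n + 1) → A) :
    (cochains M x).Isomorphic ((cochains M (Fin.tail x)).cone (x 0)) := by
  refine ⟨splitEquiv A M n, fun g => ?_, fun i g => ?_⟩
  · exact Prod.ext (funext fun s => diff_map_succ x g s) (funext fun s => diff_insert_zero x g s)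
  · change (∀ s : Finset (Fin n), _ → g (s.map (Fin.succEmb n)) = 0) ∧
      (∀ s : Finset (Fin n), _ → g (insert 0 (s.map (Fin.succEmb n))) = 0) ↔ _
    constructor
    · rintro ⟨h₀, h₁⟩ t ht
      by_cases h : 0 ∈ t
      · rw [← insert_map_unshift h] at ht ⊢
        rw [Finset.card_insert_of_notMem (zero_notMem_map_succ _), Finset.card_map] at ht
        exact h₁ _ (by push_cast at ht; omega)
      · rw [← map_unshift h] at ht ⊢
        rw [Finset.card_map] at ht
        exact h₀ _ ht
    · refine fun h => ⟨fun s hs => h _ ?_, fun s hs => h _ ?_⟩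
      · rwa [Finset.card_map]
      · rw [Finset.card_insert_of_notMem (zero_notMem_map_succ _), Finset.card_map]
        push_cast
        omega

theorem cochains_isomorphic_iterCone {n : ℕ} (x : Fin n → A) :
    (cochains M x).Isomorphic
      ((cochains M (Fin.elim0 : Fin 0 → A)).iterCone (List.ofFn x)) := by
  induction n with
  | zero =>
    rw [Subsingleton.elim x Fin.elim0, List.ofFn_zero]
    exact .refl _
  | succ n ih =>
    rw [List.ofFn_succ]
    exact (cochains_succ_isomorphic x).trans ((ih (Fin.tail x)).cone (x 0))

theorem exactBelow_cochains_of_mem_span {m n : ℕ} {x : Fin n → A} {y : Fin m → A} {k : ℤ}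
    (hy : (cochains M y).ExactBelow k) (h : ∀ j, y j ∈ Ideal.span (Set.range x)) :
    (cochains M x).ExactBelow k := by
  refine (cochains_isomorphic_iterCone x).symm.exactBelow
    (((cochains_isomorphic_iterCone y).exactBelow hy).iterCone_of_subset_span fun a ha => ?_)
  obtain ⟨j, rfl⟩ := (List.mem_ofFn' _ _).1 ha
  convert h j using 2
  ext b
  exact List.mem_ofFn' _ _

theorem exactAt_cochains_of_neg {n : ℕ} (x : Fin n → A) {i : ℤ} (hi : i < 0) :
    (cochains M x).ExactAt i := by
  refine fun g hg _ => ⟨0, zero_mem _, ?_⟩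
  rw [map_zero]
  exact funext fun s => ((mem_cochains_deg x i g).1 hg s (by omega)).symm

/-- Extension by zero of a cochain of degree `i`. -/
def extend {n i : ℕ} (g : {s : Finset (Fin n) // s.card = i} → M) : Finset (Fin n) → M :=
  fun s => if h : s.card = i then g ⟨s, h⟩ else 0

theorem extend_coe {n i : ℕ} (g : {s : Finset (Fin n) // s.card = i} → M)
    (s : {s : Finset (Fin n) // s.card = i}) : extend g s.1 = g s := by
  simp [extend, s.2]

theorem extend_mem_deg {n i : ℕ} (x : Fin n → A)
    (g : {s : Finset (Fin n) // s.card = i} → M) : extend g ∈ (cochains M x).deg i := by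
  intro s hs
  exact dif_neg fun h => hs (by rw [h])

theorem extend_restrict {n i : ℕ} {x : Fin n → A} {g : Finset (Fin n) → M}
    (hg : g ∈ (cochains M x).deg i) :
    extend (fun s : {s : Finset (Fin n) // s.card = i} => g s.1) = g := by
  funext s
  by_cases h : s.card = i
  · simp [extend, h]
  · rw [(mem_cochains_deg x i g).1 hg s (by exact_mod_cast h)]
    simp [extend, h]

theorem diff_extend {n i : ℕ} (x : Fin n → A) (g : {s : Finset (Fin n) // s.card = i} → M) :
    diff M x (extend g) = extend (koszulMap A M x i g) := by
  funext t
  rw [diff_apply]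
  by_cases h : t.card = i + 1
  · simp only [extend, h, dif_pos]
    rw [← Finset.sum_attach]
    refine Finset.sum_congr rfl fun j _ => ?_
    rw [dif_pos]
  · rw [extend, dif_neg h]
    refine Finset.sum_eq_zero fun j hj => ?_
    have := Finset.card_erase_add_one hj
    rw [extend, dif_neg (by omega), smul_zero]

theorem extend_injective {n i : ℕ} :
    Function.Injective (extend : ({s : Finset (Fin n) // s.card = i} → M) → _) := by
  intro g h e
  funext s
  rw [← extend_coe g, e, extend_coe]

theorem extend_zero {n i : ℕ} :
    extend (0 : {s : Finset (Fin n) // s.card = i} → M) = 0 := by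
  funext s
  simp [extend]

theorem exactAt_cochains_iff {n : ℕ} (x : Fin n → A) (i : ℕ) :
    (cochains M x).ExactAt i ↔ ¬ koszulCohomologyNeZero A M x i := by
  have hker : ∀ g : {s : Finset (Fin n) // s.card = i} → M,
      diff M x (extend g) = 0 ↔ g ∈ LinearMap.ker (koszulMap A M x i) := fun g => by
    rw [diff_extend, LinearMap.mem_ker, ← extend_injective.eq_iff, extend_zero]
  have hex : (cochains M x).ExactAt i ↔
      ∀ g ∈ LinearMap.ker (koszulMap A M x i),
        ∃ h ∈ (cochains M x).deg (i - 1 : ℤ), diff M x h = extend g := by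
    refine ⟨fun H g hg => H _ (extend_mem_deg x g) ((hker g).2 hg), fun H g hg hd => ?_⟩
    have hd' : diff M x g = 0 := hd
    rw [← extend_restrict hg] at hd' ⊢
    exact H _ ((hker _).1 hd')
  rw [hex]
  cases i with
  | zero =>
    rw [koszulCohomologyNeZero, not_not, LinearMap.ker_eq_bot']
    refine forall_congr' fun g => imp_congr LinearMap.mem_ker ⟨?_, ?_⟩
    · rintro ⟨h, hh, e⟩
      have h0 : h = 0 := funext fun s => (mem_cochains_deg x _ h).1 hh s (by push_cast; omega)
      rw [h0, map_zero] at e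
      exact extend_injective (by rw [← e, extend_zero])
    · rintro rfl
      exact ⟨0, zero_mem _, by rw [map_zero, extend_zero]⟩
  | succ i =>
    rw [koszulCohomologyNeZero, not_not]
    refine forall_congr' fun g => imp_congr Iff.rfl ⟨?_, ?_⟩
    · rintro ⟨h, hh, e⟩
      rw [show (((i + 1 : ℕ) : ℤ) - 1) = i by push_cast; ring] at hh
      refine ⟨fun s => h s.1, extend_injective ?_⟩
      rw [← diff_extend, extend_restrict hh, e]
    · rintro ⟨h, rfl⟩
      refine ⟨extend h, ?_, diff_extend x h⟩
      rw [show (((i + 1 : ℕ) : ℤ) - 1) = i by push_cast; ring]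
      exact extend_mem_deg x h

theorem le_kgrSeq_iff {n : ℕ} (x : Fin n → A) (k : ℕ) :
    (k : ℕ∞) ≤ kgrSeq A M x ↔ (cochains M x).ExactBelow k := by
  rw [kgrSeq, le_sInf_iff]
  constructor
  · intro H i hi
    rcases lt_or_ge i 0 with h | h
    · exact exactAt_cochains_of_neg x h
    · lift i to ℕ using h
      rw [exactAt_cochains_iff]
      intro hne
      have : k ≤ i := by exact_mod_cast H i ⟨i, rfl, hne⟩
      omega
  · rintro H _ ⟨i, rfl, hne⟩
    by_contra hlt
    have hlt' : i < k := by exact_mod_cast not_le.1 hlt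
    exact (exactAt_cochains_iff x i).1 (H i (by exact_mod_cast hlt')) hne

theorem kgrSeq_mono {m n : ℕ} {x : Fin n → A} {y : Fin m → A}
    (h : ∀ j, y j ∈ Ideal.span (Set.range x)) : kgrSeq A M y ≤ kgrSeq A M x := by
  refine ENat.forall_natCast_le_iff_le.1 fun k hk => ?_
  rw [le_kgrSeq_iff] at hk ⊢
  exact exactBelow_cochains_of_mem_span hk h

/-- A natural number bounding the Koszul grade from below is already a lower bound for the
grade of some finite sequence. -/
theorem exists_le_kgrSeq {𝔞 : Ideal A} {k : ℕ} (h : (k : ℕ∞) ≤ kgr A 𝔞 M) :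
    ∃ (n : ℕ) (x : Fin n → A), (∀ j, x j ∈ 𝔞) ∧ (k : ℕ∞) ≤ kgrSeq A M x := by
  cases k with
  | zero => exact ⟨0, Fin.elim0, fun j => j.elim0, by simp⟩
  | succ k =>
    have hlt : (k : ℕ∞) < kgr A 𝔞 M := lt_of_lt_of_le (by exact_mod_cast k.lt_succ_self) h
    simp only [kgr, lt_iSup_iff] at hlt
    obtain ⟨n, x, hx, hlt⟩ := hlt
    exact ⟨n, x, hx, by simpa using Order.add_one_le_of_lt hlt⟩

theorem kgrSeq_le_kgr {𝔞 : Ideal A} {n : ℕ} {x : Fin n → A} (hx : ∀ j, x j ∈ 𝔞) :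
    kgrSeq A M x ≤ kgr A 𝔞 M :=
  le_iSup_of_le n (le_iSup_of_le x (le_iSup_of_le hx le_rfl))

end Cochains

section Semilinear

variable {A R M N : Type*} [CommRing A] [CommRing R] [AddCommGroup M] [Module A M]
  [AddCommGroup N] [Module R N] (ρ : A →+* R)

theorem comp_diff (φ : M →+ N) (hφ : ∀ a m, φ (a • m) = ρ a • φ m) {n : ℕ} (x : Fin n → A)
    (g : Finset (Fin n) → M) : φ ∘ diff M x g = diff N (ρ ∘ x) (φ ∘ g) := by
  funext t
  simp only [Function.comp_apply, diff_apply, map_sum, hφ, map_mul, map_pow, map_neg, map_one]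

theorem comp_diff' (ψ : N →+ M) (hψ : ∀ a m, ψ (ρ a • m) = a • ψ m) {n : ℕ} (x : Fin n → A)
    (g : Finset (Fin n) → N) : ψ ∘ diff N (ρ ∘ x) g = diff M x (ψ ∘ g) := by
  funext t
  simp only [Function.comp_apply, diff_apply, map_sum, ← hψ, map_mul, map_pow, map_neg, map_one]

theorem exactAt_of_retract (φ : M →+ N) (hφ : ∀ a m, φ (a • m) = ρ a • φ m)
    (ψ : N →+ M) (hψ : ∀ a m, ψ (ρ a • m) = a • ψ m) (hψφ : ∀ m, ψ (φ m) = m)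
    {n : ℕ} {x : Fin n → A} {i : ℤ} (h : (cochains N (ρ ∘ x)).ExactAt i) :
    (cochains M x).ExactAt i := by
  intro g hg hd
  have hd' : diff N (ρ ∘ x) (φ ∘ g) = 0 := by
    rw [← comp_diff ρ φ hφ, show diff M x g = 0 from hd]
    funext t
    simp
  obtain ⟨y, hy, e⟩ := h (φ ∘ g) (fun s hs => by simp [(mem_cochains_deg x i g).1 hg s hs]) hd'
  refine ⟨ψ ∘ y, fun s hs => by simp [(mem_cochains_deg _ _ y).1 hy s hs], ?_⟩
  change diff M x (ψ ∘ y) = g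
  rw [← comp_diff' ρ ψ hψ, show diff N (ρ ∘ x) y = φ ∘ g from e]
  funext t
  simp [hψφ]

theorem exactAt_of_sum {M' : Type*} [AddCommGroup M'] [Module A M']
    (φ : M →+ N) (hφ : ∀ a m, φ (a • m) = ρ a • φ m)
    (ψ : N →+ M) (hψ : ∀ a m, ψ (ρ a • m) = a • ψ m)
    (φ' : M' →+ N) (hφ' : ∀ a m, φ' (a • m) = ρ a • φ' m)
    (ψ' : N →+ M') (hψ' : ∀ a m, ψ' (ρ a • m) = a • ψ' m)
    (hsum : ∀ y, φ (ψ y) + φ' (ψ' y) = y)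
    {n : ℕ} {x : Fin n → A} {i : ℤ} (h : (cochains M x).ExactAt i)
    (h' : (cochains M' x).ExactAt i) : (cochains N (ρ ∘ x)).ExactAt i := by
  intro g hg hd
  have hd₁ : diff M x (ψ ∘ g) = 0 := by
    rw [← comp_diff' ρ ψ hψ, show diff N (ρ ∘ x) g = 0 from hd]
    funext t
    simp
  have hd₂ : diff M' x (ψ' ∘ g) = 0 := by
    rw [← comp_diff' ρ ψ' hψ', show diff N (ρ ∘ x) g = 0 from hd]
    funext t
    simp
  obtain ⟨y, hy, e⟩ := h (ψ ∘ g) (fun s hs => by simp [(mem_cochains_deg _ i g).1 hg s hs]) hd₁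
  obtain ⟨z, hz, e'⟩ :=
    h' (ψ' ∘ g) (fun s hs => by simp [(mem_cochains_deg _ i g).1 hg s hs]) hd₂
  refine ⟨φ ∘ y + φ' ∘ z, fun s hs => ?_, ?_⟩
  · simp [(mem_cochains_deg _ _ y).1 hy s hs, (mem_cochains_deg _ _ z).1 hz s hs]
  · change diff N (ρ ∘ x) (φ ∘ y + φ' ∘ z) = g
    rw [map_add, ← comp_diff ρ φ hφ, ← comp_diff ρ φ' hφ', show diff M x y = ψ ∘ g from e,
      show diff M' x z = ψ' ∘ g from e']
    funext t
    simp [hsum]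

end Semilinear

/-- Every finite sequence in an extended ideal lies in the ideal generated by the image of a
finite sequence. -/
theorem exists_mem_span_of_mem_map {A R : Type*} [CommRing A] [CommRing R] (ρ : A →+* R)
    (𝔞 : Ideal A) {m : ℕ} {y : Fin m → R} (hy : ∀ j, y j ∈ 𝔞.map ρ) :
    ∃ (n : ℕ) (x : Fin n → A), (∀ j, x j ∈ 𝔞) ∧
      ∀ j, y j ∈ Ideal.span (Set.range (ρ ∘ x)) := by
  classical
  have hfin : ∀ j, ∃ T : Finset R, (T : Set R) ⊆ ρ '' 𝔞 ∧ y j ∈ Ideal.span (T : Set R) :=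
    fun j => Submodule.mem_span_finite_of_mem_span (hy j)
  choose T hT hyT using hfin
  have hU : ((Finset.univ.biUnion T : Finset R) : Set R) ⊆ ρ '' 𝔞 := by
    intro r hr
    obtain ⟨j, -, hj⟩ := Finset.mem_biUnion.1 hr
    exact hT j hj
  obtain ⟨S, hS, hST⟩ := Finset.subset_set_image_iff.1 hU
  refine ⟨S.card, fun j => (S.equivFin.symm j : A), fun j => hS (S.equivFin.symm j).2, ?_⟩
  intro j
  refine Ideal.span_mono (fun r hr => ?_) (hyT j)
  have : r ∈ S.image ρ := by
    rw [hST]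
    exact Finset.mem_biUnion.2 ⟨j, Finset.mem_univ j, hr⟩
  obtain ⟨a, ha, rfl⟩ := Finset.mem_image.1 this
  exact ⟨S.equivFin ⟨a, ha⟩, by simp⟩

section Extension

variable {A R M' : Type*} [CommRing A] [CommRing R] [AddCommGroup M'] [Module A M']

/-- If `R`, as an `A`-module via `ρ`, is the direct sum of `A` and a module on which every
ideal has at least the Koszul grade it has on `A`, then extending an ideal along `ρ` does not
change its Koszul grade. -/
theorem kgr_map_eq (ρ : A →+* R) (π : R →+* A) (hπ : ∀ a, π (ρ a) = a)
    (φ' : M' →+ R) (hφ' : ∀ a m, φ' (a • m) = ρ a * φ' m)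
    (ψ' : R →+ M') (hψ' : ∀ a r, ψ' (ρ a * r) = a • ψ' r)
    (hsum : ∀ r, ρ (π r) + φ' (ψ' r) = r) (𝔞 : Ideal A) (h : kgr A 𝔞 A ≤ kgr A 𝔞 M') :
    kgr R (𝔞.map ρ) R = kgr A 𝔞 A := by
  have hρ : ∀ a b : A, ρ.toAddMonoidHom (a • b) = ρ a • ρ.toAddMonoidHom b := by simp
  have hπ' : ∀ (a : A) (r : R), π.toAddMonoidHom (ρ a • r) = a • π.toAddMonoidHom r := by
    simp [hπ]
  apply le_antisymm
  · refine iSup_le fun m => iSup_le fun y => iSup_le fun hy => ?_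
    obtain ⟨n, x, hx, hyx⟩ := exists_mem_span_of_mem_map ρ 𝔞 hy
    refine (kgrSeq_mono hyx).trans (le_trans ?_ (kgrSeq_le_kgr hx))
    refine ENat.forall_natCast_le_iff_le.1 fun k hk => ?_
    rw [le_kgrSeq_iff] at hk ⊢
    exact fun i hi => exactAt_of_retract ρ ρ.toAddMonoidHom hρ π.toAddMonoidHom hπ' hπ (hk i hi)
  · refine ENat.forall_natCast_le_iff_le.1 fun k hk => ?_
    obtain ⟨n, x, hx, hxk⟩ := exists_le_kgrSeq hk
    obtain ⟨n', x', hx', hxk'⟩ := exists_le_kgrSeq (hk.trans h)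
    have hz : ∀ j, Fin.append x x' j ∈ 𝔞 := fun j => by
      refine Fin.addCases (fun j => ?_) (fun j => ?_) j
      · simpa using hx j
      · simpa using hx' j
    have h₁ := hxk.trans (kgrSeq_mono (M := A) (x := Fin.append x x') fun j =>
      Ideal.subset_span ⟨Fin.castAdd n' j, by simp⟩)
    have h₂ := hxk'.trans (kgrSeq_mono (M := M') (x := Fin.append x x') fun j =>
      Ideal.subset_span ⟨Fin.natAdd n j, by simp⟩)
    refine le_trans ?_ (kgrSeq_le_kgr (x := ρ ∘ Fin.append x x')
      fun j => Ideal.mem_map_of_mem ρ (hz j))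
    rw [le_kgrSeq_iff] at h₁ h₂ ⊢
    exact fun i hi => exactAt_of_sum ρ ρ.toAddMonoidHom hρ π.toAddMonoidHom hπ' φ' hφ' ψ' hψ'
      hsum (h₁ i hi) (h₂ i hi)

end Extension

end Koszul

/-- If `A` is Cohen-Macaulay in the sense of ideals and
`kgr_A(𝔞, J) ≥ height 𝔞` for every ideal `𝔞` of `A`, then
`kgr_{A⋈^f J}(𝔞^e, A⋈^f J) = kgr_A(𝔞, A) ≤ kgr_A(𝔞, J)` for every ideal `𝔞` of `A`. -/
theorem kgr_ext_eq_kgr_of_isCMIdeals {A B : Type*} [CommRing A] [CommRing B]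
    (f : A →+* B) (J : Ideal B) (hA : IsCMIdeals A)
    (hJ : ∀ 𝔞 : Ideal A, idealHeight A 𝔞 ≤ kgrIdeal f J 𝔞) :
    ∀ 𝔞 : Ideal A,
      kgr ↥(amalgamation f J) (idealExt f J 𝔞) ↥(amalgamation f J) = kgr A 𝔞 A ∧
        kgr A 𝔞 A ≤ kgrIdeal f J 𝔞 := by
  intro 𝔞
  have hle : kgr A 𝔞 A ≤ kgrIdeal f J 𝔞 := hA 𝔞 ▸ hJ 𝔞
  refine ⟨?_, hle⟩
  let _ : Module A J := Module.compHom J f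
  let incl : J →+ amalgamation f J :=
    { toFun := fun j => ⟨(0, j), show (j : B) - f 0 ∈ J by simp⟩
      map_zero' := rfl
      map_add' := fun j j' => Subtype.ext (by simp) }
  let proj : amalgamation f J →+ J :=
    { toFun := fun r => ⟨r.1.2 - f r.1.1, r.2⟩
      map_zero' := Subtype.ext (by simp)
      map_add' := fun r r' => Subtype.ext (by simp [add_sub_add_comm]) }
  refine Koszul.kgr_map_eq (M' := J) (amalgIota f J)
    ((RingHom.fst A B).comp (amalgamation f J).subtype) (fun a => rfl) incl (fun a j => ?_)
    proj (fun a r => ?_) (fun r => ?_) 𝔞 hle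
  · refine Subtype.ext (Prod.ext ?_ ?_)
    · exact (mul_zero a).symm
    · rfl
  · refine Subtype.ext ?_
    change f a * r.1.2 - f (a * r.1.1) = f a * (r.1.2 - f r.1.1)
    rw [map_mul, mul_sub]
  · refine Subtype.ext (Prod.ext ?_ ?_)
    · exact add_zero _
    · exact add_sub_cancel _ _
end

section
/- Let (A, 𝔪) be a quasi-local (i.e. commutative with a unique maximal ideal, not necessarily Noetherian) ring and M an A-module. If kgr_A(𝔪, M) < ∞, then kgr_A(𝔪, M) ≤ dim A, where dim A is the Krull dimension of A. -/
namespace KoszulCochain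

section Cone

variable {A N : Type*} [CommRing A] [AddCommGroup N] [Module A N]

/-- Creation and annihilation operators `E`, `h` anticommuting with a differential `D`; they
exhibit `D + r • E` as the differential of the mapping cone of multiplication by `r`. -/
structure IsCone (D E h : N →ₗ[A] N) : Prop where
  EE : ∀ f, E (E f) = 0
  hh : ∀ f, h (h f) = 0
  hE : ∀ f, h (E f) = f - E (h f)
  ED : ∀ f, E (D f) = -D (E f)
  hD : ∀ f, h (D f) = -D (h f)

variable {D E h : N →ₗ[A] N}

namespace IsCone

theorem EhE (H : IsCone D E h) (f : N) : E (h (E f)) = E f := by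
  simp [H.hE, H.EE]

theorem hEh (H : IsCone D E h) (f : N) : h (E (h f)) = h f := by
  simp [H.hE, H.hh]

theorem decomp (H : IsCone D E h) (f : N) : f = h (E f) + E (h f) := by
  simp [H.hE]

theorem hED (H : IsCone D E h) (f : N) : h (E (D f)) = D (h (E f)) := by
  simp [H.ED, H.hD]

/-- The first component of a coboundary. -/
theorem fst_eq (H : IsCone D E h) {r : A} {v c : N} (hv : v = D c + r • E c) :
    h (E v) = D (h (E c)) := by
  simp [hv, H.hED, H.EE]

/-- The second component of a coboundary. -/
theorem snd_eq (H : IsCone D E h) {r : A} {v c : N} (hv : v = D c + r • E c) :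
    h v = r • h (E c) - D (h c) := by
  simp only [hv, map_add, map_smul, H.hD]
  abel

/-- The components of a cocycle. -/
theorem cocycle (H : IsCone D E h) {r : A} {z : N} (hz : D z + r • E z = 0) :
    D (h (E z)) = 0 ∧ D (h z) = r • h (E z) := by
  refine ⟨?_, ?_⟩
  · simpa using (H.fst_eq hz.symm).symm
  · have := H.snd_eq hz.symm
    rw [map_zero] at this
    exact (sub_eq_zero.1 this.symm).symm

theorem exact_sq (H : IsCone D E h) (G : ℤ → Submodule A N) {r : A} {n : ℤ}
    (hGE : ∀ i, ∀ f ∈ G i, E f ∈ G (i + 1)) (hGh : ∀ i, ∀ f ∈ G (i + 1), h f ∈ G i)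
    (ex : ∀ i < n, ∀ z ∈ G i, D z + r • E z = 0 → ∃ c ∈ G (i - 1), z = D c + r • E c) :
    ∀ i < n, ∀ z ∈ G i, D z + (r * r) • E z = 0 →
      ∃ c ∈ G (i - 1), z = D c + (r * r) • E c := by
  intro i hi z hzG hz
  have hGE' : ∀ f ∈ G (i - 1), E f ∈ G i := fun f hf => by simpa using hGE _ f hf
  have hGh' : ∀ f ∈ G i, h f ∈ G (i - 1) := fun f hf => hGh _ f (by simpa using hf)
  obtain ⟨ha, hb⟩ := H.cocycle hz
  obtain ⟨α, hα, hv⟩ := ex i hi (r • h (E z) + E (h z))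
    (add_mem (Submodule.smul_mem _ _ (hGh _ _ (hGE _ _ hzG))) (hGE' _ (hGh' _ hzG))) (by
      have : D (E (h z)) = -((r * r) • E z) := by
        rw [← neg_eq_iff_eq_neg, ← H.ED, hb, map_smul, H.EhE]
      simp only [map_add, map_smul, ha, this, H.EhE, H.EE]
      module)
  have h1 := H.fst_eq hv
  have h2 := H.snd_eq hv
  simp only [map_add, map_smul, H.EhE, H.EE, H.hEh, H.hh, add_zero, smul_zero, zero_add] at h1 h2
  have hα0 : h (E α) ∈ G (i - 1) := hGh _ _ (hGE _ _ hα)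
  obtain ⟨β, hβ, hw⟩ := ex i hi (h (E z) + E (h (E α)))
    (add_mem (hGh _ _ (hGE _ _ hzG)) (hGE' _ hα0)) (by
      have : D (E (h (E α))) = -(r • E z) := by
        rw [← neg_eq_iff_eq_neg, ← H.ED, ← h1, map_smul, H.EhE]
      rw [H.EhE] at this
      simp only [map_add, ha, this, H.EhE, H.EE]
      module)
  have h3 := H.fst_eq hw
  have h4 := H.snd_eq hw
  simp only [map_add, H.EhE, H.EE, H.hh, add_zero, zero_add] at h3 h4
  refine ⟨h (E β) + E (r • h β + h α), add_mem (hGh _ _ (hGE _ _ hβ)) ?_, ?_⟩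
  · have : r • h β + h α ∈ G (i - 1 - 1) :=
      add_mem (Submodule.smul_mem _ _ (hGh _ _ (by simpa using hβ))) (hGh _ _ (by simpa using hα))
    simpa using hGE _ _ this
  · have h5 : E (h z) = (r * r) • E β + D (E (r • h β + h α)) := by
      have e1 := congrArg E h2
      have e2 := congrArg E h4
      simp only [map_sub, map_smul, H.EhE, H.ED] at e1 e2
      simp only [map_add, map_smul]
      rw [e1, e2]
      module
    conv_lhs => rw [H.decomp z, h3, h5]
    simp only [map_add, map_smul, H.EhE, H.EE]
    module

theorem injective_sq (H : IsCone D E h) (G : ℤ → Submodule A N) {r : A} {n : ℤ}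
    (hGE : ∀ i, ∀ f ∈ G i, E f ∈ G (i + 1)) (hGh : ∀ i, ∀ f ∈ G (i + 1), h f ∈ G i)
    (ex : ∀ i < n, ∀ z ∈ G i, D z + r • E z = 0 → ∃ c ∈ G (i - 1), z = D c + r • E c)
    {z : N} (hzG : z ∈ G n) (hz : D z + r • E z = 0)
    (hc : ∃ c ∈ G (n - 1), h (E z) + r • E (h z) = D c + (r * r) • E c) :
    ∃ c ∈ G (n - 1), z = D c + r • E c := by
  obtain ⟨c, hcG, hc⟩ := hc
  obtain ⟨ha, hb⟩ := H.cocycle hz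
  have h1 := H.fst_eq hc
  have h2 := H.snd_eq hc
  simp only [map_add, map_smul, H.EhE, H.EE, H.hEh, H.hh, add_zero, smul_zero, zero_add] at h1 h2
  have hc0 : h (E c) ∈ G (n - 1) := hGh _ _ (hGE _ _ hcG)
  have hGh' : ∀ i, ∀ f ∈ G i, h f ∈ G (i - 1) := fun i f hf => hGh _ f (by simpa using hf)
  obtain ⟨u, hu, hv⟩ := ex (n - 1) (by lia) (h z - r • h (E c) - E (h c))
    (sub_mem (sub_mem (hGh' _ _ hzG) (Submodule.smul_mem _ _ hc0))
      (by simpa using hGE _ _ (hGh' _ _ hcG))) (by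
      have e1 := congrArg E h2
      simp only [map_sub, map_smul, H.EhE, H.ED] at e1
      simp only [map_sub, map_smul, H.EhE, H.EE, hb, ← h1]
      linear_combination (norm := module) e1)
  have h3 := H.fst_eq hv
  simp only [map_sub, map_smul, H.EhE, H.EE, H.hEh, sub_zero] at h3
  have hu0 : h (E u) ∈ G (n - 1 - 1) := hGh _ _ (hGE _ _ hu)
  refine ⟨h (E c) - E (h (E u)), sub_mem hc0 (by simpa using hGE _ _ hu0), ?_⟩
  have e3 := congrArg E h3
  simp only [map_sub, map_smul, H.EhE, H.ED] at e3
  conv_lhs => rw [H.decomp z, h1]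
  simp only [map_sub, H.EhE, H.EE]
  linear_combination (norm := module) e3

end IsCone

end Cone

section Operators

variable {A : Type*} [CommRing A] {M : Type*} [AddCommGroup M] [Module A M] {n : ℕ}

/-- The sign of the position of `j` relative to `T`. -/
def sign (A : Type*) [CommRing A] (j : Fin n) (T : Finset (Fin n)) : A :=
  (-1) ^ (T.filter (fun k => k < j)).card

theorem sign_mul_self (j : Fin n) (T : Finset (Fin n)) : sign A j T * sign A j T = 1 := by
  rw [sign, ← mul_pow]; simp

theorem sign_insert_self (j : Fin n) (T : Finset (Fin n)) :
    sign A j (insert j T) = sign A j T := by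
  simp [sign, Finset.filter_insert]

theorem sign_erase_self (j : Fin n) (T : Finset (Fin n)) :
    sign A j (T.erase j) = sign A j T := by
  simp [sign, Finset.filter_erase]

theorem sign_insert {j k : Fin n} {T : Finset (Fin n)} (hk : k ∉ T) :
    sign A j (insert k T) = (if k < j then -1 else 1) * sign A j T := by
  unfold sign
  rw [Finset.filter_insert]
  split_ifs
  · rw [Finset.card_insert_of_notMem (by simp [hk]), pow_succ']
  · simp

theorem sign_erase {j k : Fin n} {T : Finset (Fin n)} (hk : k ∈ T) :
    sign A j (T.erase k) = (if k < j then -1 else 1) * sign A j T := by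
  have := sign_insert (A := A) (j := j) (Finset.notMem_erase k T)
  rw [Finset.insert_erase hk] at this
  rw [this, ← mul_assoc]
  split_ifs <;> simp

/-- Exterior multiplication by the `j`-th basis vector. -/
def create (A : Type*) [CommRing A] (M : Type*) [AddCommGroup M] [Module A M] (j : Fin n) :
    (Finset (Fin n) → M) →ₗ[A] (Finset (Fin n) → M) where
  toFun f T := if j ∈ T then sign A j T • f (T.erase j) else 0
  map_add' f g := by ext T; by_cases hj : j ∈ T <;> simp [hj]
  map_smul' a f := by ext T; by_cases hj : j ∈ T <;> simp [hj, smul_smul, mul_comm]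

/-- Contraction with the `j`-th coordinate. -/
def annihilate (A : Type*) [CommRing A] (M : Type*) [AddCommGroup M] [Module A M] (j : Fin n) :
    (Finset (Fin n) → M) →ₗ[A] (Finset (Fin n) → M) where
  toFun f T := if j ∈ T then 0 else sign A j T • f (insert j T)
  map_add' f g := by ext T; by_cases hj : j ∈ T <;> simp [hj]
  map_smul' a f := by ext T; by_cases hj : j ∈ T <;> simp [hj, smul_smul, mul_comm]

theorem create_apply (j : Fin n) (f : Finset (Fin n) → M) (T : Finset (Fin n)) :
    create A M j f T = if j ∈ T then sign A j T • f (T.erase j) else 0 := rfl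

theorem annihilate_apply (j : Fin n) (f : Finset (Fin n) → M) (T : Finset (Fin n)) :
    annihilate A M j f T = if j ∈ T then 0 else sign A j T • f (insert j T) := rfl

theorem create_create_self (j : Fin n) (f : Finset (Fin n) → M) :
    create A M j (create A M j f) = 0 := by
  ext T; simp [create_apply]

theorem annihilate_annihilate_self (j : Fin n) (f : Finset (Fin n) → M) :
    annihilate A M j (annihilate A M j f) = 0 := by
  ext T; simp [annihilate_apply]

theorem create_annihilate_self_apply (j : Fin n) (f : Finset (Fin n) → M)
    (T : Finset (Fin n)) :
    create A M j (annihilate A M j f) T = if j ∈ T then f T else 0 := by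
  by_cases hj : j ∈ T
  · simp [create_apply, annihilate_apply, hj, sign_erase_self, smul_smul, sign_mul_self]
  · simp [create_apply, hj]

theorem annihilate_create_self_apply (j : Fin n) (f : Finset (Fin n) → M)
    (T : Finset (Fin n)) :
    annihilate A M j (create A M j f) T = if j ∈ T then 0 else f T := by
  by_cases hj : j ∈ T
  · simp [annihilate_apply, hj]
  · simp [create_apply, annihilate_apply, hj, sign_insert_self, smul_smul, sign_mul_self]

theorem annihilate_create_self (j : Fin n) (f : Finset (Fin n) → M) :
    annihilate A M j (create A M j f) = f - create A M j (annihilate A M j f) := by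
  ext T
  rw [Pi.sub_apply, annihilate_create_self_apply, create_annihilate_self_apply]
  split_ifs <;> simp

theorem create_create (j k : Fin n) (f : Finset (Fin n) → M) :
    create A M j (create A M k f) = -create A M k (create A M j f) := by
  rcases eq_or_ne j k with rfl | hjk
  · simp [create_create_self]
  ext T
  by_cases hj : j ∈ T <;> by_cases hk : k ∈ T <;>
    simp only [create_apply, Pi.neg_apply, hj, hk, if_true, if_false, Finset.mem_erase, hjk,
      hjk.symm, ne_eq, not_false_eq_true, and_true, and_false, smul_zero, neg_zero]
  rw [Finset.erase_right_comm, smul_smul, smul_smul, ← neg_smul, sign_erase hj, sign_erase hk]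
  congr 1
  rcases hjk.lt_or_gt with h | h
  · simp [h, h.not_gt]; ring
  · simp [h, h.not_gt]; ring

theorem annihilate_create {j k : Fin n} (hjk : j ≠ k) (f : Finset (Fin n) → M) :
    annihilate A M j (create A M k f) = -create A M k (annihilate A M j f) := by
  ext T
  by_cases hj : j ∈ T <;> by_cases hk : k ∈ T <;>
    simp only [create_apply, annihilate_apply, Pi.neg_apply, hj, hk, if_true, if_false,
      Finset.mem_erase, Finset.mem_insert, hjk, hjk.symm, ne_eq, not_false_eq_true, and_true,
      and_false, or_true, or_false, smul_zero, neg_zero]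
  rw [Finset.erase_insert_of_ne hjk, smul_smul, smul_smul, ← neg_smul, sign_insert hj,
    sign_erase hk]
  congr 1
  rcases hjk.lt_or_gt with h | h
  · simp [h, h.not_gt]; ring
  · simp [h, h.not_gt]; ring

/-- The Koszul differential using only the indices in `Q`. -/
def diff (M : Type*) [AddCommGroup M] [Module A M] (Q : Finset (Fin n)) (c : Fin n → A) :
    (Finset (Fin n) → M) →ₗ[A] (Finset (Fin n) → M) :=
  ∑ j ∈ Q, c j • create A M j

theorem diff_apply (Q : Finset (Fin n)) (c : Fin n → A) (f : Finset (Fin n) → M) :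
    diff M Q c f = ∑ j ∈ Q, c j • create A M j f := by
  simp [diff]

theorem diff_insert {Q : Finset (Fin n)} {j : Fin n} (hj : j ∉ Q) (c : Fin n → A)
    (f : Finset (Fin n) → M) :
    diff M (insert j Q) c f = diff M Q c f + c j • create A M j f := by
  rw [diff_apply, Finset.sum_insert hj, diff_apply, add_comm]

theorem isCone {Q : Finset (Fin n)} {j : Fin n} (hj : j ∉ Q) (c : Fin n → A) :
    IsCone (diff M Q c) (create A M j) (annihilate A M j) where
  EE := create_create_self j
  hh := annihilate_annihilate_self j
  hE := annihilate_create_self j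
  ED f := by
    simp only [diff_apply, map_sum, map_smul, create_create j, smul_neg, Finset.sum_neg_distrib]
  hD f := by
    simp only [diff_apply, map_sum, map_smul, ← Finset.sum_neg_distrib, ← smul_neg]
    refine Finset.sum_congr rfl fun k hk => ?_
    rw [annihilate_create (by rintro rfl; exact hj hk)]

/-- The comparison map from the Koszul complex of `c` to that of `c * y`. -/
def scale (M : Type*) [AddCommGroup M] [Module A M] (y : Fin n → A) :
    (Finset (Fin n) → M) →ₗ[A] (Finset (Fin n) → M) where
  toFun f T := (∏ j ∈ T, y j) • f T
  map_add' f g := by ext T; simp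
  map_smul' a f := by ext T; simp [smul_smul, mul_comm]

theorem scale_apply (y : Fin n → A) (f : Finset (Fin n) → M) (T : Finset (Fin n)) :
    scale M y f T = (∏ j ∈ T, y j) • f T := rfl

theorem scale_one (f : Finset (Fin n) → M) : scale M (1 : Fin n → A) f = f := by
  ext T; simp [scale_apply]

theorem scale_scale (y y' : Fin n → A) (f : Finset (Fin n) → M) :
    scale M y' (scale M y f) = scale M (y * y') f := by
  ext T; simp [scale_apply, Finset.prod_mul_distrib, smul_smul, mul_comm]

theorem scale_create (y : Fin n → A) (j : Fin n) (f : Finset (Fin n) → M) :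
    scale M y (create A M j f) = y j • create A M j (scale M y f) := by
  ext T
  by_cases hj : j ∈ T
  · simp only [scale_apply, create_apply, Pi.smul_apply, hj, if_true, smul_smul]
    rw [← Finset.mul_prod_erase T y hj]
    congr 1; ring
  · simp [scale_apply, create_apply, hj]

theorem scale_diff (Q : Finset (Fin n)) (c y : Fin n → A) (f : Finset (Fin n) → M) :
    scale M y (diff M Q c f) = diff M Q (c * y) (scale M y f) := by
  simp [diff_apply, scale_create, smul_smul]

theorem scale_mulSingle (j : Fin n) (r : A) (f : Finset (Fin n) → M) :
    scale M (Pi.mulSingle j r) f =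
      annihilate A M j (create A M j f) + r • create A M j (annihilate A M j f) := by
  ext T
  rw [Pi.add_apply, Pi.smul_apply, annihilate_create_self_apply, create_annihilate_self_apply,
    scale_apply, Finset.prod_pi_mulSingle']
  split_ifs <;> simp

/-- Cochains of degree `i` supported on subsets of `Q`. -/
def cochains (A : Type*) [CommRing A] (M : Type*) [AddCommGroup M] [Module A M]
    (Q : Finset (Fin n)) (i : ℤ) : Submodule A (Finset (Fin n) → M) where
  carrier := {f | ∀ T, ¬(T ⊆ Q ∧ (T.card : ℤ) = i) → f T = 0}
  zero_mem' _ _ := rfl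
  add_mem' hf hg T hT := by simp [hf T hT, hg T hT]
  smul_mem' a f hf T hT := by simp [hf T hT]

theorem cochains_mono {Q Q' : Finset (Fin n)} (h : Q ⊆ Q') (i : ℤ) :
    cochains A M Q i ≤ cochains A M Q' i :=
  fun _ hf T hT => hf T fun h' => hT ⟨h'.1.trans h, h'.2⟩

theorem create_mem {Q : Finset (Fin n)} {i : ℤ} {f : Finset (Fin n) → M}
    (hf : f ∈ cochains A M Q i) (j : Fin n) :
    create A M j f ∈ cochains A M (insert j Q) (i + 1) := by
  intro T hT
  by_cases hj : j ∈ T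
  · rw [create_apply, if_pos hj, hf, smul_zero]
    rintro ⟨h1, h2⟩
    refine hT ⟨by rwa [Finset.subset_insert_iff], ?_⟩
    rw [← h2, ← Finset.card_erase_add_one hj]; simp
  · simp [create_apply, hj]

theorem annihilate_mem {Q : Finset (Fin n)} {i : ℤ} {f : Finset (Fin n) → M} {j : Fin n}
    (hf : f ∈ cochains A M (insert j Q) (i + 1)) :
    annihilate A M j f ∈ cochains A M Q i := by
  intro T hT
  by_cases hj : j ∈ T
  · simp [annihilate_apply, hj]
  · rw [annihilate_apply, if_neg hj, hf, smul_zero]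
    rintro ⟨h1, h2⟩
    refine hT ⟨by rwa [Finset.insert_subset_insert_iff hj] at h1, ?_⟩
    rw [Finset.card_insert_of_notMem hj] at h2
    push_cast at h2; lia

theorem scale_mem {Q : Finset (Fin n)} {i : ℤ} {f : Finset (Fin n) → M}
    (hf : f ∈ cochains A M Q i) (y : Fin n → A) : scale M y f ∈ cochains A M Q i :=
  fun T hT => by simp [scale_apply, hf T hT]

/-- Exactness of the Koszul complex of `c` in degree `i`. -/
def ExactAt (M : Type*) [AddCommGroup M] [Module A M] (c : Fin n → A) (i : ℤ) : Prop :=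
  ∀ z ∈ cochains A M Finset.univ i, diff M Finset.univ c z = 0 →
    ∃ b ∈ cochains A M Finset.univ (i - 1), z = diff M Finset.univ c b

/-- If the Koszul complex of `c` is exact below degree `m`, then so is that of `c * y`, and the
comparison map is injective on cohomology in degree `m`. -/
def GoodScale (M : Type*) [AddCommGroup M] [Module A M] (m : ℤ) (c y : Fin n → A) : Prop :=
  (∀ i < m, ExactAt M c i) → (∀ i < m, ExactAt M (c * y) i) ∧
    ∀ z ∈ cochains A M Finset.univ m, diff M Finset.univ c z = 0 →
      (∃ b ∈ cochains A M Finset.univ (m - 1), scale M y z = diff M Finset.univ (c * y) b) →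
      ∃ b ∈ cochains A M Finset.univ (m - 1), z = diff M Finset.univ c b

theorem GoodScale.one (m : ℤ) (c : Fin n → A) : GoodScale M m c 1 := by
  intro h
  simpa [scale_one] using h

theorem GoodScale.mul {m : ℤ} {c y y' : Fin n → A} (h : GoodScale M m c y)
    (h' : GoodScale M m (c * y) y') : GoodScale M m c (y * y') := by
  intro hc
  obtain ⟨h1, h2⟩ := h hc
  obtain ⟨h3, h4⟩ := h' h1
  rw [mul_assoc] at h3 h4
  refine ⟨h3, fun z hz hdz hb => h2 z hz hdz (h4 _ (scale_mem hz y) ?_ ?_)⟩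
  · rw [← scale_diff, hdz, map_zero]
  · rwa [scale_scale]

theorem goodScale_mulSingle (m : ℤ) (c : Fin n → A) (j : Fin n) :
    GoodScale M m c (Pi.mulSingle j (c j)) := by
  intro hc
  have hj : j ∉ Finset.univ.erase j := Finset.notMem_erase j _
  have hu : insert j (Finset.univ.erase j) = (Finset.univ : Finset (Fin n)) :=
    Finset.insert_erase (Finset.mem_univ j)
  have H : IsCone (diff M (Finset.univ.erase j) c) (create A M j) (annihilate A M j) :=
    isCone hj c
  have hd : ∀ f : Finset (Fin n) → M, diff M Finset.univ c f =
      diff M (Finset.univ.erase j) c f + c j • create A M j f := fun f => by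
    rw [← diff_insert hj, hu]
  have hd' : ∀ f : Finset (Fin n) → M, diff M Finset.univ (c * Pi.mulSingle j (c j)) f =
      diff M (Finset.univ.erase j) c f + (c j * c j) • create A M j f := fun f => by
    have e := diff_insert hj (c * Pi.mulSingle j (c j)) f
    rw [hu] at e
    rw [e]
    congr 1
    · rw [diff_apply, diff_apply]
      refine Finset.sum_congr rfl fun k hk => ?_
      simp [Pi.mulSingle_eq_of_ne (Finset.ne_of_mem_erase hk)]
    · simp
  have hGE : ∀ i, ∀ f ∈ cochains A M Finset.univ i,
      create A M j f ∈ cochains A M Finset.univ (i + 1) := fun i f hf => by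
    simpa using create_mem hf j
  have hGh : ∀ i, ∀ f ∈ cochains A M Finset.univ (i + 1),
      annihilate A M j f ∈ cochains A M Finset.univ i := fun i f hf =>
    annihilate_mem (by simpa using hf)
  simp only [ExactAt, hd, hd', scale_mulSingle] at hc ⊢
  exact ⟨H.exact_sq _ hGE hGh hc, fun z hz hdz hb => H.injective_sq _ hGE hGh hc hz hdz hb⟩

theorem goodScale_self (m : ℤ) (c : Fin n → A) : GoodScale M m c c := by
  suffices ∀ Q : Finset (Fin n), GoodScale M m c (fun k => if k ∈ Q then c k else 1) by
    simpa using this Finset.univ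
  intro Q
  induction Q using Finset.induction_on with
  | empty => simpa using! GoodScale.one m c
  | insert j Q hj ih =>
    have hs := ih.mul (goodScale_mulSingle m _ j)
    convert hs using 1
    ext k
    rcases eq_or_ne k j with rfl | hk
    · simp [hj]
    · simp [hk]

theorem goodScale_pow (m : ℤ) (c : Fin n → A) (k : ℕ) : GoodScale M m c (c ^ (2 ^ k - 1)) := by
  induction k with
  | zero => simpa using GoodScale.one m c
  | succ k ih =>
    have hs := ih.mul (goodScale_self m _)
    have : 2 ^ k - 1 + (2 ^ k - 1 + 1) = 2 ^ (k + 1) - 1 := by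
      have := Nat.one_le_two_pow (n := k)
      rw [pow_succ]; lia
    rwa [← pow_succ', ← pow_add, this] at hs

end Operators

section Vanishing

variable {A : Type*} [CommRing A] {M : Type*} [AddCommGroup M] [Module A M] {n : ℕ}

/-- The ring elements whose multiples of `z` become coboundaries after raising the sequence to
a high power. -/
def killers (x : Fin n → A) (Q : Finset (Fin n)) (i : ℤ) (t : ℕ) (z : Finset (Fin n) → M) :
    Ideal A where
  carrier := {u | ∃ s : ℕ, ∃ b ∈ cochains A M Q i,
    u • scale M (x ^ s) z = diff M Q (x ^ (t + s)) b}
  zero_mem' := ⟨0, 0, zero_mem _, by simp⟩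
  add_mem' := by
    rintro u v ⟨s, b, hb, hu⟩ ⟨s', b', hb', hv⟩
    refine ⟨s + s', scale M (x ^ s') b + scale M (x ^ s) b',
      add_mem (scale_mem hb _) (scale_mem hb' _), ?_⟩
    have e1 := congrArg (scale M (x ^ s')) hu
    have e2 := congrArg (scale M (x ^ s)) hv
    rw [map_smul, scale_scale, scale_diff, ← pow_add, ← pow_add] at e1 e2
    rw [add_comm s' s] at e2
    rw [map_add, add_smul, e1, e2, add_assoc, add_assoc, add_comm s' s]
  smul_mem' := by
    rintro a u ⟨s, b, hb, hu⟩
    exact ⟨s, a • b, Submodule.smul_mem _ _ hb, by rw [smul_assoc, hu, map_smul]⟩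

theorem exists_mem_killers (x : Fin n → A) (Q : Finset (Fin n)) :
    ∀ (S : Submonoid A) (i : ℕ),
      (∀ q : PrimeSpectrum A, Disjoint (q.asIdeal : Set A) S → Order.height q < i) →
      ∀ (t : ℕ), ∀ z ∈ cochains A M Q i, diff M Q (x ^ t) z = 0 →
        ∃ u ∈ S, u ∈ killers x Q (i - 1) t z := by
  induction Q using Finset.induction_on with
  | empty =>
    intro S i hS t z hz _
    by_contra! hcon
    obtain ⟨p, hp, -, hpS⟩ := Ideal.exists_le_prime_disjoint (killers x ∅ (i - 1) t z) S
      (Set.disjoint_left.2 fun u hu hu' => hcon u hu' hu)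
    have hi := hS ⟨p, hp⟩ hpS
    have hi0 : i ≠ 0 := by rintro rfl; simp at hi
    have hz0 : z = 0 := by
      ext T
      refine hz T ?_
      rintro ⟨h1, h2⟩
      rw [Finset.subset_empty] at h1
      subst h1
      exact hi0 (by simpa using h2.symm)
    exact hcon 1 S.one_mem ⟨0, 0, zero_mem _, by simp [hz0]⟩
  | insert j Q hj ih =>
    intro S i hS t z hz hdz
    by_contra! hcon
    obtain ⟨p, hp, hIp, hpS⟩ := Ideal.exists_le_prime_disjoint
      (killers x (insert j Q) (i - 1) t z) S
      (Set.disjoint_left.2 fun u hu hu' => hcon u hu' hu)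
    have hi := hS ⟨p, hp⟩ hpS
    obtain ⟨i, rfl⟩ : ∃ k, i = k + 1 := Nat.exists_eq_succ_of_ne_zero (by rintro rfl; simp at hi)
    push_cast at hz hIp
    rw [add_sub_cancel_right] at hIp
    have H (c : Fin n → A) := isCone (M := M) hj c
    rw [diff_insert hj] at hdz
    obtain ⟨ha, hb⟩ := (H _).cocycle hdz
    have haG : annihilate A M j (create A M j z) ∈ cochains A M Q (i + 1) :=
      annihilate_mem (by simpa using create_mem hz j)
    have hbG : annihilate A M j z ∈ cochains A M Q i := annihilate_mem hz
    have hz' := (H (x ^ t)).decomp z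
    set a := annihilate A M j (create A M j z)
    set b := annihilate A M j z
    have hxp : x j ∈ p := by
      refine hp.mem_of_pow_mem t (hIp ⟨0, b, cochains_mono (Finset.subset_insert _ _) _ hbG, ?_⟩)
      rw [pow_zero, scale_one, add_zero, diff_insert hj, hb, ← Pi.pow_apply, ← smul_add]
      exact congrArg _ hz'
    obtain ⟨u, hu, s, a', ha', hua⟩ := ih p.primeCompl (i + 1) (fun q hq => by
      refine lt_of_le_of_lt (Order.height_mono (?_ : q ≤ ⟨p, hp⟩)) hi
      intro y hy
      by_contra hyp
      exact Set.disjoint_left.1 hq hy hyp) t a (by simpa using haG) ha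
    have ha'G : a' ∈ cochains A M Q i := by simpa using ha'
    set b' := (u * x j ^ s) • scale M (x ^ s) b - x j ^ (t + s) • a' with hb'
    have hb'G : b' ∈ cochains A M Q i :=
      sub_mem (Submodule.smul_mem _ _ (scale_mem hbG _)) (Submodule.smul_mem _ _ ha'G)
    have hdb' : diff M Q (x ^ (t + s)) b' = 0 := by
      have e := congrArg (scale M (x ^ s)) hb
      rw [scale_diff, ← pow_add, map_smul, Pi.pow_apply] at e
      rw [hb', map_sub, map_smul, map_smul, e, ← hua, pow_add]
      module
    obtain ⟨v, hv, s', c, hc, hvc⟩ := ih (p.primeCompl ⊔ Submonoid.powers (x j)) i (fun q hq => by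
      have hqp : q < ⟨p, hp⟩ := by
        refine lt_of_le_of_ne ?_ ?_
        · intro y hy
          by_contra hyp
          exact Set.disjoint_left.1 hq hy
            ((le_sup_left : p.primeCompl ≤ p.primeCompl ⊔ Submonoid.powers (x j)) hyp)
        · rintro rfl
          exact Set.disjoint_left.1 hq hxp
            ((le_sup_right : Submonoid.powers (x j) ≤ p.primeCompl ⊔ Submonoid.powers (x j))
              (Submonoid.mem_powers _))
      have h1 : Order.height q < Order.height (⟨p, hp⟩ : PrimeSpectrum A) :=
        Order.height_strictMono hqp
          (((Order.height_mono hqp.le).trans_lt hi).trans (ENat.natCast_lt_top _))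
      exact h1.trans_le (Order.le_of_lt_add_one (by exact_mod_cast hi))) (t + s) b' hb'G hdb'
    obtain ⟨w, hw, _, ⟨k, rfl⟩, rfl⟩ := Submonoid.mem_sup.1 hv
    refine (mul_mem hw hu : w * u ∈ p.primeCompl) (hIp ⟨s + (s' + k),
      w • scale M (x ^ (s' + k)) a' - x j ^ s' • create A M j (scale M (x ^ k) c), ?_, ?_⟩)
    · refine sub_mem (Submodule.smul_mem _ _ (cochains_mono (Finset.subset_insert _ _) _
        (scale_mem ha'G _))) (Submodule.smul_mem _ _ ?_)
      simpa using create_mem (scale_mem hc (x ^ k)) j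
    · clear_value b'
      have e1 := congrArg (scale M (x ^ (s' + k))) hua
      have e2 := congrArg (scale M (x ^ k)) (show (w * x j ^ k) • _ = _ from hvc)
      have e3 := congrArg (scale M (x ^ (s' + k))) hb'
      rw [map_smul, scale_scale, scale_diff, ← pow_add, ← pow_add, add_assoc] at e1 e2
      rw [map_sub, map_smul, map_smul, scale_scale, ← pow_add] at e3
      rw [add_assoc t s] at e2
      have e4 := congrArg (create A M j) e2
      have e5 := congrArg (create A M j) e3
      rw [(H _).ED, map_smul] at e4
      rw [map_sub, map_smul, map_smul] at e5
      have e6 : scale M (x ^ (s + (s' + k))) z = scale M (x ^ (s + (s' + k))) a +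
          x j ^ (s + (s' + k)) • create A M j (scale M (x ^ (s + (s' + k))) b) := by
        conv_lhs => rw [hz', map_add, scale_create, Pi.pow_apply]
      rw [diff_insert hj, map_sub, map_sub, map_smul, map_smul, map_smul, map_smul, ← e1, e6,
        create_create_self, Pi.pow_apply]
      have e7 := congrArg (fun m => x j ^ s' • m) e4
      rw [e5] at e7
      simp only [pow_add] at e7 ⊢
      linear_combination (norm := module) e7

end Vanishing

section Comparison

variable {A : Type*} [CommRing A] {M : Type*} [AddCommGroup M] [Module A M] {n : ℕ}

/-- Extension by zero of a homogeneous Koszul cochain. -/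
def extend (i : ℕ) (g : {s : Finset (Fin n) // s.card = i} → M) : Finset (Fin n) → M :=
  fun T => if hT : T.card = i then g ⟨T, hT⟩ else 0

theorem extend_mem (i : ℕ) (g : {s : Finset (Fin n) // s.card = i} → M) :
    extend i g ∈ cochains A M Finset.univ i := by
  intro T hT
  have : T.card ≠ i := by simpa using hT
  simp [extend, this]

theorem exists_extend {i : ℕ} {f : Finset (Fin n) → M}
    (hf : f ∈ cochains A M Finset.univ i) : ∃ g, f = extend i g := by
  refine ⟨fun s => f s.1, ?_⟩
  ext T
  by_cases hT : T.card = i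
  · simp [extend, hT]
  · simp only [extend, hT, dite_false]
    exact hf T (by simpa using hT)

theorem extend_injective (i : ℕ) :
    Function.Injective (extend i : ({s : Finset (Fin n) // s.card = i} → M) → _) := by
  intro g g' h
  ext ⟨T, hT⟩
  simpa [extend, hT] using congrFun h T

theorem extend_koszulMap (x : Fin n → A) (i : ℕ)
    (g : {s : Finset (Fin n) // s.card = i} → M) :
    extend (i + 1) (koszulMap A M x i g) = diff M Finset.univ x (extend i g) := by
  ext T
  have hR : diff M Finset.univ x (extend i g) T =
      ∑ j ∈ T, (sign A j T * x j) • extend i g (T.erase j) := by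
    simp only [diff_apply, Finset.sum_apply, Pi.smul_apply, create_apply, smul_ite, smul_zero,
      smul_smul, Finset.sum_ite_mem, Finset.univ_inter, mul_comm]
  rw [hR]
  by_cases hT : T.card = i + 1
  · rw [← Finset.sum_attach]
    simp only [extend, hT, dite_true, koszulMap, LinearMap.coe_mk, AddHom.coe_mk]
    refine Finset.sum_congr rfl fun j _ => ?_
    have : (T.erase j.1).card = i := by rw [Finset.card_erase_of_mem j.2, hT]; rfl
    rw [dif_pos this]
    rfl
  · simp only [extend, hT, dite_false]
    refine (Finset.sum_eq_zero fun j hj => ?_).symm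
    have : (T.erase j).card ≠ i := by
      have := Finset.card_erase_add_one hj
      lia
    simp [this]

theorem not_koszulCohomologyNeZero_iff (x : Fin n → A) (k : ℕ) :
    ¬koszulCohomologyNeZero A M x k ↔ ExactAt M x k := by
  have hz (i : ℕ) : extend (M := M) (n := n) i 0 = 0 := by ext; simp [extend]
  have hker (i : ℕ) (g : {s : Finset (Fin n) // s.card = i} → M) :
      g ∈ LinearMap.ker (koszulMap A M x i) ↔ diff M Finset.univ x (extend i g) = 0 := by
    rw [LinearMap.mem_ker, ← extend_koszulMap, ← hz (i + 1), (extend_injective _).eq_iff]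
  cases k with
  | zero =>
    rw [koszulCohomologyNeZero, not_ne_iff, Submodule.eq_bot_iff]
    constructor
    · intro h z hzG hdz
      obtain ⟨g, rfl⟩ := exists_extend hzG
      refine ⟨0, zero_mem _, ?_⟩
      rw [h g ((hker 0 g).2 hdz), hz, map_zero]
    · intro h g hg
      obtain ⟨b, hb, hgb⟩ := h _ (extend_mem 0 g) ((hker 0 g).1 hg)
      have hb0 : b = 0 := by
        ext T
        refine hb T ?_
        push_cast
        lia
      rw [hb0, map_zero, ← hz 0] at hgb
      exact extend_injective _ hgb
  | succ i =>
    rw [koszulCohomologyNeZero, not_not]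
    constructor
    · intro h z hzG hdz
      obtain ⟨g, rfl⟩ := exists_extend hzG
      obtain ⟨b, rfl⟩ := h ((hker _ g).2 hdz)
      exact ⟨extend i b, by simpa using extend_mem (A := A) i b, extend_koszulMap x i b⟩
    · intro h g hg
      obtain ⟨b, hb, hgb⟩ := h _ (extend_mem _ g) ((hker _ g).1 hg)
      obtain ⟨b, rfl⟩ := exists_extend (i := i) (by simpa using hb)
      rw [← extend_koszulMap] at hgb
      exact ⟨b, (extend_injective _ hgb).symm⟩

/-- Above all heights of primes, exactness in the lower degrees forces exactness. -/
theorem exactAt_of_height_lt (x : Fin n → A) (m : ℕ)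
    (hm : ∀ q : PrimeSpectrum A, Order.height q < m) (ex : ∀ i < (m : ℤ), ExactAt M x i) :
    ExactAt M x m := by
  intro z hz hdz
  obtain ⟨u, hu, s, b, hb, hub⟩ := exists_mem_killers x Finset.univ ⊥ m (fun q _ => hm q) 1 z hz
    (by simpa using hdz)
  rw [Submonoid.mem_bot.1 hu, one_smul] at hub
  refine (goodScale_pow (M := M) m x s ex).2 z hz hdz ?_
  have hs : s + (2 ^ s - 1 - s) = 2 ^ s - 1 := by
    have := Nat.lt_two_pow_self (n := s)
    lia
  refine ⟨scale M (x ^ (2 ^ s - 1 - s)) b, scale_mem hb _, ?_⟩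
  have e := congrArg (scale M (x ^ (2 ^ s - 1 - s))) hub
  rwa [scale_scale, scale_diff, ← pow_add, ← pow_add, add_assoc, hs, pow_add, pow_one] at e

end Comparison

/-- A finite Koszul grade is at most the Krull dimension. -/
theorem kgrSeq_le_ringKrullDim {A : Type*} [CommRing A] (M : Type*) [AddCommGroup M]
    [Module A M] {n : ℕ} (x : Fin n → A) (h : kgrSeq A M x ≠ ⊤) :
    (kgrSeq A M x : WithBot ℕ∞) ≤ ringKrullDim A := by
  have hne : {i : ℕ∞ | ∃ k : ℕ, i = k ∧ koszulCohomologyNeZero A M x k}.Nonempty := by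
    by_contra hcon
    rw [Set.not_nonempty_iff_eq_empty] at hcon
    exact h (by rw [kgrSeq, hcon, sInf_empty])
  obtain ⟨m, hm, hmne⟩ := csInf_mem hne
  change kgrSeq A M x = m at hm
  have ex : ∀ i < (m : ℤ), ExactAt M x i := by
    intro i hi
    rcases lt_or_ge i 0 with h0 | h0
    · intro z hz _
      refine ⟨0, zero_mem _, ?_⟩
      rw [map_zero]
      ext T
      exact hz T (by lia)
    · lift i to ℕ using h0
      rw [← not_koszulCohomologyNeZero_iff]
      intro hk
      have : kgrSeq A M x ≤ i := sInf_le ⟨i, rfl, hk⟩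
      rw [hm] at this
      have : m ≤ i := by exact_mod_cast this
      lia
  rw [hm]
  by_contra! hlt
  refine (not_koszulCohomologyNeZero_iff x m).2 (exactAt_of_height_lt x m (fun q => ?_) ex) hmne
  have := (Order.height_le_krullDim q).trans_lt hlt
  exact_mod_cast this

end KoszulCochain

/-- If `(A, 𝔪)` is quasi-local and `kgr_A(𝔪, M) < ∞`, then
`kgr_A(𝔪, M) ≤ dim A`. -/
theorem kgr_maximalIdeal_le_krullDim {A : Type*} [CommRing A] [IsLocalRing A]
    (M : Type*) [AddCommGroup M] [Module A M]
    (h : kgr A (IsLocalRing.maximalIdeal A) M ≠ ⊤) :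
    (kgr A (IsLocalRing.maximalIdeal A) M : WithBot ℕ∞) ≤ ringKrullDim A := by
  obtain ⟨d, hd⟩ : ∃ d : ℕ∞, ringKrullDim A = d :=
    ⟨_, (WithBot.coe_unbot _ fun hbot => by
      have h0 := ringKrullDim_nonneg_of_nontrivial (R := A)
      simp [hbot] at h0).symm⟩
  rw [hd, WithBot.coe_le_coe]
  refine iSup_le fun n => iSup_le fun x => iSup_le fun hx => ?_
  have hle : kgrSeq A M x ≤ kgr A (IsLocalRing.maximalIdeal A) M :=
    le_iSup_of_le n (le_iSup_of_le x (le_iSup_of_le hx le_rfl))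
  have := KoszulCochain.kgrSeq_le_ringKrullDim M x (ne_top_of_le_ne_top h hle)
  rwa [hd, WithBot.coe_le_coe] at this
end

section
/- Let A be a commutative ring, 𝔞 an ideal of A and M an A-module. If for every prime ideal 𝔭 minimal over 𝔞 one has kgr_{A_𝔭}(𝔭A_𝔭, M_𝔭) < ∞ (for example, when M is finitely generated), then kgr_A(𝔞, M) ≤ height 𝔞. -/
universe u v w

/-- A module with a square-zero endomorphism raising a `ℤ`-indexed family of submodules by one:
an internally graded model of a cochain complex. -/
structure GradedComplex (R : Type u) [CommRing R] : Type (max u (w + 1)) where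
  /-- The underlying module. -/
  E : Type w
  [addCommGroup : AddCommGroup E]
  [module : Module R E]
  /-- The differential. -/
  d : E →ₗ[R] E
  /-- The homogeneous components. -/
  G : ℤ → Submodule R E
  d_mem : ∀ i, ∀ z ∈ G i, d z ∈ G (i + 1)
  d_d : ∀ z, d (d z) = 0

namespace GradedComplex

attribute [instance] GradedComplex.addCommGroup GradedComplex.module

variable {R : Type u} [CommRing R]

/-- The coboundaries of degree `i`. -/
def boundaries (C : GradedComplex.{u, w} R) (i : ℤ) : Submodule R C.E :=
  (C.G (i - 1)).map C.d

/-- Vanishing of the cohomology in degree `i`. -/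
def Acyclic (C : GradedComplex.{u, w} R) (i : ℤ) : Prop :=
  ∀ z ∈ C.G i, C.d z = 0 → z ∈ C.boundaries i

theorem d_mem' (C : GradedComplex.{u, w} R) {i : ℤ} {z : C.E} (h : z ∈ C.G (i - 1)) :
    C.d z ∈ C.G i := by
  simpa using C.d_mem _ _ h

/-- Morphisms of graded complexes. -/
structure Hom (C : GradedComplex.{u, v} R) (D : GradedComplex.{u, w} R) where
  /-- The underlying linear map. -/
  f : C.E →ₗ[R] D.E
  comm : ∀ z, f (C.d z) = D.d (f z)
  mem : ∀ i, ∀ z ∈ C.G i, f z ∈ D.G i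

/-- The homotopy fibre of a morphism. -/
def fib {C : GradedComplex.{u, v} R} {D : GradedComplex.{u, w} R} (φ : Hom C D) :
    GradedComplex.{u, max v w} R where
  E := C.E × D.E
  d := (C.d ∘ₗ LinearMap.fst R C.E D.E).prod
    (φ.f ∘ₗ LinearMap.fst R C.E D.E - D.d ∘ₗ LinearMap.snd R C.E D.E)
  G i := (C.G i).prod (D.G (i - 1))
  d_mem i z hz := by
    refine ⟨C.d_mem _ _ hz.1, ?_⟩
    have h1 := φ.mem _ _ hz.1
    have h2 := D.d_mem' hz.2
    simpa using sub_mem h1 h2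
  d_d z := by
    ext <;> simp [C.d_d, D.d_d, φ.comm]

section fib

variable {C : GradedComplex.{u, v} R} {D : GradedComplex.{u, w} R} (φ : Hom C D)

theorem fib_d (c : C.E) (y : D.E) :
    (fib φ).d ((c, y) : C.E × D.E) = ((C.d c, φ.f c - D.d y) : C.E × D.E) := rfl

theorem fib_cocycle {c : C.E} {y : D.E} :
    (fib φ).d ((c, y) : C.E × D.E) = 0 ↔ C.d c = 0 ∧ φ.f c = D.d y := by
  rw [fib_d, ← sub_eq_zero (a := φ.f c)]
  exact Prod.mk_eq_zero

theorem mem_fib_boundaries {i : ℤ} {c : C.E} {y : D.E} :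
    ((c, y) : C.E × D.E) ∈ (fib φ).boundaries i ↔
      ∃ b ∈ C.G (i - 1), ∃ t ∈ D.G (i - 1 - 1), C.d b = c ∧ φ.f b - D.d t = y := by
  constructor
  · rintro ⟨⟨b, t⟩, ⟨hb, ht⟩, h⟩
    rw [fib_d] at h
    exact ⟨b, hb, t, ht, congrArg Prod.fst h, congrArg Prod.snd h⟩
  · rintro ⟨b, hb, t, ht, h1, h2⟩
    exact ⟨(b, t), ⟨hb, ht⟩, by rw [fib_d, h1, h2]⟩

end fib

/-- Multiplication by a ring element. -/
def smulHom (C : GradedComplex.{u, w} R) (a : R) : Hom C C where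
  f := LinearMap.lsmul R C.E a
  comm z := by simp
  mem i z hz := (C.G i).smul_mem a hz

/-- The Koszul complex on one element with coefficients in `C`. -/
abbrev cone (a : R) (C : GradedComplex.{u, w} R) : GradedComplex.{u, w} R :=
  fib (C.smulHom a)

@[simp] theorem smulHom_f (C : GradedComplex.{u, w} R) (a : R) (z : C.E) :
    (C.smulHom a).f z = a • z := rfl

/-- The Koszul complex of a finite sequence with coefficients in `C`. -/
def kos : {n : ℕ} → (Fin n → R) → GradedComplex.{u, w} R → GradedComplex.{u, w} R
  | 0, _, C => C
  | _ + 1, x, C => cone (x 0) (kos (fun j => x j.succ) C)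

/-- A module as a complex concentrated in degree zero. -/
def single (R : Type u) [CommRing R] (M : Type w) [AddCommGroup M] [Module R M] :
    GradedComplex.{u, w} R where
  E := M
  d := 0
  G i := if i = 0 then ⊤ else ⊥
  d_mem _ _ _ := zero_mem _
  d_d _ := rfl

/-- Multiplication by `a` is bijective in each degree. -/
def Invertible (a : R) (C : GradedComplex.{u, w} R) : Prop :=
  (∀ z : C.E, a • z = 0 → z = 0) ∧ ∀ i, ∀ z ∈ C.G i, ∃ y ∈ C.G i, a • y = z

theorem Invertible.cone {a : R} {C : GradedComplex.{u, w} R} (h : C.Invertible a) (b : R) :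
    (C.cone b).Invertible a := by
  constructor
  · rintro ⟨c, y⟩ hz
    have hz' : ((a • c, a • y) : C.E × C.E) = 0 := hz
    obtain ⟨h1, h2⟩ := Prod.mk_eq_zero.1 hz'
    exact Prod.mk_eq_zero.2 ⟨h.1 _ h1, h.1 _ h2⟩
  · rintro i ⟨c, y⟩ ⟨hc, hy⟩
    obtain ⟨c', hc', h1⟩ := h.2 _ _ hc
    obtain ⟨y', hy', h2⟩ := h.2 _ _ hy
    exact ⟨(c', y'), ⟨hc', hy'⟩, Prod.ext h1 h2⟩

theorem Invertible.kos {a : R} {C : GradedComplex.{u, w} R} (h : C.Invertible a) {n : ℕ}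
    (x : Fin n → R) : (C.kos x).Invertible a := by
  induction n with
  | zero => exact h
  | succ n ih => exact (ih _).cone _

theorem Invertible.acyclic_cone {a : R} {C : GradedComplex.{u, w} R} (h : C.Invertible a)
    (i : ℤ) : (C.cone a).Acyclic i := by
  rintro ⟨c, y⟩ ⟨hc, hy⟩ hz
  obtain ⟨-, h2⟩ := (fib_cocycle _).1 hz
  obtain ⟨b, hb, rfl⟩ := h.2 _ _ hy
  refine (mem_fib_boundaries _).2 ⟨b, hb, 0, zero_mem _, ?_, by simp⟩
  rw [← sub_eq_zero]
  apply h.1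
  rw [smul_sub, ← map_smul, ← h2, smulHom_f, sub_self]

theorem Acyclic.cone {C : GradedComplex.{u, w} R} {i : ℤ} (h : C.Acyclic i)
    (h' : C.Acyclic (i - 1)) (b : R) : (C.cone b).Acyclic i := by
  rintro ⟨c, y⟩ ⟨hc, hy⟩ hz
  obtain ⟨h1, h2⟩ := (fib_cocycle _).1 hz
  obtain ⟨e, he, rfl⟩ := h c hc h1
  rw [smulHom_f] at h2
  obtain ⟨t, ht, ht'⟩ := h' (b • e - y) (sub_mem (Submodule.smul_mem _ _ he) hy)
    (by rw [map_sub, ← h2, map_smul, sub_self])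
  exact (mem_fib_boundaries _).2 ⟨e, he, t, ht, rfl, by simp [ht']⟩

theorem acyclic_kos {C : GradedComplex.{u, w} R} (h : ∀ i, C.Acyclic i) {n : ℕ}
    (x : Fin n → R) (i : ℤ) : (C.kos x).Acyclic i := by
  induction n generalizing i with
  | zero => exact h i
  | succ n ih => exact (ih _ _).cone (ih _ _) _

theorem acyclic_kos_lt {C : GradedComplex.{u, w} R} {i : ℤ} (h : ∀ j < i, C.Acyclic j) {n : ℕ}
    (x : Fin n → R) (j : ℤ) (hj : j < i) : (C.kos x).Acyclic j := by
  induction n generalizing j with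
  | zero => exact h j hj
  | succ n ih => exact (ih _ _ hj).cone (ih _ _ (by omega)) _

theorem Invertible.acyclic_kos {C : GradedComplex.{u, w} R} {n : ℕ} (x : Fin n → R) (j : Fin n)
    (h : C.Invertible (x j)) (i : ℤ) : (C.kos x).Acyclic i := by
  induction n generalizing i with
  | zero => exact j.elim0
  | succ n ih =>
    induction j using Fin.cases with
    | zero => exact (h.kos _).acyclic_cone i
    | succ j => exact (ih _ j h i).cone (ih _ j h _) _

/-- Every cohomology class of degree `i` is killed by a power of `a`. -/
def PowTorsion (C : GradedComplex.{u, w} R) (a : R) (i : ℤ) : Prop :=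
  ∀ z ∈ C.G i, C.d z = 0 → ∃ k : ℕ, a ^ k • z ∈ C.boundaries i

theorem PowTorsion.cone {C : GradedComplex.{u, w} R} {a : R} {i : ℤ} (h : C.PowTorsion a i)
    (h' : C.Acyclic (i - 1)) (b : R) : (C.cone b).PowTorsion a i := by
  rintro ⟨c, y⟩ ⟨hc, hy⟩ hz
  obtain ⟨h1, h2⟩ := (fib_cocycle _).1 hz
  obtain ⟨k, e, he, hk⟩ := h c hc h1
  rw [smulHom_f] at h2
  obtain ⟨t, ht, ht'⟩ := h' (b • e - a ^ k • y)
    (sub_mem (Submodule.smul_mem _ _ he) (Submodule.smul_mem _ _ hy))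
    (by rw [map_sub, map_smul, map_smul, hk, ← h2, smul_comm, sub_self])
  exact ⟨k, (mem_fib_boundaries _).2 ⟨e, he, t, ht, hk, by simp [ht']⟩⟩

theorem not_acyclic_cone {C : GradedComplex.{u, w} R} {a : R} {i : ℤ} (h : C.PowTorsion a i)
    (hC : ¬ C.Acyclic i) : ¬ (C.cone a).Acyclic i := by
  intro hcone
  apply hC
  intro z hz hdz
  have key : ∀ k : ℕ, a ^ k • z ∈ C.boundaries i → z ∈ C.boundaries i := by
    intro k
    induction k with
    | zero => simp
    | succ k ih =>
      rintro ⟨y, hy, hk⟩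
      apply ih
      have := hcone ((a ^ k • z, y) : C.E × C.E) ⟨Submodule.smul_mem _ _ hz, hy⟩
        ((fib_cocycle _).2 ⟨by simp [hdz], by rw [smulHom_f, hk, smul_smul, pow_succ']⟩)
      obtain ⟨b, hb, -, -, h1, -⟩ := (mem_fib_boundaries _).1 this
      exact ⟨b, hb, h1⟩
  obtain ⟨k, hk⟩ := h z hz hdz
  exact key k hk

theorem not_acyclic_kos {C : GradedComplex.{u, w} R} {i : ℤ} (hC : ¬ C.Acyclic i)
    (hlt : ∀ j < i, C.Acyclic j) {n : ℕ} (x : Fin n → R) (h : ∀ j, C.PowTorsion (x j) i) :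
    ¬ (C.kos x).Acyclic i := by
  have tors : ∀ (m : ℕ) (y : Fin m → R) (a : R), C.PowTorsion a i → (C.kos y).PowTorsion a i := by
    intro m
    induction m with
    | zero => exact fun _ _ h => h
    | succ m ih => exact fun y a h => (ih _ a h).cone (acyclic_kos_lt hlt _ _ (by omega)) _
  induction n with
  | zero => exact hC
  | succ n ih => exact not_acyclic_cone (tors _ _ _ (h 0)) (ih _ fun j => h j.succ)

/-- Degreewise short exact sequences of complexes. -/
structure ShortExact {K : GradedComplex.{u, v} R} {C : GradedComplex.{u, w} R}
    {D : GradedComplex.{u, w'} R} (ι : Hom K C) (π : Hom C D) : Prop where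
  inj : ∀ k, ι.f k = 0 → k = 0
  zero : ∀ k, π.f (ι.f k) = 0
  exact : ∀ i, ∀ c ∈ C.G i, π.f c = 0 → ∃ k ∈ K.G i, ι.f k = c
  surj : ∀ i, ∀ y ∈ D.G i, ∃ c ∈ C.G i, π.f c = y

/-- Functoriality of `cone`. -/
def Hom.cone {C : GradedComplex.{u, v} R} {D : GradedComplex.{u, w} R} (φ : Hom C D) (a : R) :
    Hom (C.cone a) (D.cone a) where
  f := φ.f.prodMap φ.f
  comm := by
    rintro ⟨c, y⟩
    refine Prod.ext (φ.comm c) ?_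
    change φ.f (a • c - C.d y) = a • φ.f c - D.d (φ.f y)
    rw [map_sub, map_smul, φ.comm]
  mem i z hz := ⟨φ.mem _ _ hz.1, φ.mem _ _ hz.2⟩

theorem ShortExact.cone {K : GradedComplex.{u, v} R} {C : GradedComplex.{u, w} R}
    {D : GradedComplex.{u, w'} R} {ι : Hom K C} {π : Hom C D} (h : ShortExact ι π) (a : R) :
    ShortExact (ι.cone a) (π.cone a) where
  inj := by
    rintro ⟨k, l⟩ hk
    have hk' : ((ι.f k, ι.f l) : C.E × C.E) = 0 := hk
    obtain ⟨h1, h2⟩ := Prod.mk_eq_zero.1 hk'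
    exact Prod.mk_eq_zero.2 ⟨h.inj _ h1, h.inj _ h2⟩
  zero := by
    rintro ⟨k, l⟩
    exact Prod.mk_eq_zero.2 ⟨h.zero _, h.zero _⟩
  exact := by
    rintro i ⟨c, y⟩ ⟨hc, hy⟩ hz
    have hz' : ((π.f c, π.f y) : D.E × D.E) = 0 := hz
    obtain ⟨h1, h2⟩ := Prod.mk_eq_zero.1 hz'
    obtain ⟨k, hk, rfl⟩ := h.exact _ _ hc h1
    obtain ⟨l, hl, rfl⟩ := h.exact _ _ hy h2
    exact ⟨(k, l), ⟨hk, hl⟩, rfl⟩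
  surj := by
    rintro i ⟨c, y⟩ ⟨hc, hy⟩
    obtain ⟨k, hk, rfl⟩ := h.surj _ _ hc
    obtain ⟨l, hl, rfl⟩ := h.surj _ _ hy
    exact ⟨(k, l), ⟨hk, hl⟩, rfl⟩

theorem ShortExact.kos {K : GradedComplex.{u, v} R} {C : GradedComplex.{u, w} R}
    {D : GradedComplex.{u, w'} R} {ι : Hom K C} {π : Hom C D} (h : ShortExact ι π) {n : ℕ}
    (x : Fin n → R) :
    ∃ (ι' : Hom (K.kos x) (C.kos x)) (π' : Hom (C.kos x) (D.kos x)), ShortExact ι' π' := by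
  induction n with
  | zero => exact ⟨ι, π, h⟩
  | succ n ih =>
    obtain ⟨_, _, h'⟩ := ih fun j => x j.succ
    exact ⟨_, _, h'.cone (x 0)⟩

theorem ShortExact.acyclic_iff {K : GradedComplex.{u, v} R} {C : GradedComplex.{u, w} R}
    {D : GradedComplex.{u, w'} R} {ι : Hom K C} {π : Hom C D} (h : ShortExact ι π)
    (hK : ∀ i, K.Acyclic i) (i : ℤ) : C.Acyclic i ↔ D.Acyclic i := by
  constructor
  · intro hC y hy hdy
    obtain ⟨c, hc, rfl⟩ := h.surj _ _ hy
    obtain ⟨k, hk, hkc⟩ := h.exact _ _ (C.d_mem _ _ hc) (by rw [π.comm, hdy])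
    have hdk : K.d k = 0 := h.inj _ (by rw [ι.comm, hkc, C.d_d])
    obtain ⟨l, hl, rfl⟩ := hK _ _ hk hdk
    rw [add_sub_cancel_right] at hl
    obtain ⟨b, hb, hb'⟩ := hC (c - ι.f l) (sub_mem hc (ι.mem _ _ hl))
      (by rw [map_sub, ← ι.comm, hkc, sub_self])
    exact ⟨π.f b, π.mem _ _ hb, by rw [← π.comm, hb', map_sub, h.zero, sub_zero]⟩
  · intro hD c hc hdc
    obtain ⟨y, hy, hy'⟩ := hD (π.f c) (π.mem _ _ hc) (by rw [← π.comm, hdc, map_zero])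
    obtain ⟨b, hb, rfl⟩ := h.surj _ _ hy
    obtain ⟨k, hk, hkc⟩ := h.exact i (c - C.d b) (sub_mem hc (C.d_mem' hb))
      (by rw [map_sub, π.comm, hy', sub_self])
    have hdk : K.d k = 0 := h.inj _ (by rw [ι.comm, hkc, map_sub, hdc, C.d_d, sub_zero])
    obtain ⟨l, hl, rfl⟩ := hK _ _ hk hdk
    exact ⟨b + ι.f l, add_mem hb (ι.mem _ _ hl), by
      rw [map_add, ← ι.comm, hkc, add_sub_cancel]⟩

/-- The shift of a complex by one to the right. -/
def shift (C : GradedComplex.{u, w} R) : GradedComplex.{u, w} R where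
  E := C.E
  d := -C.d
  G i := C.G (i - 1)
  d_mem i z hz := by simpa using neg_mem (C.d_mem' hz)
  d_d z := by simp [C.d_d]

/-- The inclusion of the shifted target into the fibre. -/
def fibInr {C : GradedComplex.{u, v} R} {D : GradedComplex.{u, w} R} (φ : Hom C D) :
    Hom D.shift (fib φ) where
  f := LinearMap.inr R C.E D.E
  comm z := by
    refine Prod.ext (map_zero C.d).symm ?_
    change -D.d z = φ.f 0 - D.d z
    rw [map_zero, zero_sub]
  mem i z hz := ⟨zero_mem _, hz⟩

/-- The projection of the fibre to the source. -/
def fibFst {C : GradedComplex.{u, v} R} {D : GradedComplex.{u, w} R} (φ : Hom C D) :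
    Hom (fib φ) C where
  f := LinearMap.fst R C.E D.E
  comm _ := rfl
  mem _ _ hz := hz.1

theorem fib_shortExact {C : GradedComplex.{u, v} R} {D : GradedComplex.{u, w} R}
    (φ : Hom C D) : ShortExact (fibInr φ) (fibFst φ) where
  inj k hk := congrArg (Prod.snd : C.E × D.E → D.E) hk
  zero _ := rfl
  exact := by
    rintro i ⟨c, y⟩ ⟨-, hy⟩ hc
    obtain rfl : c = 0 := hc
    exact ⟨y, hy, rfl⟩
  surj i y hy := ⟨((y, 0) : C.E × D.E), ⟨hy, zero_mem _⟩, rfl⟩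

section loc

variable (C : GradedComplex.{u, w} R) (a : R)

/-- The localization map away from `a`. -/
noncomputable abbrev locMk : C.E →ₗ[R] LocalizedModule (Submonoid.powers a) C.E :=
  LocalizedModule.mkLinearMap (Submonoid.powers a) C.E

theorem locMk_eq_zero {c : C.E} (h : C.locMk a c = 0) : ∃ k : ℕ, a ^ k • c = 0 := by
  obtain ⟨⟨_, k, rfl⟩, hk⟩ := (IsLocalizedModule.eq_zero_iff (Submonoid.powers a) (C.locMk a)).1 h
  exact ⟨k, hk⟩

theorem loc_pow_smul_inj (k : ℕ) {y z : LocalizedModule (Submonoid.powers a) C.E}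
    (h : a ^ k • y = a ^ k • z) : y = z :=
  IsLocalizedModule.smul_injective (C.locMk a) (⟨a ^ k, k, rfl⟩ : Submonoid.powers a) h

theorem loc_exists_pow_smul_eq (k : ℕ) (z : LocalizedModule (Submonoid.powers a) C.E) :
    ∃ y, a ^ k • y = z :=
  ((Module.End.isUnit_iff _).1
    (IsLocalizedModule.map_units (C.locMk a) (⟨a ^ k, k, rfl⟩ : Submonoid.powers a))).2 z

/-- The localization of a complex away from `a`. -/
noncomputable def loc : GradedComplex.{u, max u w} R where
  E := LocalizedModule (Submonoid.powers a) C.E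
  d := IsLocalizedModule.map (Submonoid.powers a) (C.locMk a) (C.locMk a) C.d
  G i :=
    { carrier := {y | ∃ k : ℕ, ∃ c ∈ C.G i, a ^ k • y = C.locMk a c}
      zero_mem' := ⟨0, 0, zero_mem _, by simp⟩
      add_mem' := by
        rintro y z ⟨k, c, hc, h⟩ ⟨l, e, he, h'⟩
        refine ⟨k + l, a ^ l • c + a ^ k • e,
          add_mem (Submodule.smul_mem _ _ hc) (Submodule.smul_mem _ _ he), ?_⟩
        rw [map_add, map_smul, map_smul, ← h, ← h', smul_smul, smul_smul, smul_add, pow_add,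
          mul_comm (a ^ l)]
      smul_mem' := by
        rintro r y ⟨k, c, hc, h⟩
        exact ⟨k, r • c, Submodule.smul_mem _ _ hc, by rw [map_smul, ← h, smul_comm]⟩ }
  d_mem := by
    rintro i y ⟨k, c, hc, h⟩
    refine ⟨k, C.d c, C.d_mem _ _ hc, ?_⟩
    rw [← map_smul, h, IsLocalizedModule.map_apply]
  d_d y := by
    obtain ⟨⟨c, ⟨_, k, rfl⟩⟩, hc⟩ := IsLocalizedModule.surj (Submonoid.powers a) (C.locMk a) y
    have hc' : a ^ k • y = C.locMk a c := hc
    apply C.loc_pow_smul_inj a k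
    rw [← map_smul, ← map_smul, hc', IsLocalizedModule.map_apply, IsLocalizedModule.map_apply,
      C.d_d, map_zero, smul_zero]

/-- The localization map as a morphism of complexes. -/
noncomputable def toLoc : Hom C (C.loc a) where
  f := C.locMk a
  comm z := (IsLocalizedModule.map_apply (Submonoid.powers a) (C.locMk a) (C.locMk a) C.d z).symm
  mem _ z hz := ⟨0, z, hz, (by rw [pow_zero, one_smul] : a ^ 0 • C.locMk a z = C.locMk a z)⟩

variable {C a}

theorem toLoc_eq_zero {c : C.E} (h : (C.toLoc a).f c = 0) : ∃ k : ℕ, a ^ k • c = 0 :=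
  C.locMk_eq_zero a h

theorem mem_loc_G {i : ℤ} {y : (C.loc a).E} :
    y ∈ (C.loc a).G i ↔ ∃ k : ℕ, ∃ c ∈ C.G i, a ^ k • y = (C.toLoc a).f c := Iff.rfl

theorem loc_smul_inj {k : ℕ} {y z : (C.loc a).E} (h : a ^ k • y = a ^ k • z) : y = z :=
  C.loc_pow_smul_inj a k h

theorem loc_exists_smul_eq (k : ℕ) {i : ℤ} {z : (C.loc a).E} (hz : z ∈ (C.loc a).G i) :
    ∃ y ∈ (C.loc a).G i, a ^ k • y = z := by
  obtain ⟨y, hy⟩ : ∃ y : (C.loc a).E, a ^ k • y = z := C.loc_exists_pow_smul_eq a k z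
  obtain ⟨l, c, hc, h⟩ := mem_loc_G.1 hz
  exact ⟨y, mem_loc_G.2 ⟨l + k, c, hc, by rw [pow_add, mul_smul, hy, h]⟩, hy⟩

theorem loc_invertible : (C.loc a).Invertible a := by
  constructor
  · intro z hz
    apply loc_smul_inj (k := 1)
    rw [pow_one, hz, smul_zero]
  · intro i z hz
    simpa using loc_exists_smul_eq 1 hz

/-- A cocycle of the localization comes from a cocycle up to a power of `a`. -/
theorem loc_exists_cocycle {i : ℤ} {y : (C.loc a).E} (hy : y ∈ (C.loc a).G i)
    (hdy : (C.loc a).d y = 0) :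
    ∃ k : ℕ, ∃ c ∈ C.G i, C.d c = 0 ∧ a ^ k • y = (C.toLoc a).f c := by
  obtain ⟨k, c, hc, h⟩ := mem_loc_G.1 hy
  obtain ⟨m, hm⟩ := toLoc_eq_zero (c := C.d c) (a := a) (by
    rw [(C.toLoc a).comm, ← h, map_smul, hdy, smul_zero])
  exact ⟨m + k, a ^ m • c, Submodule.smul_mem _ _ hc, by rw [map_smul, hm], by
    rw [map_smul, ← h, smul_smul, pow_add]⟩

theorem loc_mem_boundaries {i : ℤ} {y : (C.loc a).E} {k : ℕ} {c : C.E}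
    (hc : c ∈ C.boundaries i) (h : a ^ k • y = (C.toLoc a).f c) :
    y ∈ (C.loc a).boundaries i := by
  obtain ⟨b, hb, rfl⟩ := hc
  obtain ⟨e, he, he'⟩ := loc_exists_smul_eq k ((C.toLoc a).mem _ _ hb)
  refine ⟨e, he, loc_smul_inj (k := k) ?_⟩
  rw [h, (C.toLoc a).comm, ← he', map_smul]

variable (C a) in
/-- The Čech complex on one element with coefficients in `C`. -/
noncomputable abbrev cech : GradedComplex.{u, max u w} R := fib (C.toLoc a)

theorem Invertible.shift {D : GradedComplex.{u, w} R} (h : D.Invertible a) :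
    D.shift.Invertible a :=
  ⟨h.1, fun _ z hz => h.2 _ z hz⟩

theorem acyclic_kos_cech_iff {n : ℕ} (x : Fin n → R) (j : Fin n) (i : ℤ) :
    ((C.cech (x j)).kos x).Acyclic i ↔ (C.kos x).Acyclic i := by
  obtain ⟨ι, π, h⟩ := (fib_shortExact (C.toLoc (x j))).kos x
  exact h.acyclic_iff (Invertible.acyclic_kos x j loc_invertible.shift) i

theorem cech_powTorsion_self (i : ℤ) : (C.cech a).PowTorsion a i := by
  rintro ⟨c, y⟩ ⟨-, hy⟩ hz
  obtain ⟨-, h2⟩ := (fib_cocycle _).1 hz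
  obtain ⟨k, b, hb, h⟩ := mem_loc_G.1 hy
  obtain ⟨m, hm⟩ := toLoc_eq_zero (c := a ^ k • c - C.d b) (a := a) (by
    rw [map_sub, map_smul, h2, (C.toLoc a).comm, ← h, map_smul, sub_self])
  rw [smul_sub, sub_eq_zero, smul_smul, ← pow_add] at hm
  refine ⟨m + k, (mem_fib_boundaries _).2 ⟨a ^ m • b, Submodule.smul_mem _ _ hb, 0, zero_mem _,
    ?_, ?_⟩⟩
  · rw [map_smul, hm]
  · rw [map_zero, sub_zero, map_smul, ← h, smul_smul, pow_add]

/-- A cocycle of the fibre whose first component is a coboundary is cohomologous to one coming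
from the target. -/
theorem fib_exists_of_boundary {C : GradedComplex.{u, v} R} {D : GradedComplex.{u, w} R}
    {φ : Hom C D} {i : ℤ} {c : C.E} {y : D.E} (hy : y ∈ D.G (i - 1)) (h2 : φ.f c = D.d y) {s : R}
    (hc : s • c ∈ C.boundaries i) :
    ∃ y' ∈ D.G (i - 1), D.d y' = 0 ∧ ∀ r : R, r • y' ∈ D.boundaries (i - 1) →
      (r * s) • (show (fib φ).E from (c, y)) ∈ (fib φ).boundaries i := by
  obtain ⟨b, hb, hbc⟩ := hc
  refine ⟨s • y - φ.f b, sub_mem (Submodule.smul_mem _ _ hy) (φ.mem _ _ hb), by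
    rw [map_sub, ← φ.comm, hbc, map_smul, map_smul, h2, sub_self], ?_⟩
  rintro r ⟨t, ht, h⟩
  refine (mem_fib_boundaries _).2 ⟨r • b, Submodule.smul_mem _ _ hb, -t, neg_mem ht, ?_, ?_⟩
  · rw [map_smul, hbc, smul_smul]
  · rw [map_neg, h, map_smul, smul_sub, smul_smul]
    abel

theorem PowTorsion.cech {b : R} (h : ∀ i, C.PowTorsion b i) (i : ℤ) :
    (C.cech a).PowTorsion b i := by
  rintro ⟨c, y⟩ ⟨hc, hy⟩ hz
  obtain ⟨h1, h2⟩ := (fib_cocycle _).1 hz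
  obtain ⟨k, hk⟩ := h i c hc h1
  obtain ⟨y', hy', hdy', H⟩ := fib_exists_of_boundary hy h2 hk
  obtain ⟨l, e, he, hde, hl⟩ := loc_exists_cocycle hy' hdy'
  obtain ⟨m, hm⟩ := h _ e he hde
  refine ⟨m + k, ?_⟩
  have := H (b ^ m) (loc_mem_boundaries (k := l) hm (by rw [smul_comm, hl, map_smul]))
  rw [pow_add]
  exact this

/-- At every prime of the support of the cohomology in degree `i`, the height is at least `i`. -/
def HeightBound (C : GradedComplex.{u, w} R) : Prop :=
  ∀ (i : ℤ) (q : PrimeSpectrum R), ∀ z ∈ C.G i, C.d z = 0 →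
    (∀ s ∉ q.asIdeal, s • z ∉ C.boundaries i) → (i.toNat : ℕ∞) ≤ Order.height q

theorem HeightBound.cech (h : C.HeightBound) : (C.cech a).HeightBound := by
  rintro i q ⟨c, y⟩ ⟨hc, hy⟩ hz hq
  obtain ⟨h1, h2⟩ := (fib_cocycle _).1 hz
  have haq : a ∈ q.asIdeal := by
    by_contra haq
    obtain ⟨k, hk⟩ := cech_powTorsion_self i ((c, y) : C.E × (C.loc a).E) ⟨hc, hy⟩ hz
    exact hq _ (fun hmem => haq (q.isPrime.mem_of_pow_mem _ hmem)) hk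
  by_cases hcq : ∀ s ∉ q.asIdeal, s • c ∉ C.boundaries i
  · exact h i q c hc h1 hcq
  push Not at hcq
  obtain ⟨s, hs, hsc⟩ := hcq
  obtain ⟨y', hy', hdy', H⟩ := fib_exists_of_boundary hy h2 hsc
  obtain ⟨l, e, he, hde, hl⟩ := loc_exists_cocycle hy' hdy'
  let I : Ideal R := (C.boundaries (i - 1)).comap (LinearMap.toSpanSingleton R C.E e)
  have hI : ∀ r, r ∈ I ↔ r • e ∈ C.boundaries (i - 1) := fun r => Iff.rfl
  have hdisj : Disjoint (I : Set R) (Submonoid.powers a ⊔ q.asIdeal.primeCompl : Submonoid R) := by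
    rw [Set.disjoint_left]
    rintro r hr hr'
    obtain ⟨_, ⟨k, rfl⟩, t, ht, rfl⟩ := Submonoid.mem_sup.1 hr'
    have hr'' := (hI _).1 hr
    refine hq (t * s) (q.asIdeal.primeCompl.mul_mem ht hs) ?_
    exact H t (loc_mem_boundaries (k := k + l) hr'' (by
      rw [map_smul, ← hl, smul_smul, smul_smul, pow_add]
      congr 1
      ring))
  obtain ⟨p, hp, hIp, hpS⟩ := Ideal.exists_le_prime_disjoint I _ hdisj
  rw [Set.disjoint_right] at hpS
  have hap : a ∉ p := hpS (Submonoid.mem_sup_left (Submonoid.mem_powers a))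
  have hpq : (⟨p, hp⟩ : PrimeSpectrum R) < q := by
    refine lt_of_le_not_ge (fun r hr => ?_) fun hle => hap (hle haq)
    by_contra hrq
    exact hpS (Submonoid.mem_sup_right (show r ∈ q.asIdeal.primeCompl from hrq)) hr
  have hp' := h (i - 1) ⟨p, hp⟩ e he hde fun r hr hr' => hr (hIp ((hI r).2 hr'))
  calc (i.toNat : ℕ∞) ≤ ((i - 1).toNat : ℕ∞) + 1 := by exact_mod_cast by omega
    _ ≤ Order.height (⟨p, hp⟩ : PrimeSpectrum R) + 1 := by gcongr
    _ ≤ Order.height q := Order.height_add_one_le hpq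

end loc

theorem heightBound_single (M : Type w) [AddCommGroup M] [Module R M] :
    (single R M).HeightBound := by
  intro i q z hz _ hq
  by_cases hi : i = 0
  · simp [hi]
  · have hz0 : z = 0 := by
      simp only [single, hi, if_false] at hz
      exact (Submodule.mem_bot R).1 hz
    exact absurd (by rw [hz0, smul_zero]; exact zero_mem _)
      (hq 1 ((Ideal.ne_top_iff_one _).1 q.isPrime.ne_top))

theorem exists_cech (M : Type (max u v)) [AddCommGroup M] [Module R M] {n : ℕ} (x : Fin n → R)
    (s : Finset (Fin n)) :
    ∃ N : GradedComplex.{u, max u v} R, N.HeightBound ∧ (∀ i < 0, N.G i = ⊥) ∧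
      (∀ j ∈ s, ∀ i, N.PowTorsion (x j) i) ∧
      ∀ i, (N.kos x).Acyclic i ↔ ((single R M).kos x).Acyclic i := by
  induction s using Finset.induction_on with
  | empty =>
    exact ⟨single R M, heightBound_single M, fun i hi => if_neg hi.ne, by simp,
      fun _ => Iff.rfl⟩
  | insert j s _ ih =>
    obtain ⟨N, h1, h2, h3, h4⟩ := ih
    refine ⟨N.cech (x j), h1.cech, fun i hi => ?_, fun k hk => ?_, fun i => ?_⟩
    · rw [Submodule.eq_bot_iff]
      rintro ⟨c, y⟩ ⟨hc, hy⟩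
      obtain ⟨l, b, hb, h⟩ := mem_loc_G.1 hy
      rw [h2 _ (by omega), Submodule.mem_bot] at hb
      rw [h2 _ hi] at hc
      refine Prod.mk_eq_zero.2 ⟨hc, loc_smul_inj (k := l) ?_⟩
      rw [h, hb, map_zero, smul_zero]
    · obtain rfl | hk := Finset.mem_insert.1 hk
      · exact cech_powTorsion_self
      · exact PowTorsion.cech (h3 k hk)
    · rw [acyclic_kos_cech_iff, h4]

theorem acyclic_kos_single [IsLocalRing R] (M : Type (max u v)) [AddCommGroup M] [Module R M]
    {n : ℕ} (x : Fin n → R)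
    (h : ∀ i : ℕ, (i : ℕ∞) ≤ Order.height (IsLocalRing.closedPoint R) →
      ((single R M).kos x).Acyclic i) (i : ℤ) :
    ((single R M).kos x).Acyclic i := by
  obtain ⟨N, h1, h2, h3, h4⟩ := exists_cech M x Finset.univ
  have key : ∀ m : ℕ, ∀ j < (m : ℤ), N.Acyclic j := by
    intro m
    induction m with
    | zero =>
      intro j hj z hz _
      rw [h2 j hj, Submodule.mem_bot] at hz
      exact hz ▸ zero_mem _
    | succ m ih =>
      intro j hj
      obtain hj | rfl : j < m ∨ j = m := by omega
      · exact ih j hj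
      by_contra hN
      refine not_acyclic_kos hN ih x (fun k => h3 k (Finset.mem_univ _) _) ((h4 _).2 (h m ?_))
      simp only [Acyclic, not_forall] at hN
      obtain ⟨z, hz, hdz, hzb⟩ := hN
      refine h1 m _ z hz hdz fun s hs hsz => hzb ?_
      have hu : IsUnit s := by simpa [IsLocalRing.closedPoint] using hs
      exact (Submodule.smul_mem_iff_of_isUnit _ hu).1 hsz
  rw [← h4]
  exact acyclic_kos (fun j => key (j.toNat + 1) j (by omega)) x i

end GradedComplex

section KoszulDifferential

variable {R : Type u} [CommRing R] {M : Type w} [AddCommGroup M] [Module R M]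

/-- The Koszul differential on all degrees at once. -/
def koszulDiff (M : Type w) [AddCommGroup M] [Module R M] {n : ℕ} (x : Fin n → R) :
    (Finset (Fin n) → M) →ₗ[R] (Finset (Fin n) → M) where
  toFun g t := ∑ j ∈ t, (((-1 : R) ^ (t.filter (fun k => k < j)).card) * x j) • g (t.erase j)
  map_add' g h := funext fun t => by simp [smul_add, Finset.sum_add_distrib]
  map_smul' a g := funext fun t => by
    simp only [Pi.smul_apply, RingHom.id_apply, Finset.smul_sum]
    exact Finset.sum_congr rfl fun j _ => by rw [smul_smul, smul_smul, mul_comm]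

theorem koszulDiff_apply {n : ℕ} (x : Fin n → R) (g : Finset (Fin n) → M) (t : Finset (Fin n)) :
    koszulDiff M x g t =
      ∑ j ∈ t, (((-1 : R) ^ (t.filter (fun k => k < j)).card) * x j) • g (t.erase j) := rfl

/-- Functions on subsets supported on those of cardinality `i`. -/
def SupportedAt {n : ℕ} (i : ℤ) (g : Finset (Fin n) → M) : Prop :=
  ∀ t, (t.card : ℤ) ≠ i → g t = 0

theorem koszulDiff_map_succ {n : ℕ} (x : Fin (n + 1) → R) (g : Finset (Fin (n + 1)) → M)
    (t : Finset (Fin n)) :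
    koszulDiff M x g (t.map (Fin.succEmb n)) =
      koszulDiff M (fun j => x j.succ) (fun s => g (s.map (Fin.succEmb n))) t := by
  simp only [koszulDiff_apply, Finset.sum_map, Finset.filter_map, Finset.card_map,
    Finset.map_erase]
  simp [Function.comp_def]

theorem zero_notMem_map_succ {n : ℕ} (t : Finset (Fin n)) :
    (0 : Fin (n + 1)) ∉ t.map (Fin.succEmb n) := by
  simp [Fin.succ_ne_zero]

theorem koszulDiff_insert_zero {n : ℕ} (x : Fin (n + 1) → R) (g : Finset (Fin (n + 1)) → M)
    (t : Finset (Fin n)) :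
    koszulDiff M x g (insert 0 (t.map (Fin.succEmb n))) =
      x 0 • g (t.map (Fin.succEmb n)) -
        koszulDiff M (fun j => x j.succ) (fun s => g (insert 0 (s.map (Fin.succEmb n)))) t := by
  rw [koszulDiff_apply, Finset.sum_insert (zero_notMem_map_succ t),
    Finset.erase_insert (zero_notMem_map_succ t), sub_eq_add_neg]
  congr 1
  · simp
  · rw [koszulDiff_apply, Finset.sum_map, ← Finset.sum_neg_distrib]
    refine Finset.sum_congr rfl fun j _ => ?_
    have h1 : (insert 0 (t.map (Fin.succEmb n))).erase (Fin.succEmb n j) =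
        insert 0 ((t.erase j).map (Fin.succEmb n)) := by
      rw [Finset.erase_insert_of_ne (by simp [eq_comm, Fin.succ_ne_zero]), Finset.map_erase]
    have h2 : ((insert 0 (t.map (Fin.succEmb n))).filter (· < Fin.succEmb n j)).card =
        (t.filter (· < j)).card + 1 := by
      rw [Finset.filter_insert, if_pos (by simp), Finset.card_insert_of_notMem
        (fun h => zero_notMem_map_succ t (Finset.mem_filter.1 h).1), Finset.filter_map,
        Finset.card_map]
      simp [Function.comp_def]
    rw [h1, h2, pow_succ, ← neg_smul]
    simp

/-- The successors whose image lies in a given subset. -/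
def succPreimage {n : ℕ} (t : Finset (Fin (n + 1))) : Finset (Fin n) :=
  Finset.univ.filter fun j => j.succ ∈ t

theorem succPreimage_map {n : ℕ} (t : Finset (Fin n)) :
    succPreimage (t.map (Fin.succEmb n)) = t := by
  ext j; simp [succPreimage]

theorem succPreimage_insert {n : ℕ} (t : Finset (Fin n)) :
    succPreimage (insert 0 (t.map (Fin.succEmb n))) = t := by
  ext j; simp [succPreimage, Fin.succ_ne_zero]

theorem map_succPreimage {n : ℕ} {t : Finset (Fin (n + 1))} (h : 0 ∉ t) :
    (succPreimage t).map (Fin.succEmb n) = t := by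
  ext j
  induction j using Fin.cases with
  | zero => simp [h, Fin.succ_ne_zero]
  | succ j => simp [succPreimage]

theorem insert_succPreimage {n : ℕ} {t : Finset (Fin (n + 1))} (h : 0 ∈ t) :
    insert 0 ((succPreimage t).map (Fin.succEmb n)) = t := by
  ext j
  induction j using Fin.cases with
  | zero => simp [h]
  | succ j => simp [succPreimage, Fin.succ_ne_zero]

variable (R M) in
/-- Splitting functions on subsets according to membership of `0`. -/
def splitZero (n : ℕ) :
    (Finset (Fin (n + 1)) → M) ≃ₗ[R] (Finset (Fin n) → M) × (Finset (Fin n) → M) where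
  toFun g := (fun s => g (s.map (Fin.succEmb n)), fun s => g (insert 0 (s.map (Fin.succEmb n))))
  map_add' _ _ := rfl
  map_smul' _ _ := rfl
  invFun p t := if 0 ∈ t then p.2 (succPreimage t) else p.1 (succPreimage t)
  left_inv g := by
    funext t
    by_cases h : 0 ∈ t
    · simp [h, insert_succPreimage h]
    · simp [h, map_succPreimage h]
  right_inv p := by
    ext t
    · simp [succPreimage_map, Fin.succ_ne_zero]
    · simp [succPreimage_insert]

theorem supportedAt_succ_iff {n : ℕ} {i : ℤ} {g : Finset (Fin (n + 1)) → M} :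
    SupportedAt i g ↔ SupportedAt i (splitZero R M n g).1 ∧
      SupportedAt (i - 1) (splitZero R M n g).2 := by
  constructor
  · intro h
    refine ⟨fun t ht => h _ (by simpa using ht), fun t ht => h _ ?_⟩
    rw [Finset.card_insert_of_notMem (zero_notMem_map_succ t), Finset.card_map]
    push_cast
    omega
  · rintro ⟨h1, h2⟩ t ht
    by_cases h0 : 0 ∈ t
    · rw [← insert_succPreimage h0] at ht ⊢
      refine h2 _ ?_
      rw [Finset.card_insert_of_notMem (zero_notMem_map_succ _), Finset.card_map] at ht
      push_cast at ht
      omega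
    · rw [← map_succPreimage h0] at ht ⊢
      exact h1 _ (by simpa using ht)

open GradedComplex in
theorem exists_equiv_kos {n : ℕ} (x : Fin n → R) :
    ∃ e : (Finset (Fin n) → M) ≃ₗ[R] ((single R M).kos x).E,
      (∀ g, e (koszulDiff M x g) = ((single R M).kos x).d (e g)) ∧
      ∀ i g, e g ∈ ((single R M).kos x).G i ↔ SupportedAt i g := by
  induction n with
  | zero =>
    refine ⟨LinearEquiv.funUnique (Finset (Fin 0)) R M, fun g => ?_, fun i g => ?_⟩
    · change koszulDiff M x g default = 0
      rw [koszulDiff_apply, Finset.eq_empty_of_isEmpty default, Finset.sum_empty]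
    · change g default ∈ (if i = 0 then (⊤ : Submodule R M) else ⊥) ↔ _
      rw [Finset.eq_empty_of_isEmpty default]
      constructor
      · intro h t ht
        obtain rfl := Finset.eq_empty_of_isEmpty t
        rw [if_neg (by simpa [eq_comm] using ht)] at h
        exact h
      · intro h
        split_ifs with hi
        · trivial
        · exact h ∅ (by simpa [eq_comm] using hi)
  | succ n ih =>
    obtain ⟨e, h1, h2⟩ := ih fun j => x j.succ
    refine ⟨(splitZero R M n).trans (e.prodCongr e), fun g => ?_, fun i g => ?_⟩
    · refine Prod.ext ?_ ?_
      · change e (fun s => koszulDiff M x g (s.map (Fin.succEmb n))) = _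
        simp only [koszulDiff_map_succ]
        exact h1 _
      · change e (fun s => koszulDiff M x g (insert 0 (s.map (Fin.succEmb n)))) =
          x 0 • e (splitZero R M n g).1 - (kos _ _).d (e (splitZero R M n g).2)
        rw [← h1, ← map_smul, ← map_sub]
        congr 1
        funext s
        exact koszulDiff_insert_zero x g s
    · rw [supportedAt_succ_iff (R := R), ← h2, ← h2]
      rfl

/-- Vanishing of the Koszul cohomology in degree `i`, for functions on all subsets. -/
def KoszulAcyclic (M : Type w) [AddCommGroup M] [Module R M] {n : ℕ} (x : Fin n → R)
    (i : ℤ) : Prop :=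
  ∀ g : Finset (Fin n) → M, SupportedAt i g → koszulDiff M x g = 0 →
    ∃ h, SupportedAt (i - 1) h ∧ koszulDiff M x h = g

theorem koszulAcyclic_iff_acyclic_kos {n : ℕ} (x : Fin n → R) (i : ℤ) :
    KoszulAcyclic M x i ↔ ((GradedComplex.single R M).kos x).Acyclic i := by
  obtain ⟨e, h1, h2⟩ := exists_equiv_kos (M := M) x
  constructor
  · intro H z hz hdz
    obtain ⟨g, rfl⟩ := e.surjective z
    obtain ⟨h, hh, rfl⟩ := H g ((h2 _ _).1 hz)
      (e.injective (by rw [h1, hdz, map_zero]))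
    exact ⟨e h, (h2 _ _).2 hh, (h1 h).symm⟩
  · intro H g hg hdg
    obtain ⟨y, hy, hyz⟩ := H (e g) ((h2 _ _).2 hg) (by rw [← h1, hdg, map_zero])
    obtain ⟨h, rfl⟩ := e.surjective y
    exact ⟨h, (h2 _ _).1 hy, e.injective (by rw [h1, hyz])⟩

/-- Extension by zero of a function on subsets of cardinality `i`. -/
def extendCard {n i : ℕ} (g : {s : Finset (Fin n) // s.card = i} → M) : Finset (Fin n) → M :=
  fun s => if h : s.card = i then g ⟨s, h⟩ else 0

theorem extendCard_coe {n i : ℕ} (g : {s : Finset (Fin n) // s.card = i} → M)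
    (s : {s : Finset (Fin n) // s.card = i}) : extendCard g s.1 = g s := by
  simp [extendCard, s.2]

theorem supportedAt_extendCard {n i : ℕ} (g : {s : Finset (Fin n) // s.card = i} → M) :
    SupportedAt i (extendCard g) := fun t ht => dif_neg (by exact_mod_cast ht)

theorem extendCard_restrict {n i : ℕ} {g : Finset (Fin n) → M} (hg : SupportedAt i g) :
    extendCard (fun s : {s : Finset (Fin n) // s.card = i} => g s.1) = g := by
  funext t
  by_cases h : t.card = i
  · simp [extendCard, h]
  · rw [hg t (by exact_mod_cast h)]
    exact dif_neg h

theorem koszulDiff_extendCard {n : ℕ} (x : Fin n → R) {i : ℕ}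
    (g : {s : Finset (Fin n) // s.card = i} → M) :
    koszulDiff M x (extendCard g) = extendCard (koszulMap R M x i g) := by
  funext t
  rw [koszulDiff_apply]
  by_cases h : t.card = i + 1
  · rw [extendCard, dif_pos h, koszulMap, LinearMap.coe_mk, AddHom.coe_mk, ← Finset.sum_attach]
    refine Finset.sum_congr rfl fun j _ => ?_
    congr 1
    exact extendCard_coe g ⟨t.erase j.1, by rw [Finset.card_erase_of_mem j.2, h]; omega⟩
  · rw [extendCard, dif_neg h]
    refine Finset.sum_eq_zero fun j hj => ?_
    rw [extendCard, dif_neg, smul_zero]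
    have := Finset.card_erase_add_one hj
    omega

theorem extendCard_injective {n i : ℕ} :
    Function.Injective (extendCard : ({s : Finset (Fin n) // s.card = i} → M) → _) := by
  intro g h hgh
  funext s
  rw [← extendCard_coe g, hgh, extendCard_coe]

theorem extendCard_zero {n i : ℕ} :
    extendCard (0 : {s : Finset (Fin n) // s.card = i} → M) = 0 := by
  funext s
  simp [extendCard]

theorem mem_ker_koszulMap_iff {n : ℕ} (x : Fin n → R) {i : ℕ}
    (g : {s : Finset (Fin n) // s.card = i} → M) :
    g ∈ LinearMap.ker (koszulMap R M x i) ↔ koszulDiff M x (extendCard g) = 0 := by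
  rw [LinearMap.mem_ker, koszulDiff_extendCard, ← extendCard_zero (i := i + 1),
    extendCard_injective.eq_iff]

theorem koszulCohomologyNeZero_iff {n : ℕ} (x : Fin n → R) (i : ℕ) :
    koszulCohomologyNeZero R M x i ↔ ¬ KoszulAcyclic M x i := by
  cases i with
  | zero =>
    refine not_congr ⟨fun H g hg hdg => ⟨0, fun _ _ => rfl, ?_⟩, fun H => ?_⟩
    · rw [map_zero]
      rw [← extendCard_restrict hg, ← mem_ker_koszulMap_iff, H, Submodule.mem_bot] at hdg
      rw [← extendCard_restrict hg, hdg, extendCard_zero]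
    · rw [Submodule.eq_bot_iff]
      intro g hg
      obtain ⟨h, hh, hd⟩ := H _ (supportedAt_extendCard g) ((mem_ker_koszulMap_iff x g).1 hg)
      have h0 : h = 0 := funext fun t => hh t (by push_cast; omega)
      rw [h0, map_zero] at hd
      exact extendCard_injective (by rw [← hd, extendCard_zero])
  | succ i =>
    have hi : ((i + 1 : ℕ) : ℤ) - 1 = i := by push_cast; ring
    refine not_congr ⟨fun H g hg hdg => ?_, fun H g hg => ?_⟩
    · rw [← extendCard_restrict hg, ← mem_ker_koszulMap_iff] at hdg
      obtain ⟨h, hh⟩ := H hdg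
      exact ⟨extendCard h, hi ▸ supportedAt_extendCard h, by
        rw [koszulDiff_extendCard, hh, extendCard_restrict hg]⟩
    · obtain ⟨h, hh, hd⟩ := H _ (supportedAt_extendCard g) ((mem_ker_koszulMap_iff x g).1 hg)
      rw [hi] at hh
      refine ⟨fun s => h s.1, extendCard_injective ?_⟩
      rw [← koszulDiff_extendCard, extendCard_restrict hh, hd]

theorem koszulDiff_localized {S : Submonoid R} {n : ℕ} (x : Fin n → R)
    (g : Finset (Fin n) → LocalizedModule S M) :
    koszulDiff (R := Localization S) (LocalizedModule S M) (fun j => algebraMap R _ (x j)) g =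
      koszulDiff (LocalizedModule S M) x g := by
  funext t
  refine Finset.sum_congr rfl fun j _ => ?_
  rw [← algebraMap_smul (Localization S) (_ * x j)]
  simp

theorem KoszulAcyclic.localized {n : ℕ} {x : Fin n → R} {i : ℤ} (H : KoszulAcyclic M x i)
    (S : Submonoid R) :
    KoszulAcyclic (LocalizedModule S M) (fun j => algebraMap R (Localization S) (x j)) i := by
  intro g hg hdg
  rw [koszulDiff_localized] at hdg
  let f := LocalizedModule.mkLinearMap S M
  let F : (Finset (Fin n) → M) →ₗ[R] (Finset (Fin n) → LocalizedModule S M) :=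
    LinearMap.pi fun t => f ∘ₗ LinearMap.proj t
  have hF : ∀ g, koszulDiff _ x (F g) = F (koszulDiff M x g) := fun g => funext fun t => by
    simp [F, koszulDiff_apply, map_sum]
  have hloc : IsLocalizedModule S F := inferInstance
  obtain ⟨⟨g', s⟩, hs⟩ := IsLocalizedModule.surj S F g
  classical
  let g'' : Finset (Fin n) → M := fun t => if (t.card : ℤ) = i then g' t else 0
  have hs' : s • g = F g'' := by
    funext t
    by_cases ht : (t.card : ℤ) = i
    · rw [hs]
      simp [F, g'', ht]
    · have : F g'' t = 0 := by simp [F, g'', ht]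
      rw [this, Pi.smul_apply, hg t ht, smul_zero]
  obtain ⟨r, hr⟩ := (IsLocalizedModule.eq_zero_iff S F (m := koszulDiff M x g'')).1 (by
    rw [← hF, ← hs', Submonoid.smul_def, map_smul, hdg, smul_zero])
  obtain ⟨h, hh, hd⟩ := H (r • g'') (fun t ht => by simp [g'', ht]) (by
    rw [Submonoid.smul_def, map_smul]
    exact hr)
  obtain ⟨e, he⟩ := ((Module.End.isUnit_iff _).1 (IsLocalizedModule.map_units F (r * s))).2 (F h)
  replace he : (r * s) • e = F h := he
  refine ⟨e, fun t ht => ?_, ?_⟩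
  · apply IsLocalizedModule.smul_injective f (r * s)
    change ((r * s) • e) t = (r * s) • (0 : LocalizedModule S M)
    rw [he, smul_zero]
    simp [F, hh t ht]
  · rw [koszulDiff_localized]
    apply IsLocalizedModule.smul_injective F (r * s)
    change (r * s) • _ = (r * s) • g
    rw [Submonoid.smul_def, ← map_smul, ← Submonoid.smul_def, he, hF, hd, mul_smul, hs',
      Submonoid.smul_def, map_smul]
    rfl

end KoszulDifferential

theorem height_closedPoint_localization {A : Type u} [CommRing A] (p : PrimeSpectrum A) :
    Order.height (IsLocalRing.closedPoint (Localization.AtPrime p.asIdeal)) = Order.height p := by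
  have h := IsLocalization.AtPrime.ringKrullDim_eq_height p.asIdeal
    (Localization.AtPrime p.asIdeal)
  rw [← IsLocalRing.maximalIdeal_height_eq_ringKrullDim] at h
  have h' := WithBot.coe_injective h
  exact (PrimeSpectrum.height_eq_orderHeight _).symm.trans (h'.trans (PrimeSpectrum.height_eq_orderHeight p))

theorem kgrSeq_le_height {A : Type u} [CommRing A] (p : PrimeSpectrum A) (M : Type v)
    [AddCommGroup M] [Module A M] {n : ℕ} (x : Fin n → A)
    (h : kgrSeq (Localization.AtPrime p.asIdeal) (LocalizedModule p.asIdeal.primeCompl M)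
      (fun j => algebraMap A _ (x j)) ≠ ⊤) :
    kgrSeq A M x ≤ Order.height p := by
  by_contra! hlt
  refine h (sInf_eq_top.2 ?_)
  rintro _ ⟨k, -, hk⟩
  refine absurd ((koszulAcyclic_iff_acyclic_kos _ _).2
    (GradedComplex.acyclic_kos_single.{u, max u v} _ _ (fun i hi => ?_) k))
    ((koszulCohomologyNeZero_iff _ k).1 hk)
  rw [← koszulAcyclic_iff_acyclic_kos]
  refine KoszulAcyclic.localized (not_not.1 fun hne => ?_) _
  rw [height_closedPoint_localization] at hi
  exact (hlt.trans_le (sInf_le ⟨i, rfl, (koszulCohomologyNeZero_iff x i).2 hne⟩)).not_ge hi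

/-- If `kgr_{A_𝔭}(𝔭A_𝔭, M_𝔭) < ∞` for every minimal prime `𝔭` over `𝔞`
(e.g. when `M` is finitely generated), then `kgr_A(𝔞, M) ≤ height 𝔞`. -/
theorem kgr_le_idealHeight {A : Type*} [CommRing A] (𝔞 : Ideal A) (M : Type*)
    [AddCommGroup M] [Module A M]
    (h : ∀ (𝔭 : Ideal A) (h𝔭 : 𝔭 ∈ 𝔞.minimalPrimes),
      haveI : 𝔭.IsPrime := h𝔭.1.1
      kgr (Localization.AtPrime 𝔭) (IsLocalRing.maximalIdeal (Localization.AtPrime 𝔭))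
        (LocalizedModule 𝔭.primeCompl M) ≠ ⊤) :
    kgr A 𝔞 M ≤ idealHeight A 𝔞 := by
  refine iSup_le fun n => iSup_le fun x => iSup_le fun hx => le_iInf fun q => le_iInf fun hq => ?_
  obtain ⟨p, hp, hpq⟩ := Ideal.exists_minimalPrimes_le hq
  have hprime : p.IsPrime := hp.1.1
  refine (kgrSeq_le_height ⟨p, hprime⟩ M x fun htop => h p hp (top_unique ?_)).trans
    (Order.height_mono (show (⟨p, hprime⟩ : PrimeSpectrum A) ≤ q from hpq))
  rw [← htop]
  refine le_iSup_of_le n (le_iSup_of_le _ (le_iSup_of_le (fun j => ?_) le_rfl))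
  exact (IsLocalization.AtPrime.to_map_mem_maximal_iff _ p _).2 (hp.1.2 (hx j))
end

section
/- Let A and B be commutative rings, f : A → B a ring homomorphism, J an ideal of B, and 𝒜 a non-empty class of ideals of A. Assume that height 𝔞^e ≥ height 𝔞 for each 𝔞 ∈ 𝒜. If A⋈^f J is Cohen-Macaulay in the sense of 𝒜^e := { 𝔞^e : 𝔞 ∈ 𝒜 }, then A is Cohen-Macaulay in the sense of 𝒜 and kgr_A(𝔞, J) ≥ height 𝔞 for each 𝔞 ∈ 𝒜. -/
universe u v

/-- A module with an endomorphism `D` and a family of submodules `gr`, thought of as the total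
module of a cochain complex. -/
structure DiffModule (R : Type u) [CommRing R] where
  V : Type v
  [addCommGroup : AddCommGroup V]
  [module : Module R V]
  D : V →ₗ[R] V
  gr : ℤ → Submodule R V

namespace DiffModule

attribute [instance] addCommGroup module

variable {R : Type u} [CommRing R]

/-- Every homogeneous cocycle of degree `i` is the coboundary of an element of degree `i - 1`. -/
def ExactAt (C : DiffModule.{u, v} R) (i : ℤ) : Prop :=
  ∀ g ∈ C.gr i, C.D g = 0 → ∃ h ∈ C.gr (i - 1), C.D h = g

/-- A graded isomorphism commuting with the differentials. -/
def Iso (C C' : DiffModule.{u, v} R) : Prop :=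
  ∃ e : C.V ≃ₗ[R] C'.V, (∀ g, e (C.D g) = C'.D (e g)) ∧ ∀ i g, e g ∈ C'.gr i ↔ g ∈ C.gr i

theorem Iso.refl (C : DiffModule.{u, v} R) : C.Iso C :=
  ⟨LinearEquiv.refl R C.V, fun _ => rfl, fun _ _ => Iff.rfl⟩

theorem Iso.symm {C C' : DiffModule.{u, v} R} : C.Iso C' → C'.Iso C := by
  rintro ⟨e, hD, hgr⟩
  refine ⟨e.symm, fun g => ?_, fun i g => ?_⟩
  · rw [LinearEquiv.symm_apply_eq, hD, e.apply_symm_apply]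
  · rw [← hgr, e.apply_symm_apply]

theorem Iso.trans {C C' C'' : DiffModule.{u, v} R} : C.Iso C' → C'.Iso C'' → C.Iso C'' := by
  rintro ⟨e, hD, hgr⟩ ⟨e', hD', hgr'⟩
  exact ⟨e.trans e', fun g => by simp [hD, hD'], fun i g => by simp [hgr, hgr']⟩

theorem Iso.exactAt {C C' : DiffModule.{u, v} R} (h : C.Iso C') {i : ℤ} (hC : C.ExactAt i) :
    C'.ExactAt i := by
  obtain ⟨e, hD, hgr⟩ := h
  intro g hg hg0
  obtain ⟨g, rfl⟩ := e.surjective g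
  rw [← hD, e.map_eq_zero_iff] at hg0
  obtain ⟨h, hh, rfl⟩ := hC g ((hgr i g).1 hg) hg0
  exact ⟨e h, (hgr _ h).2 hh, (hD h).symm⟩

/-- The (shifted) mapping cone of multiplication by `a`. -/
def cone (a : R) (C : DiffModule.{u, v} R) : DiffModule.{u, v} R where
  V := C.V × C.V
  D := (C.D ∘ₗ LinearMap.fst R C.V C.V).prod
    (a • LinearMap.fst R C.V C.V - C.D ∘ₗ LinearMap.snd R C.V C.V)
  gr i := (C.gr i).prod (C.gr (i - 1))

theorem cone_D (a : R) (C : DiffModule.{u, v} R) (p q : C.V) :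
    (cone a C).D (p, q) = (C.D p, a • p - C.D q) := rfl

theorem mem_cone_gr (a : R) (C : DiffModule.{u, v} R) (i : ℤ) (p q : C.V) :
    ((p, q) : C.V × C.V) ∈ (cone a C).gr i ↔ p ∈ C.gr i ∧ q ∈ C.gr (i - 1) := Iff.rfl

theorem Iso.cone {C C' : DiffModule.{u, v} R} (h : C.Iso C') (a : R) :
    (DiffModule.cone a C).Iso (DiffModule.cone a C') := by
  obtain ⟨e, hD, hgr⟩ := h
  refine ⟨e.prodCongr e, ?_, ?_⟩
  · rintro ⟨p, q⟩
    refine Prod.ext (hD p) ?_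
    change e (a • p - C.D q) = a • e p - C'.D (e q)
    rw [map_sub, map_smul, hD]
  · rintro i ⟨p, q⟩
    exact and_congr (hgr i p) (hgr _ q)

theorem cone_cone_iso (a b : R) (C : DiffModule.{u, v} R) :
    (cone a (cone b C)).Iso (cone b (cone a C)) := by
  refine ⟨(LinearEquiv.prodProdProdComm R C.V C.V C.V C.V).trans
    ((LinearEquiv.refl R _).prodCongr ((LinearEquiv.refl R C.V).prodCongr (LinearEquiv.neg R))),
    ?_, ?_⟩
  · rintro ⟨⟨p, q⟩, ⟨r, s⟩⟩
    change (((C.D p, a • p - C.D r), (b • p - C.D q, -(a • q - (b • r - C.D s)))) :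
      (C.V × C.V) × (C.V × C.V)) =
      ((C.D p, a • p - C.D r), (b • p - C.D q, b • r - (a • q - C.D (-s))))
    refine Prod.ext rfl (Prod.ext rfl ?_)
    simp only [map_neg]
    abel
  · rintro i ⟨⟨p, q⟩, ⟨r, s⟩⟩
    change ((p ∈ C.gr i ∧ r ∈ C.gr (i - 1)) ∧ (q ∈ C.gr (i - 1) ∧ -s ∈ C.gr (i - 1 - 1))) ↔
      ((p ∈ C.gr i ∧ q ∈ C.gr (i - 1)) ∧ (r ∈ C.gr (i - 1) ∧ s ∈ C.gr (i - 1 - 1)))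
    rw [neg_mem_iff]
    tauto

theorem ExactAt.cone {C : DiffModule.{u, v} R} {i : ℤ} (h : C.ExactAt i)
    (h' : C.ExactAt (i - 1)) (a : R) : (DiffModule.cone a C).ExactAt i := by
  rintro ⟨p, q⟩ ⟨hp, hq⟩ h0
  rw [cone_D] at h0
  obtain ⟨h1, h2⟩ := Prod.ext_iff.1 h0
  obtain ⟨w, hw, rfl⟩ := h p hp h1
  obtain ⟨z, hz, hz'⟩ := h' (a • w - q) (sub_mem (Submodule.smul_mem _ _ hw) hq)
    (by rw [map_sub, map_smul]; exact h2)
  refine ⟨(w, z), ⟨hw, hz⟩, ?_⟩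
  rw [cone_D, hz', sub_sub_cancel]

/-- The ideal of scalars acting null-homotopically. -/
def nullIdeal (C : DiffModule.{u, v} R) : Ideal R where
  carrier := {c | ∃ s : C.V →ₗ[R] C.V, (∀ i, ∀ g ∈ C.gr i, s g ∈ C.gr (i - 1)) ∧
    ∀ g, C.D (s g) + s (C.D g) = c • g}
  zero_mem' := ⟨0, by simp, by simp⟩
  add_mem' := by
    rintro c c' ⟨s, hs, h⟩ ⟨s', hs', h'⟩
    refine ⟨s + s', fun i g hg => add_mem (hs i g hg) (hs' i g hg), fun g => ?_⟩
    rw [add_smul, ← h, ← h']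
    simp only [LinearMap.add_apply, map_add]
    abel
  smul_mem' := by
    rintro c c' ⟨s, hs, h⟩
    refine ⟨c • s, fun i g hg => Submodule.smul_mem _ _ (hs i g hg), fun g => ?_⟩
    rw [smul_assoc, ← h]
    simp only [LinearMap.smul_apply, map_smul, smul_add]

theorem self_mem_nullIdeal_cone (a : R) (C : DiffModule.{u, v} R) :
    a ∈ (cone a C).nullIdeal := by
  refine ⟨(LinearMap.snd R C.V C.V).prod 0, ?_, ?_⟩
  · rintro i ⟨p, q⟩ ⟨_, hq⟩
    exact ⟨hq, zero_mem _⟩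
  · rintro ⟨p, q⟩
    change ((C.D q + (a • p - C.D q), a • q - C.D 0 + 0) : C.V × C.V) = (a • p, a • q)
    simp

theorem nullIdeal_le_cone (a : R) (C : DiffModule.{u, v} R) :
    C.nullIdeal ≤ (cone a C).nullIdeal := by
  rintro c ⟨s, hs, h⟩
  refine ⟨s.prodMap (-s), ?_, ?_⟩
  · rintro i ⟨p, q⟩ ⟨hp, hq⟩
    exact ⟨hs i p hp, neg_mem (hs _ q hq)⟩
  · rintro ⟨p, q⟩
    change ((C.D (s p) + s (C.D p), (a • s p - C.D (-s q)) + -s (a • p - C.D q)) : C.V × C.V) =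
      (c • p, c • q)
    refine Prod.ext (h p) ?_
    rw [← h q]
    simp only [map_sub, map_smul, map_neg]
    abel

theorem ExactAt.of_cone {C : DiffModule.{u, v} R} {a : R} {i : ℤ}
    (h : (DiffModule.cone a C).ExactAt i)
    (ha : a ∈ C.nullIdeal.radical) : C.ExactAt i := by
  obtain ⟨N, s, hs, hN⟩ := ha
  have key : ∀ N : ℕ, ∀ g ∈ C.gr i, C.D g = 0 → (∃ h ∈ C.gr (i - 1), C.D h = a ^ N • g) →
      ∃ h ∈ C.gr (i - 1), C.D h = g := by
    intro N
    induction N with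
    | zero => simp
    | succ N ih =>
      rintro g hg h0 ⟨w, hw, hw'⟩
      refine ih g hg h0 ?_
      obtain ⟨⟨y, z⟩, ⟨hy, _⟩, hyz⟩ := h (a ^ N • g, w) ⟨Submodule.smul_mem _ _ hg, hw⟩
        (by rw [cone_D, hw', map_smul, h0, smul_smul, ← pow_succ', sub_self, smul_zero]; rfl)
      exact ⟨y, hy, (Prod.ext_iff.1 hyz).1⟩
  intro g hg h0
  refine key N g hg h0 ⟨s g, hs i g hg, ?_⟩
  have := hN g
  rwa [h0, map_zero, add_zero] at this

variable (M : Type v) [AddCommGroup M] [Module R M]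

/-- The module `M` placed in degree `0`. -/
def single : DiffModule.{u, v} R where
  V := M
  D := 0
  gr i := if i = 0 then ⊤ else ⊥

/-- The Koszul cochain complex of a list, as an iterated cone. -/
def kos (l : List R) : DiffModule.{u, v} R := l.foldr cone (single M)

theorem kos_iso_of_perm {l l' : List R} (h : l.Perm l') : (kos M l).Iso (kos M l') := by
  induction h with
  | nil => exact Iso.refl _
  | cons a _ ih => exact ih.cone a
  | swap a b l => exact cone_cone_iso b a (kos M l)
  | trans _ _ ih ih' => exact ih.trans ih'

theorem mem_nullIdeal_kos {l : List R} {a : R} (ha : a ∈ l) : a ∈ (kos M l).nullIdeal := by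
  induction l with
  | nil => simp at ha
  | cons b l ih =>
    rcases List.mem_cons.1 ha with rfl | h
    · exact self_mem_nullIdeal_cone _ _
    · exact nullIdeal_le_cone b _ (ih h)

theorem exactAt_kos_append {k : ℤ} {l : List R} (h : ∀ i < k, (kos M l).ExactAt i)
    (l' : List R) : ∀ i < k, (kos M (l' ++ l)).ExactAt i := by
  induction l' with
  | nil => exact h
  | cons a l' ih => exact fun i hi => (ih i hi).cone (ih (i - 1) (by lia)) a

theorem exactAt_kos_of_append {i : ℤ} {l l' : List R} (h : (kos M (l' ++ l)).ExactAt i)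
    (hl : ∀ a ∈ l', a ∈ (Ideal.span {b | b ∈ l}).radical) : (kos M l).ExactAt i := by
  induction l' with
  | nil => exact h
  | cons a l' ih =>
    refine ih (ExactAt.of_cone h (Ideal.radical_mono ?_ (hl a (by simp))))
      fun b hb => hl b (by simp [hb])
    exact Ideal.span_le.2 fun b hb => mem_nullIdeal_kos M (List.mem_append_right l' hb)

/-- Vanishing of Koszul cohomology below a given degree only improves when the ideal is enlarged
up to radical. -/
theorem exactAt_kos_mono {k : ℤ} {l l' : List R} (h : ∀ i < k, (kos M l).ExactAt i)
    (hl : ∀ a ∈ l, a ∈ (Ideal.span {b | b ∈ l'}).radical) : ∀ i < k, (kos M l').ExactAt i :=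
  fun i hi => exactAt_kos_of_append M
    ((kos_iso_of_perm M List.perm_append_comm).exactAt (exactAt_kos_append M h l' i hi)) hl

variable {M}

/-- The Koszul differential on all functions on subsets. -/
def koszulD {n : ℕ} (x : Fin n → R) : (Finset (Fin n) → M) →ₗ[R] (Finset (Fin n) → M) where
  toFun g t := ∑ j ∈ t, ((-1) ^ (t.filter (· < j)).card * x j) • g (t.erase j)
  map_add' g h := by ext t; simp [Finset.sum_add_distrib]
  map_smul' c g := by
    ext t
    simp only [Pi.smul_apply, RingHom.id_apply, Finset.smul_sum]
    exact Finset.sum_congr rfl fun j _ => smul_comm _ _ _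

theorem koszulD_apply {n : ℕ} (x : Fin n → R) (g : Finset (Fin n) → M) (t : Finset (Fin n)) :
    koszulD x g t = ∑ j ∈ t, ((-1 : R) ^ (t.filter (· < j)).card * x j) • g (t.erase j) := rfl

theorem koszulD_comp {A N : Type*} [CommRing A] [AddCommGroup N] [Module A N] (φ : A →+* R)
    (ψ : N →+ M) (hψ : ∀ a m, ψ (a • m) = φ a • ψ m) {n : ℕ} (x : Fin n → A)
    (g : Finset (Fin n) → N) : koszulD (φ ∘ x) (ψ ∘ g) = ψ ∘ koszulD x g := by
  funext t
  simp [koszulD_apply, hψ]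

variable (R M) in
/-- Functions supported on subsets of cardinality `i`. -/
def homogeneous (n : ℕ) (i : ℤ) : Submodule R (Finset (Fin n) → M) where
  carrier := {g | ∀ t : Finset (Fin n), (t.card : ℤ) ≠ i → g t = 0}
  zero_mem' := by simp
  add_mem' := fun {g h} hg hh t ht => by simp [hg t ht, hh t ht]
  smul_mem' := fun c g hg t ht => by simp [hg t ht]

theorem mem_homogeneous {n : ℕ} {i : ℤ} {g : Finset (Fin n) → M} :
    g ∈ homogeneous R M n i ↔ ∀ t : Finset (Fin n), (t.card : ℤ) ≠ i → g t = 0 := Iff.rfl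

variable (M) in
/-- The Koszul cochain complex of a sequence, with terms the functions on subsets. -/
def cochain {n : ℕ} (x : Fin n → R) : DiffModule.{u, v} R where
  V := Finset (Fin n) → M
  D := koszulD x
  gr := homogeneous R M n

/-- Splitting functions on subsets of `Fin (n + 1)` according to membership of `0`. -/
def splitEquiv (R : Type u) [CommRing R] (M : Type v) [AddCommGroup M] [Module R M] (n : ℕ) :
    (Finset (Fin (n + 1)) → M) ≃ₗ[R] (Finset (Fin n) → M) × (Finset (Fin n) → M) where
  toFun g := (fun s => g (s.map (Fin.succEmb n)), fun s => g (insert 0 (s.map (Fin.succEmb n))))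
  map_add' _ _ := rfl
  map_smul' _ _ := rfl
  invFun p t := if 0 ∈ t then p.2 (Finset.univ.filter fun i : Fin n => i.succ ∈ t)
    else p.1 (Finset.univ.filter fun i : Fin n => i.succ ∈ t)
  left_inv g := by
    ext t
    by_cases h : 0 ∈ t
    · simp only [h, if_true]
      congr 1
      ext i
      refine Fin.cases ?_ (fun i => ?_) i <;> simp [h]
    · simp only [h, if_false]
      congr 1
      ext i
      refine Fin.cases ?_ (fun i => ?_) i <;> simp [h]
  right_inv p := by
    refine Prod.ext (funext fun s => ?_) (funext fun s => ?_) <;> simp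

theorem cochain_succ_iso {n : ℕ} (x : Fin (n + 1) → R) :
    (cochain M x).Iso (cone (x 0) (cochain M (Fin.tail x))) := by
  have hfil (s : Finset (Fin n)) (j : Fin n) :
      (s.map (Fin.succEmb n)).filter (· < j.succ) = (s.filter (· < j)).map (Fin.succEmb n) := by
    ext i
    refine Fin.cases ?_ (fun i => ?_) i <;> simp
  have h0 (s : Finset (Fin n)) : 0 ∉ s.map (Fin.succEmb n) := by simp
  refine ⟨splitEquiv R M n, fun (g : Finset (Fin (n + 1)) → M) =>
    Prod.ext (funext fun s => ?_) (funext fun s => ?_),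
    fun i (g : Finset (Fin (n + 1)) → M) => ?_⟩
  · change koszulD x g (s.map (Fin.succEmb n)) =
      koszulD (Fin.tail x) (fun s => g (s.map (Fin.succEmb n))) s
    rw [koszulD_apply, koszulD_apply, Finset.sum_map]
    refine Finset.sum_congr rfl fun j _ => ?_
    rw [Finset.map_erase, Fin.coe_succEmb, hfil, Finset.card_map]
    rfl
  · change koszulD x g (insert 0 (s.map (Fin.succEmb n))) =
      x 0 • g (s.map (Fin.succEmb n)) -
      koszulD (Fin.tail x) (fun s => g (insert 0 (s.map (Fin.succEmb n)))) s
    rw [koszulD_apply, koszulD_apply, Finset.sum_insert (h0 s), Finset.sum_map, sub_eq_add_neg,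
      ← Finset.sum_neg_distrib]
    congr 1
    · rw [Finset.erase_insert (h0 s)]
      simp
    · refine Finset.sum_congr rfl fun j _ => ?_
      rw [Finset.map_erase, Fin.coe_succEmb, Finset.filter_insert, hfil,
        if_pos (Fin.succ_pos j), Finset.card_insert_of_notMem (by simp), Finset.card_map,
        Finset.erase_insert_of_ne (Fin.succ_ne_zero j).symm, pow_succ, mul_neg_one, neg_mul,
        neg_smul]
      rfl
  · change ((∀ s : Finset (Fin n), (s.card : ℤ) ≠ i → g (s.map (Fin.succEmb n)) = 0) ∧
      (∀ s : Finset (Fin n), (s.card : ℤ) ≠ i - 1 → g (insert 0 (s.map (Fin.succEmb n))) = 0)) ↔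
      ∀ t : Finset (Fin (n + 1)), (t.card : ℤ) ≠ i → g t = 0
    constructor
    · rintro ⟨hu, hv⟩ t ht
      set s : Finset (Fin n) := Finset.univ.filter fun i : Fin n => i.succ ∈ t with hs
      by_cases h : 0 ∈ t
      · have : t = insert 0 (s.map (Fin.succEmb n)) := by
          ext i
          refine Fin.cases ?_ (fun i => ?_) i <;> simp [h, hs]
        rw [this] at ht ⊢
        refine hv s fun hc => ht ?_
        rw [Finset.card_insert_of_notMem (h0 s), Finset.card_map]
        push_cast
        lia
      · have : t = s.map (Fin.succEmb n) := by
          ext i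
          refine Fin.cases ?_ (fun i => ?_) i <;> simp [h, hs]
        rw [this] at ht ⊢
        exact hu s (by rwa [Finset.card_map] at ht)
    · refine fun h => ⟨fun s hs => h _ (by rwa [Finset.card_map]), fun s hs => h _ ?_⟩
      rw [Finset.card_insert_of_notMem (h0 s), Finset.card_map]
      push_cast
      lia

theorem cochain_iso_kos {n : ℕ} (x : Fin n → R) :
    (cochain M x).Iso (kos M (List.ofFn x)) := by
  induction n with
  | zero =>
    refine ⟨LinearEquiv.funUnique (Finset (Fin 0)) R M,
      fun (g : Finset (Fin 0) → M) => ?_, fun i (g : Finset (Fin 0) → M) => ?_⟩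
    · change koszulD x g ∅ = 0
      rw [koszulD_apply, Finset.sum_empty]
    · change g ∅ ∈ (if i = 0 then ⊤ else ⊥ : Submodule R M) ↔ _
      change _ ↔ g ∈ homogeneous R M 0 i
      rw [mem_homogeneous, (Unique.forall_iff (α := Finset (Fin 0)))]
      have hd : (default : Finset (Fin 0)) = ∅ := rfl
      rw [hd]
      by_cases hi : i = 0
      · simp [hi]
      · simp [hi, Ne.symm hi]
  | succ n ih =>
    rw [List.ofFn_succ]
    exact (cochain_succ_iso x).trans ((ih _).cone _)

theorem exactAt_cochain_mono {k : ℤ} {m n : ℕ} {x : Fin m → R} {y : Fin n → R}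
    (h : ∀ i < k, (cochain M x).ExactAt i)
    (hxy : ∀ j, x j ∈ (Ideal.span (Set.range y)).radical) : ∀ i < k, (cochain M y).ExactAt i := by
  intro i hi
  refine (cochain_iso_kos y).symm.exactAt
    (exactAt_kos_mono M (fun i hi => (cochain_iso_kos x).exactAt (h i hi)) ?_ i hi)
  intro a ha
  obtain ⟨j, rfl⟩ := (List.mem_ofFn' x a).1 ha
  have : {b | b ∈ List.ofFn y} = Set.range y := by
    ext b
    exact List.mem_ofFn' y b
  rw [this]
  exact hxy j

/-- Restriction of a function on all subsets to the subsets of cardinality `k`. -/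
def res {n : ℕ} (k : ℕ) (g : Finset (Fin n) → M) : {s : Finset (Fin n) // s.card = k} → M :=
  fun s => g s.1

theorem koszulMap_res {n : ℕ} (x : Fin n → R) (k : ℕ) (g : Finset (Fin n) → M) :
    koszulMap R M x k (res k g) = res (k + 1) (koszulD x g) := by
  funext t
  exact Finset.sum_attach t.1
    (fun j => ((-1 : R) ^ (t.1.filter (· < j)).card * x j) • g (t.1.erase j))

theorem koszulD_mem {n : ℕ} (x : Fin n → R) {k : ℤ} {g : Finset (Fin n) → M}
    (hg : g ∈ homogeneous R M n k) : koszulD x g ∈ homogeneous R M n (k + 1) := by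
  intro t ht
  refine Finset.sum_eq_zero fun j hj => ?_
  rw [hg, smul_zero]
  have := Finset.card_erase_add_one hj
  lia

theorem exists_res_eq {n k : ℕ} (φ : {s : Finset (Fin n) // s.card = k} → M) :
    ∃ g ∈ homogeneous R M n k, res k g = φ := by
  refine ⟨fun t => if h : t.card = k then φ ⟨t, h⟩ else 0, fun t ht => ?_, ?_⟩
  · exact dif_neg (by exact_mod_cast ht)
  · funext s
    exact dif_pos s.2

theorem res_injective {n k : ℕ} {g g' : Finset (Fin n) → M} (hg : g ∈ homogeneous R M n k)
    (hg' : g' ∈ homogeneous R M n k) (h : res k g = res k g') : g = g' := by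
  funext t
  by_cases ht : t.card = k
  · exact congrFun h ⟨t, ht⟩
  · rw [hg t (by exact_mod_cast ht), hg' t (by exact_mod_cast ht)]

theorem koszulMap_res_eq_zero {n k : ℕ} (x : Fin n → R) {g : Finset (Fin n) → M}
    (hg : g ∈ homogeneous R M n k) : koszulMap R M x k (res k g) = 0 ↔ koszulD x g = 0 := by
  rw [koszulMap_res]
  refine ⟨fun h => res_injective (R := R) (k := k + 1) ?_ (zero_mem _) h, fun h => by rw [h]; rfl⟩
  exact_mod_cast koszulD_mem x hg

theorem koszulCohomologyNeZero_iff {n : ℕ} (x : Fin n → R) (k : ℕ) :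
    koszulCohomologyNeZero R M x k ↔ ¬ (cochain M x).ExactAt k := by
  cases k with
  | zero =>
    refine not_congr ⟨fun h => ?_, fun h => ?_⟩
    · intro (g : Finset (Fin n) → M) hg hg0
      refine ⟨0, zero_mem _, (map_zero _).trans ?_⟩
      have : res 0 g ∈ LinearMap.ker (koszulMap R M x 0) := (koszulMap_res_eq_zero x hg).2 hg0
      rw [h, Submodule.mem_bot] at this
      exact (res_injective hg (zero_mem _) this).symm
    · rw [eq_bot_iff]
      intro φ hφ
      obtain ⟨g, hg, rfl⟩ := exists_res_eq (R := R) φ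
      obtain ⟨w, hw, rfl⟩ := h g hg ((koszulMap_res_eq_zero x hg).1 hφ)
      have : w = 0 := funext fun t => hw t (by push_cast; lia)
      rw [this, map_zero]
      exact zero_mem _
  | succ k =>
    refine not_congr ⟨fun h => ?_, fun h => ?_⟩
    · intro (g : Finset (Fin n) → M) hg hg0
      obtain ⟨φ, hφ⟩ := h ((koszulMap_res_eq_zero x hg).2 hg0)
      obtain ⟨w, hw, rfl⟩ := exists_res_eq (R := R) φ
      rw [koszulMap_res] at hφ
      refine ⟨w, by push_cast; rwa [add_sub_cancel_right], res_injective ?_ hg hφ⟩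
      exact_mod_cast koszulD_mem x hw
    · intro φ hφ
      obtain ⟨g, hg, rfl⟩ := exists_res_eq (R := R) φ
      obtain ⟨w, hw, rfl⟩ := h g hg ((koszulMap_res_eq_zero x hg).1 hφ)
      exact ⟨res k w, koszulMap_res x k w⟩

theorem kgrSeq_le {n : ℕ} {x : Fin n → R} {k : ℕ} (h : ¬ (cochain M x).ExactAt k) :
    kgrSeq R M x ≤ k :=
  sInf_le ⟨k, rfl, (koszulCohomologyNeZero_iff x k).2 h⟩

theorem exactAt_of_lt_kgrSeq {n : ℕ} {x : Fin n → R} {k : ℕ} (h : k < kgrSeq R M x) :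
    (cochain M x).ExactAt k := by
  by_contra hc
  exact (kgrSeq_le hc).not_gt h

theorem kgrSeq_le_kgrSeq {S : Type*} [CommRing S] {N : Type*} [AddCommGroup N] [Module S N]
    {m n : ℕ} {x : Fin m → R} {y : Fin n → S}
    (h : ∀ k : ℕ, (∀ i : ℤ, i ≤ k → (cochain M x).ExactAt i) → (cochain N y).ExactAt k) :
    kgrSeq R M x ≤ kgrSeq S N y := by
  refine le_sInf ?_
  rintro _ ⟨k, rfl, hk⟩
  by_contra! hlt
  refine (koszulCohomologyNeZero_iff y k).1 hk (h k fun i hi => ?_)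
  rcases lt_or_ge i 0 with h0 | h0
  · intro g hg _
    have : g = 0 := funext fun t => hg t (by lia)
    exact ⟨0, zero_mem _, by rw [this, map_zero]⟩
  · lift i to ℕ using h0
    exact exactAt_of_lt_kgrSeq (lt_of_le_of_lt (by exact_mod_cast hi) hlt)

theorem kgrSeq_mono {m n : ℕ} {x : Fin m → R} {y : Fin n → R}
    (hxy : ∀ j, x j ∈ (Ideal.span (Set.range y)).radical) : kgrSeq R M x ≤ kgrSeq R M y :=
  kgrSeq_le_kgrSeq fun k h =>
    exactAt_cochain_mono (k := k + 1) (fun i hi => h i (by lia)) hxy k (by lia)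

theorem kgrSeq_le_of_retract {A N : Type*} [CommRing A] [AddCommGroup N] [Module A N]
    (φ : A →+* R) (ψ : N →+ M) (hψ : ∀ a m, ψ (a • m) = φ a • ψ m) (ρ : M →+ N)
    (hρ : ∀ a m, ρ (φ a • m) = a • ρ m) (hρψ : ∀ m, ρ (ψ m) = m) {n : ℕ} (x : Fin n → A) :
    kgrSeq R M (φ ∘ x) ≤ kgrSeq A N x := by
  refine kgrSeq_le_kgrSeq fun k h => ?_
  intro (g : Finset (Fin n) → N) hg (hg0 : koszulD x g = 0)
  obtain ⟨(w : Finset (Fin n) → M), hw, hw'⟩ := h k le_rfl (ψ ∘ g) (fun t ht => by simp [hg t ht])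
    ((koszulD_comp φ ψ hψ x g).trans (by rw [hg0]; exact funext fun _ => map_zero ψ))
  refine ⟨ρ ∘ w, fun t ht => (congrArg ρ (hw t ht)).trans (map_zero ρ), ?_⟩
  have hcomp : koszulD x (ρ ∘ w) = ρ ∘ koszulD (φ ∘ x) w := by
    funext t
    have hρ' (k : ℕ) (a : A) (m : M) :
        ρ (((-1) ^ k * φ a) • m) = ((-1) ^ k * a) • ρ m := by
      rw [← hρ]
      simp
    simp [koszulD_apply, hρ']
  refine hcomp.trans (funext fun t => ?_)
  exact (congrArg ρ (congrFun hw' t)).trans (hρψ _)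

theorem kgrSeq_le_localization (S : Submonoid R) (L : Type*) [CommRing L] [Algebra R L]
    [IsLocalization S L] {n : ℕ} (x : Fin n → R) :
    kgrSeq R R x ≤ kgrSeq L L (algebraMap R L ∘ x) := by
  refine kgrSeq_le_kgrSeq fun k h => ?_
  intro (g : Finset (Fin n) → L) hg (hg0 : koszulD (algebraMap R L ∘ x) g = 0)
  have hcomp := koszulD_comp (algebraMap R L) (algebraMap R L : R →+ L)
    (fun a m => by simp) x
  obtain ⟨s, hs⟩ := IsLocalization.exist_integer_multiples_of_finite S g
  have hint : ∀ t : Finset (Fin n),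
      ∃ r : R, algebraMap R L r = algebraMap R L s * g t ∧ ((t.card : ℤ) ≠ k → r = 0) := fun t => by
    by_cases ht : (t.card : ℤ) = k
    · obtain ⟨r, hr⟩ := hs t
      exact ⟨r, by rw [hr, Algebra.smul_def], fun h => (h ht).elim⟩
    · exact ⟨0, by rw [hg t ht, mul_zero, map_zero], fun _ => rfl⟩
  choose g' hg' hsupp using hint
  have hg'' : (algebraMap R L : R →+ L) ∘ g' = algebraMap R L s • g := funext hg'
  have hann : ∀ t, ∃ c : S, c * koszulD x g' t = 0 := fun t => by
    refine (IsLocalization.map_eq_zero_iff S L _).1 ?_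
    have := congrFun (hcomp g') t
    rw [hg'', map_smul, hg0, smul_zero] at this
    exact this.symm
  choose c hc using hann
  obtain ⟨(w : Finset (Fin n) → R), hw, hw'⟩ := h k le_rfl (((∏ t, c t : S) : R) • g')
    (Submodule.smul_mem _ _ hsupp) (by
      change koszulD x (((∏ t, c t : S) : R) • g') = 0
      rw [map_smul]
      funext t
      obtain ⟨e, he⟩ := Finset.dvd_prod_of_mem c (Finset.mem_univ t)
      rw [he, Pi.smul_apply, smul_eq_mul, Submonoid.coe_mul, mul_right_comm, hc, zero_mul]
      rfl)
  have hu := IsLocalization.map_units L ((∏ t, c t) * s)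
  obtain ⟨v, hv⟩ := hu
  refine ⟨(↑v⁻¹ : L) • ((algebraMap R L : R →+ L) ∘ w), Submodule.smul_mem _ _ fun t ht => ?_, ?_⟩
  · exact (congrArg (algebraMap R L) (hw t ht)).trans (map_zero _)
  · change koszulD (algebraMap R L ∘ x) (_ • _) = g
    rw [map_smul]
    rw [hcomp]
    funext t
    have h1 := congrFun hw' t
    change koszulD x w t = ((∏ t, c t : S) : R) * g' t at h1
    change (↑v⁻¹ : L) * algebraMap R L (koszulD x w t) = g t
    rw [h1, map_mul, hg', ← mul_assoc (algebraMap R L _), ← map_mul, ← Submonoid.coe_mul, ← hv,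
      Units.inv_mul_cancel_left]

theorem kgrSeq_self_le {n : ℕ} {y : Fin n → R} (hy : Ideal.span (Set.range y) ≠ ⊤) :
    kgrSeq R R y ≤ n := by
  refine kgrSeq_le fun h => hy ?_
  obtain ⟨(w : Finset (Fin n) → R), -, hw'⟩ := h (fun t => if t = Finset.univ then 1 else 0)
    (fun t ht => if_neg fun h => ht (by rw [h, Finset.card_univ, Fintype.card_fin]))
    (funext fun t => Finset.sum_eq_zero fun j hj => by
      have hj : t.erase j ≠ Finset.univ :=
        fun h => Finset.notMem_erase j t (h.symm ▸ Finset.mem_univ j)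
      change _ • (if t.erase j = Finset.univ then (1 : R) else 0) = 0
      rw [if_neg hj, smul_zero])
  rw [Ideal.eq_top_iff_one]
  have h1 : koszulD y w Finset.univ = 1 := (congrFun hw' Finset.univ).trans (if_pos rfl)
  rw [← h1, koszulD_apply]
  refine sum_mem fun j _ => Ideal.mul_mem_right _ _ (Ideal.mul_mem_left _ _ ?_)
  exact Ideal.subset_span ⟨j, rfl⟩

end DiffModule

theorem Ideal.exists_notMem_mul_mem_radical_of_mem_minimalPrimes {R : Type*} [CommRing R]
    {I q : Ideal R} (hq : q ∈ I.minimalPrimes) {b : R} (hb : b ∈ q) :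
    ∃ z ∉ q, z * b ∈ I.radical := by
  have := hq.1.1
  have hmem : algebraMap R (Localization.AtPrime q) b ∈
      (I.map (algebraMap R (Localization.AtPrime q))).radical := by
    rw [IsLocalization.AtPrime.radical_map_of_mem_minimalPrimes _ q I hq]
    exact Ideal.mem_map_of_mem _ hb
  obtain ⟨n, hn⟩ := hmem
  rw [← map_pow, IsLocalization.algebraMap_mem_map_algebraMap_iff q.primeCompl] at hn
  obtain ⟨z, hz, hzb⟩ := hn
  refine ⟨z, hz, n + 1, ?_⟩
  have : (z * b) ^ (n + 1) = (z ^ n * b) * (z * b ^ n) := by ring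
  rw [this]
  exact Ideal.mul_mem_left _ _ hzb

/-- Kronecker's theorem in a local ring, relative to an ideal `I`: an element of the maximal ideal
can be absorbed, up to radical, into as many elements as the dimension of `R ⧸ I`. -/
theorem IsLocalRing.exists_mem_radical_span_add_mul {R : Type*} [CommRing R] [IsLocalRing R]
    {a : R} (ha : a ∈ IsLocalRing.maximalIdeal R) (n : ℕ) (I : Ideal R)
    (hI : ∀ s : LTSeries (PrimeSpectrum R), I ≤ s.head.asIdeal → s.length ≤ n) (b : Fin n → R) :
    ∃ y : Fin n → R, a ∈ (I ⊔ Ideal.span (Set.range fun j => b j + a * y j)).radical := by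
  induction n generalizing I with
  | zero =>
    refine ⟨Fin.elim0, ?_⟩
    rw [Ideal.radical_eq_sInf, Submodule.mem_sInf]
    rintro q ⟨hq, hq'⟩
    by_contra haq
    have hlt : (⟨q, hq'⟩ : PrimeSpectrum R) < IsLocalRing.closedPoint R :=
      lt_of_le_of_ne (IsLocalRing.le_maximalIdeal hq'.ne_top)
        fun h => haq (by
          have := congrArg PrimeSpectrum.asIdeal h
          change q = _ at this
          rw [this]
          exact ha)
    exact Nat.not_succ_le_zero _
      (hI ((RelSeries.singleton _ (IsLocalRing.closedPoint R)).cons ⟨q, hq'⟩ hlt)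
        (le_sup_left.trans hq))
  | succ n ih =>
    obtain ⟨y, N, hy⟩ := ih (I ⊔ Ideal.span {b 0} ⊔ I.radical.colon {b 0})
      (fun s hs => by
        obtain ⟨q, hq, hqs⟩ := Ideal.exists_minimalPrimes_le
          ((le_sup_left.trans le_sup_left).trans hs)
        have hb : b 0 ∈ s.head.asIdeal :=
          hs (Ideal.mem_sup_left (Ideal.mem_sup_right (Ideal.mem_span_singleton_self _)))
        have hne : q ≠ s.head.asIdeal := by
          intro h
          obtain ⟨z, hz, hzb⟩ :=
            Ideal.exists_notMem_mul_mem_radical_of_mem_minimalPrimes hq (h ▸ hb)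
          refine hz (h ▸ hs (Ideal.mem_sup_right ?_))
          exact Submodule.mem_colon_singleton.2 hzb
        have hlt : (⟨q, hq.1.1⟩ : PrimeSpectrum R) < s.head :=
          lt_of_le_of_ne hqs fun h => hne (congrArg PrimeSpectrum.asIdeal h)
        have := hI (RelSeries.cons s ⟨q, hq.1.1⟩ hlt) hq.1.2
        simp only [RelSeries.cons_length] at this
        lia) (Fin.tail b)
    obtain ⟨u, hu, t, ht, hut⟩ := Submodule.mem_sup.1 hy
    obtain ⟨u', hu', z, hz, rfl⟩ := Submodule.mem_sup.1 hu
    have hzb : z * b 0 ∈ I.radical := Submodule.mem_colon_singleton.1 hz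
    refine ⟨Fin.cons z y, ?_⟩
    rw [Ideal.radical_eq_sInf, Submodule.mem_sInf]
    rintro q ⟨hq, hq'⟩
    have hIq : I ≤ q := le_sup_left.trans hq
    have hgen (j : Fin (n + 1)) : b j + a * (Fin.cons z y : Fin (n + 1) → R) j ∈ q :=
      hq (Ideal.mem_sup_right (Ideal.subset_span ⟨j, rfl⟩))
    have htq : t ∈ q := by
      refine (Ideal.span_le.2 ?_) ht
      rintro _ ⟨j, rfl⟩
      exact hgen j.succ
    have hzbq : z * b 0 ∈ q := hq'.radical_le_iff.2 hIq hzb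
    have h0 : b 0 + a * z ∈ q := hgen 0
    by_cases haz : z ∈ q
    · have hb0 : b 0 ∈ q := (Ideal.add_mem_iff_left q (Ideal.mul_mem_left q a haz)).1 h0
      refine hq'.mem_of_pow_mem N ?_
      rw [← hut]
      refine add_mem (add_mem ?_ haz) htq
      refine (sup_le hIq ?_) hu'
      rwa [Ideal.span_singleton_le_iff_mem]
    · have h1 : a * z * z ∈ q := by
        have : a * z * z = z * (b 0 + a * z) - z * b 0 := by ring
        rw [this]
        exact sub_mem (Ideal.mul_mem_left q z h0) hzbq
      exact (hq'.mem_or_mem ((hq'.mem_or_mem h1).resolve_right haz)).resolve_right haz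

theorem IsLocalRing.exists_radical_span {R : Type*} [CommRing R] [IsLocalRing R] {n : ℕ}
    (hR : ∀ s : LTSeries (PrimeSpectrum R), s.length ≤ n) {m : ℕ} (x : Fin m → R)
    (hx : ∀ j, x j ∈ IsLocalRing.maximalIdeal R) :
    ∃ y : Fin n → R, (∀ j, y j ∈ IsLocalRing.maximalIdeal R) ∧
      ∀ j, x j ∈ (Ideal.span (Set.range y)).radical := by
  induction m with
  | zero => exact ⟨0, fun _ => zero_mem _, fun j => j.elim0⟩
  | succ m ih =>
    obtain ⟨b, hb, hxb⟩ := ih (Fin.tail x) fun j => hx j.succ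
    obtain ⟨y, hy⟩ := IsLocalRing.exists_mem_radical_span_add_mul (hx 0) n ⊥ (fun s _ => hR s) b
    rw [bot_sup_eq] at hy
    refine ⟨_, fun j => add_mem (hb j) (Ideal.mul_mem_right _ _ (hx 0)), Fin.cases hy fun j => ?_⟩
    refine Ideal.radical_le_radical_iff.2 (Ideal.span_le.2 ?_) (hxb j)
    rintro _ ⟨i, rfl⟩
    refine (Ideal.add_mem_iff_left _ (Ideal.mul_mem_right (y i) _ hy)).1 ?_
    exact Ideal.le_radical (Ideal.subset_span ⟨i, rfl⟩)

theorem kgrSeq_le_height_s9 {R : Type*} [CommRing R] (p : PrimeSpectrum R) {m : ℕ} (x : Fin m → R)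
    (hx : ∀ j, x j ∈ p.asIdeal) : kgrSeq R R x ≤ Order.height p := by
  rcases eq_or_ne (Order.height p) ⊤ with h | h
  · exact h ▸ le_top
  obtain ⟨n, hn⟩ := ENat.ne_top_iff_exists.1 h
  rw [← hn]
  let L := Localization.AtPrime p.asIdeal
  have hmono : StrictMono (PrimeSpectrum.comap (algebraMap R L)) :=
    Monotone.strictMono_of_injective (fun _ _ h => Ideal.comap_mono h)
      (PrimeSpectrum.localization_comap_injective L p.asIdeal.primeCompl)
  have hdim (s : LTSeries (PrimeSpectrum L)) : s.length ≤ n := by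
    have := Order.length_le_height (p := s.map _ hmono) (x := p) (by
      rw [LTSeries.last_map]
      change Ideal.comap (algebraMap R L) s.last.asIdeal ≤ p.asIdeal
      exact (Ideal.comap_mono (IsLocalRing.le_maximalIdeal s.last.2.ne_top)).trans
        (IsLocalization.AtPrime.under_maximalIdeal L p.asIdeal).le)
    rw [← hn] at this
    exact_mod_cast this
  obtain ⟨y, hy, hxy⟩ := IsLocalRing.exists_radical_span hdim (algebraMap R L ∘ x) fun j =>
    (IsLocalization.AtPrime.to_map_mem_maximal_iff L p.asIdeal (x j)).2 (hx j)
  refine (DiffModule.kgrSeq_le_localization p.asIdeal.primeCompl L x).trans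
    ((DiffModule.kgrSeq_mono hxy).trans (DiffModule.kgrSeq_self_le fun htop => ?_))
  refine (IsLocalRing.maximalIdeal.isMaximal L).ne_top (top_le_iff.1 (htop ▸ Ideal.span_le.2 ?_))
  rintro _ ⟨j, rfl⟩
  exact hy j

/-- The Koszul grade of an ideal is at most its height. -/
theorem kgr_le_idealHeight_s9 {R : Type*} [CommRing R] (𝔞 : Ideal R) :
    kgr R 𝔞 R ≤ idealHeight R 𝔞 :=
  iSup_le fun _ => iSup_le fun x => iSup_le fun hx => le_iInf fun p => le_iInf fun hp =>
    kgrSeq_le_height_s9 p x fun j => hp (hx j)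

theorem Ideal.exists_fin_span_of_mem_map {A R : Type*} [CommRing A] [CommRing R] (φ : A →+* R)
    (𝔞 : Ideal A) {n : ℕ} (z : Fin n → R) (hz : ∀ j, z j ∈ 𝔞.map φ) :
    ∃ (m : ℕ) (x : Fin m → A), (∀ j, x j ∈ 𝔞) ∧
      ∀ j, z j ∈ Ideal.span (Set.range (φ ∘ x)) := by
  classical
  choose T hT hzT using fun j => Submodule.mem_span_finite_of_mem_span (hz j)
  obtain ⟨T', hT', hTT'⟩ := (Finset.subset_set_image_iff (s := (𝔞 : Set A)) (f := φ)
    (t := Finset.univ.biUnion T)).1 (by simpa using hT)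
  refine ⟨T'.card, fun j => T'.equivFin.symm j, fun j => hT' (T'.equivFin.symm j).2, fun j => ?_⟩
  refine Ideal.span_mono ?_ (hzT j)
  intro t ht
  have : t ∈ T'.image φ := hTT' ▸ Finset.mem_biUnion.2 ⟨j, Finset.mem_univ j, ht⟩
  obtain ⟨s, hs, rfl⟩ := Finset.mem_image.1 this
  exact ⟨T'.equivFin ⟨s, hs⟩, by simp⟩

theorem kgr_map_le_of_retract {A R N : Type*} [CommRing A] [CommRing R] [AddCommGroup N]
    [Module A N] (φ : A →+* R) (ψ : N →+ R) (hψ : ∀ a m, ψ (a • m) = φ a * ψ m) (ρ : R →+ N)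
    (hρ : ∀ a m, ρ (φ a * m) = a • ρ m) (hρψ : ∀ m, ρ (ψ m) = m) (𝔞 : Ideal A) :
    kgr R (𝔞.map φ) R ≤ kgr A 𝔞 N := by
  refine iSup_le fun n => iSup_le fun z => iSup_le fun hz => ?_
  obtain ⟨m, x, hx, hzx⟩ := Ideal.exists_fin_span_of_mem_map φ 𝔞 z hz
  refine (DiffModule.kgrSeq_mono fun j => Ideal.le_radical (hzx j)).trans
    ((DiffModule.kgrSeq_le_of_retract φ ψ hψ ρ hρ hρψ x).trans ?_)
  exact le_iSup_of_le m (le_iSup_of_le x (le_iSup_of_le hx le_rfl))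

section Amalgamation

variable {A B : Type*} [CommRing A] [CommRing B] (f : A →+* B) (J : Ideal B) (𝔞 : Ideal A)

theorem kgr_idealExt_le :
    kgr (amalgamation f J) (idealExt f J 𝔞) (amalgamation f J) ≤ kgr A 𝔞 A :=
  kgr_map_le_of_retract (amalgIota f J) (amalgIota f J : A →+ amalgamation f J)
    (fun a m => map_mul (amalgIota f J) a m)
    ((RingHom.fst A B).comp (amalgamation f J).subtype : amalgamation f J →+ A)
    (fun _ _ => rfl) (fun _ => rfl) 𝔞

theorem kgr_idealExt_le_kgrIdeal :
    kgr (amalgamation f J) (idealExt f J 𝔞) (amalgamation f J) ≤ kgrIdeal f J 𝔞 := by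
  let : Module A J := Module.compHom J f
  exact kgr_map_le_of_retract (N := J) (amalgIota f J)
    { toFun j := ⟨(0, j), show (j : B) - f 0 ∈ J by simp⟩
      map_zero' := rfl
      map_add' _ _ := Subtype.ext (Prod.ext (add_zero 0).symm rfl) }
    (fun a _ => Subtype.ext (Prod.ext (mul_zero a).symm rfl))
    { toFun r := ⟨r.1.2 - f r.1.1, r.2⟩
      map_zero' := Subtype.ext (by simp)
      map_add' r s := Subtype.ext (by simp; ring) }
    (fun a r => Subtype.ext (by
      change f a * r.1.2 - f (a * r.1.1) = f a * (r.1.2 - f r.1.1)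
      rw [map_mul, mul_sub]))
    (fun j => Subtype.ext (by simp)) 𝔞

end Amalgamation

/-- Let `𝒜` be a non-empty class of ideals of `A` with
`height 𝔞^e ≥ height 𝔞` for each `𝔞 ∈ 𝒜`. If `A⋈^f J` is Cohen-Macaulay in the sense of
`𝒜^e`, then `A` is Cohen-Macaulay in the sense of `𝒜` and `kgr_A(𝔞, J) ≥ height 𝔞` for
each `𝔞 ∈ 𝒜`. -/
theorem isCMSense_of_isCMSense_ext {A B : Type*} [CommRing A] [CommRing B]
    (f : A →+* B) (J : Ideal B) (𝒜 : Set (Ideal A)) (h𝒜 : 𝒜.Nonempty)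
    (hht : ∀ 𝔞 ∈ 𝒜, idealHeight A 𝔞 ≤ idealHeight ↥(amalgamation f J) (idealExt f J 𝔞))
    (hCM : IsCMSense ↥(amalgamation f J) (idealExt f J '' 𝒜)) :
    IsCMSense A 𝒜 ∧ ∀ 𝔞 ∈ 𝒜, idealHeight A 𝔞 ≤ kgrIdeal f J 𝔞 := by
  have hle (𝔞) (h𝔞 : 𝔞 ∈ 𝒜) : idealHeight A 𝔞 ≤
      kgr (amalgamation f J) (idealExt f J 𝔞) (amalgamation f J) :=
    (hht 𝔞 h𝔞).trans (hCM _ ⟨𝔞, h𝔞, rfl⟩).le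
  exact ⟨fun 𝔞 h𝔞 => ((hle 𝔞 h𝔞).trans (kgr_idealExt_le f J 𝔞)).antisymm (kgr_le_idealHeight_s9 𝔞),
    fun 𝔞 h𝔞 => (hle 𝔞 h𝔞).trans (kgr_idealExt_le_kgrIdeal f J 𝔞)⟩
end
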